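/- arXiv:2602.04286 — 3 statements merged into one kernel-verified Lean document; each statement's English description precedes it below -/
import Mathlib

section
/- Let M = (M,<,…) be an almost o-minimal structure that is neither downward o-minimal nor upward o-minimal. Let N be an elementary extension of M in which M is both cofinal and coinitial. Then N is almost o-minimal (and neither downward nor upward o-minimal). -/
open FirstOrder FirstOrder.Language

universe u v w x

/-- A subset of a linear order is an open interval (possibly unbounded). -/
def IsOpenIntervalSet {M : Type w} [LinearOrder M] (s : Set M) : Prop :=
  (∃ a b : M, s = Set.Ioo a b) ∨ (∃ a : M, s = Set.Ioi a) ∨ (∃ b : M, s = Set.Iio b) ∨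
    s = Set.univ

/-- `s` is a finite union of points and open intervals. -/
def IsFinUnionPointsIntervals {M : Type w} [LinearOrder M] (s : Set M) : Prop :=
  ∃ (F : Finset M) (n : ℕ) (J : Fin n → Set M),
    (∀ k, IsOpenIntervalSet (J k)) ∧ s = ↑F ∪ ⋃ k, J k

/-- `M` is o-minimal: every subset of `M` definable with parameters is a finite union of
points and open intervals. -/
def IsOMinimal (L : FirstOrder.Language.{u, v}) (M : Type w) [L.Structure M]
    [LinearOrder M] : Prop :=
  ∀ s : Set M, (Set.univ : Set M).Definable₁ L s → IsFinUnionPointsIntervals s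

/-- `M` is almost o-minimal: every bounded definable (with parameters) subset of `M` is a
finite union of points and open intervals. -/
def IsAlmostOMinimal (L : FirstOrder.Language.{u, v}) (M : Type w) [L.Structure M]
    [LinearOrder M] : Prop :=
  ∀ s : Set M, (Set.univ : Set M).Definable₁ L s → BddAbove s → BddBelow s →
    IsFinUnionPointsIntervals s

/-- `M` is downward o-minimal: every definable (with parameters) subset of `M` that is
bounded above is a finite union of points and open intervals. -/
def IsDownwardOMinimal (L : FirstOrder.Language.{u, v}) (M : Type w) [L.Structure M]
    [LinearOrder M] : Prop :=
  ∀ s : Set M, (Set.univ : Set M).Definable₁ L s → BddAbove s → IsFinUnionPointsIntervals s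

/-- `M` is upward o-minimal: every definable (with parameters) subset of `M` that is
bounded below is a finite union of points and open intervals. -/
def IsUpwardOMinimal (L : FirstOrder.Language.{u, v}) (M : Type w) [L.Structure M]
    [LinearOrder M] : Prop :=
  ∀ s : Set M, (Set.univ : Set M).Definable₁ L s → BddBelow s → IsFinUnionPointsIntervals s

section

open Filter Topology Set

set_option linter.unusedSectionVars false

/-- A system of definable predicates on a dense linear order `R`, closed under first-order
operations and substitution of parameters, in which every unary definable predicate is determined
by the position relative to finitely many points. -/
structure OMinSys (R : Type w) [LinearOrder R] where
  /-- The definable predicates in the variables indexed by `α`. -/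
  Def : ∀ {α : Type}, ((α → R) → Prop) → Prop
  and : ∀ {α : Type} {p q : (α → R) → Prop}, Def p → Def q → Def fun v => p v ∧ q v
  not : ∀ {α : Type} {p : (α → R) → Prop}, Def p → Def fun v => ¬ p v
  comp : ∀ {α β : Type} (σ : α → β ⊕ R) {p : (α → R) → Prop}, Def p →
    Def fun w : β → R => p fun i => Sum.elim w id (σ i)
  ex : ∀ {α : Type} {p : (α → R) → R → Prop},
    Def (fun w : Option α → R => p (fun i => w (some i)) (w none)) → Def fun v => ∃ x, p v x
  lt : ∀ {α : Type} (i j : α), Def fun v : α → R => v i < v j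
  tame : ∀ p : R → Prop, (∀ ⦃α : Type⦄ (i : α), Def fun v : α → R => p (v i)) →
    ∃ F : Finset R, ∀ x y, (∀ c ∈ F, (x < c ↔ y < c) ∧ (c < x ↔ c < y)) → (p x ↔ p y)

namespace OMinSys

section Closure

variable {R : Type w} [LinearOrder R] (D : OMinSys R) {α β Γ : Type}

/-- Definability of a unary predicate. -/
def Def1 (p : R → Prop) : Prop := ∀ ⦃α : Type⦄ (i : α), D.Def fun v : α → R => p (v i)

/-- Definability of a binary predicate. -/
def Def2 (A : R → R → Prop) : Prop :=
  ∀ ⦃α : Type⦄ (i j : α), D.Def fun v : α → R => A (v i) (v j)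

/-- Definability of a family of predicates. -/
def DefFam0 (A : (α → R) → Prop) : Prop :=
  ∀ ⦃β : Type⦄ (σ : α → β), D.Def fun w : β → R => A (fun i => w (σ i))

/-- Definability of a family of unary predicates. -/
def DefFam1 (A : (α → R) → R → Prop) : Prop :=
  ∀ ⦃β : Type⦄ (σ : α → β) (j : β), D.Def fun w : β → R => A (fun i => w (σ i)) (w j)

/-- Definability of a family of binary predicates. -/
def DefFam2 (A : (α → R) → R → R → Prop) : Prop :=
  ∀ ⦃β : Type⦄ (σ : α → β) (j k : β),
    D.Def fun w : β → R => A (fun i => w (σ i)) (w j) (w k)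

/-- A map is definable if substituting it preserves definability. -/
def DefMap (F : (Γ → R) → (α → R)) : Prop :=
  ∀ ⦃δ : Type⦄ (σ : Γ → δ) (p : (α → R) → (δ → R) → Prop),
    D.Def (fun w : α ⊕ δ → R => p (fun i => w (.inl i)) (fun i => w (.inr i))) →
    D.Def fun w : δ → R => p (F fun i => w (σ i)) w

variable {D}

theorem reindex {p : (α → R) → Prop} (h : D.Def p) (σ : α → β) :
    D.Def fun w : β → R => p fun i => w (σ i) :=
  D.comp (fun i => .inl (σ i)) h

theorem iff_congr {p q : (α → R) → Prop} (h : D.Def p) (hpq : ∀ v, q v ↔ p v) : D.Def q := by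
  rwa [show q = p from funext fun v => propext (hpq v)]

theorem or {p q : (α → R) → Prop} (hp : D.Def p) (hq : D.Def q) : D.Def fun v => p v ∨ q v :=
  iff_congr (D.not (D.and (D.not hp) (D.not hq))) fun v => by tauto

theorem imp {p q : (α → R) → Prop} (hp : D.Def p) (hq : D.Def q) : D.Def fun v => p v → q v :=
  iff_congr (D.not (D.and hp (D.not hq))) fun v => by tauto

theorem iff {p q : (α → R) → Prop} (hp : D.Def p) (hq : D.Def q) : D.Def fun v => p v ↔ q v :=
  iff_congr (D.and (imp hp hq) (imp hq hp)) fun v => by tauto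

theorem all {p : (α → R) → R → Prop}
    (h : D.Def (fun w : Option α → R => p (fun i => w (some i)) (w none))) :
    D.Def fun v => ∀ x, p v x :=
  iff_congr (D.not (D.ex (p := fun v x => ¬ p v x) (D.not h))) fun v => by simp

theorem le (i j : α) : D.Def fun v : α → R => v i ≤ v j :=
  iff_congr (D.not (D.lt j i)) fun v => by simp

theorem eq (i j : α) : D.Def fun v : α → R => v i = v j :=
  iff_congr (D.and (le i j) (le j i)) fun v => by simp [le_antisymm_iff]

theorem lt_const (i : α) (c : R) : D.Def fun v : α → R => v i < c :=
  D.comp (fun o : Option α => o.elim (.inr c) .inl) (D.lt (some i) none)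

theorem const_lt (i : α) (c : R) : D.Def fun v : α → R => c < v i :=
  D.comp (fun o : Option α => o.elim (.inr c) .inl) (D.lt none (some i))

theorem eq_const (i : α) (c : R) : D.Def fun v : α → R => v i = c :=
  D.comp (fun o : Option α => o.elim (.inr c) .inl) (eq (some i) none)

theorem const (P : Prop) : D.Def fun _ : α → R => P := by
  by_cases hP : P
  · by_cases hα : Nonempty R
    · obtain ⟨c⟩ := hα
      have := D.comp (β := α) (fun _ : Unit => .inr c) (eq () ())
      exact iff_congr this fun v => by simp [hP]
    · have : D.Def fun v : α → R => ∀ x : R, P := by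
        refine iff_congr (all (p := fun v x => x = x) (eq none none)) fun v => by simp [hP]
      exact iff_congr this fun v => by simp [hP]
  · by_cases hα : Nonempty R
    · obtain ⟨c⟩ := hα
      have := D.comp (β := α) (fun _ : Unit => .inr c) (D.lt () ())
      exact iff_congr this fun v => by simp [hP]
    · exact iff_congr (D.ex (p := fun v x => x = x) (eq none none)) fun v => by
        simp [hP]; exact not_nonempty_iff.1 hα

theorem DefFam1.fix {A : (α → R) → R → Prop} (hA : D.DefFam1 A) (v : α → R) : D.Def1 (A v) :=
  fun β j => D.comp (β := β) (Sum.elim (fun i => .inr (v i)) .inl)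
    (hA (β := α ⊕ β) .inl (.inr j))

theorem DefFam2.fix {A : (α → R) → R → R → Prop} (hA : D.DefFam2 A) (v : α → R) :
    D.Def2 (A v) :=
  fun β j k => D.comp (β := β) (Sum.elim (fun i => .inr (v i)) .inl)
    (hA (β := α ⊕ β) .inl (.inr j) (.inr k))

theorem Def2.fix {A : R → R → Prop} (hA : D.Def2 A) (c : R) : D.Def1 (A c) :=
  fun β j => D.comp (β := β) (fun o : Option β => o.elim (.inr c) .inl)
    (hA none (some j))

theorem Def2.swap {A : R → R → Prop} (hA : D.Def2 A) : D.Def2 fun x y => A y x :=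
  fun _ i j => hA j i

/-- The same system for the reversed order. -/
def dual (D : OMinSys R) : OMinSys Rᵒᵈ where
  Def := fun {α} p => D.Def (α := α) p
  and := D.and
  not := D.not
  comp := D.comp
  ex := D.ex
  lt := fun i j => D.lt j i
  tame := fun p hp => by
    obtain ⟨F, hF⟩ := D.tame (fun x => p (OrderDual.toDual x)) (fun _ i => hp i)
    refine ⟨F.map OrderDual.toDual.toEmbedding, fun x y h => hF (OrderDual.ofDual x)
      (OrderDual.ofDual y) fun c hc => ?_⟩
    exact (h (OrderDual.toDual c) (Finset.mem_map_of_mem _ hc)).symm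

end Closure

section Topology

variable {R : Type w} [LinearOrder R] [TopologicalSpace R] [OrderTopology R]
  [NoMinOrder R] [NoMaxOrder R] {D : OMinSys R} {α β Γ : Type}

theorem eventually_nhds_iff {p : R → Prop} {t : R} :
    (∀ᶠ u in 𝓝 t, p u) ↔ ∃ l, ∃ m, (l < t ∧ t < m) ∧ ∀ u, l < u → u < m → p u := by
  rw [Filter.Eventually, mem_nhds_iff_exists_Ioo_subset]
  exact ⟨fun ⟨l, m, h, hs⟩ => ⟨l, m, h, fun u h1 h2 => hs ⟨h1, h2⟩⟩,
    fun ⟨l, m, h, hs⟩ => ⟨l, m, h, fun u hu => hs u hu.1 hu.2⟩⟩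

theorem eventually_gt_iff {p : R → Prop} {t : R} :
    (∀ᶠ u in 𝓝[>] t, p u) ↔ ∃ m, t < m ∧ ∀ u, t < u → u < m → p u := by
  rw [Filter.Eventually, mem_nhdsGT_iff_exists_Ioo_subset]
  exact ⟨fun ⟨m, h, hs⟩ => ⟨m, h, fun u h1 h2 => hs ⟨h1, h2⟩⟩,
    fun ⟨m, h, hs⟩ => ⟨m, h, fun u hu => hs u hu.1 hu.2⟩⟩

theorem eventually_lt_iff {p : R → Prop} {t : R} :
    (∀ᶠ u in 𝓝[<] t, p u) ↔ ∃ m, m < t ∧ ∀ u, m < u → u < t → p u := by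
  rw [Filter.Eventually, mem_nhdsLT_iff_exists_Ioo_subset]
  exact ⟨fun ⟨m, h, hs⟩ => ⟨m, h, fun u h1 h2 => hs ⟨h1, h2⟩⟩,
    fun ⟨m, h, hs⟩ => ⟨m, h, fun u hu => hs u hu.1 hu.2⟩⟩

theorem def_eventually {p : (α → R) → R → Prop} (i : α)
    (h : D.Def (fun w : Option α → R => p (fun i => w (some i)) (w none))) :
    D.Def fun v => ∀ᶠ u in 𝓝 (v i), p v u := by
  simp only [eventually_nhds_iff]
  exact D.ex <| D.ex <| D.and (D.and (D.lt _ _) (D.lt _ _)) <| all <| imp (D.lt _ _) <|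
    imp (D.lt _ _) <| reindex h (fun o : Option α => o.elim none fun i => some (some (some i)))

theorem def_eventually_gt {p : (α → R) → R → Prop} (i : α)
    (h : D.Def (fun w : Option α → R => p (fun i => w (some i)) (w none))) :
    D.Def fun v => ∀ᶠ u in 𝓝[>] (v i), p v u := by
  simp only [eventually_gt_iff]
  exact D.ex <| D.and (D.lt _ _) <| all <| imp (D.lt _ _) <|
    imp (D.lt _ _) <| reindex h (fun o : Option α => o.elim none fun i => some (some i))

theorem def_eventually_lt {p : (α → R) → R → Prop} (i : α)
    (h : D.Def (fun w : Option α → R => p (fun i => w (some i)) (w none))) :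
    D.Def fun v => ∀ᶠ u in 𝓝[<] (v i), p v u := by
  simp only [eventually_lt_iff]
  exact D.ex <| D.and (D.lt _ _) <| all <| imp (D.lt _ _) <|
    imp (D.lt _ _) <| reindex h (fun o : Option α => o.elim none fun i => some (some i))

/-- A definable predicate is constant on a right germ. -/
theorem Def1.germ_gt {p : R → Prop} (hp : D.Def1 p) (a : R) :
    (∀ᶠ x in 𝓝[>] a, p x) ∨ ∀ᶠ x in 𝓝[>] a, ¬ p x := by
  obtain ⟨F, hF⟩ := D.tame p hp
  have key : ∃ m, a < m ∧ ∀ c ∈ F, ¬ (a < c ∧ c < m) := by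
    have : ∀ᶠ x in 𝓝[>] a, ∀ c ∈ F, a < c → x < c := by
      rw [Filter.eventually_all_finset]
      intro c _
      by_cases h : a < c
      · exact eventually_gt_iff.2 ⟨c, h, fun u _ h2 _ => h2⟩
      · exact Eventually.of_forall fun _ h' => absurd h' h
    obtain ⟨m, hm, h⟩ := eventually_gt_iff.1 this
    refine ⟨m, hm, fun c hc h' => ?_⟩
    exact lt_irrefl _ (h c h'.1 h'.2 c hc h'.1)
  obtain ⟨m, hm, h⟩ := key
  have same : ∀ x y, a < x → x < m → a < y → y < m → (p x ↔ p y) := by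
    intro x y h1 h2 h3 h4
    refine hF x y fun c hc => ?_
    have := h c hc
    grind
  by_cases hall : ∀ x, a < x → x < m → p x
  · exact .inl (eventually_gt_iff.2 ⟨m, hm, hall⟩)
  · push Not at hall
    obtain ⟨x, h1, h2, h3⟩ := hall
    exact .inr (eventually_gt_iff.2 ⟨m, hm, fun y h4 h5 h6 => h3 ((same x y h1 h2 h4 h5).2 h6)⟩)

theorem Def1.germ_lt {p : R → Prop} (hp : D.Def1 p) (a : R) :
    (∀ᶠ x in 𝓝[<] a, p x) ∨ ∀ᶠ x in 𝓝[<] a, ¬ p x :=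
  Def1.germ_gt (R := Rᵒᵈ) (D := D.dual) (p := p) (fun _ i => hp i) (a : R)

/-- The points at which a definable predicate is not locally constant form a finite set. -/
theorem Def1.finite_not_locConst {p : R → Prop} (hp : D.Def1 p) :
    {t | ¬ ∀ᶠ u in 𝓝 t, (p u ↔ p t)}.Finite := by
  obtain ⟨F, hF⟩ := D.tame p hp
  refine F.finite_toSet.subset fun t ht => ?_
  by_contra hcF
  apply ht
  have : ∀ᶠ u in 𝓝 t, ∀ c ∈ F, (u < c ↔ t < c) ∧ (c < u ↔ c < t) := by
    rw [Filter.eventually_all_finset]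
    intro c hc
    rcases lt_trichotomy c t with h | h | h
    · filter_upwards [lt_mem_nhds h] with u hu
      grind
    · exact absurd (h ▸ hc) hcF
    · filter_upwards [gt_mem_nhds h] with u hu
      grind
  filter_upwards [this] with u hu using hF u t hu

theorem Def1.exists_Ioo {p : R → Prop} (hp : D.Def1 p) (h : {x | p x}.Infinite) :
    ∃ a b, a < b ∧ ∀ x, a < x → x < b → p x := by
  obtain ⟨x, hx, hx'⟩ := (h.sdiff hp.finite_not_locConst).nonempty
  simp only [mem_ofPred_eq, not_not] at hx hx'
  obtain ⟨l, m, h, h'⟩ := eventually_nhds_iff.1 hx'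
  exact ⟨l, m, h.1.trans h.2, fun y h1 h2 => (h' y h1 h2).2 hx⟩

/-- Definable completeness. -/
theorem Def1.exists_isLUB [DenselyOrdered R] {p : R → Prop} (hp : D.Def1 p) (hne : ∃ x, p x) {b : R}
    (hb : ∀ x, p x → x ≤ b) : ∃ s, IsLUB {x | p x} s := by
  obtain ⟨F, hF⟩ := D.tame p hp
  obtain ⟨x₀, hx₀⟩ := hne
  -- an element of `p` above every point of `F` that is not an upper bound of `p`
  have key : ∃ x, p x ∧ ∀ c ∈ F, c ∉ upperBounds {x | p x} → c < x := by
    have : ∀ G : Finset R, (∀ c ∈ G, c ∉ upperBounds {x | p x}) → ∃ x, p x ∧ ∀ c ∈ G, c < x := by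
      intro G
      induction G using Finset.induction_on with
      | empty => exact fun _ => ⟨x₀, hx₀, by simp⟩
      | insert a G _ ih =>
        intro hG
        obtain ⟨x, hx, h⟩ := ih fun c hc => hG c (Finset.mem_insert_of_mem hc)
        have := hG a (Finset.mem_insert_self _ _)
        simp only [upperBounds, mem_ofPred_eq, not_forall, not_le] at this
        obtain ⟨y, hy, hay⟩ := this
        rcases le_total x y with h' | h'
        · exact ⟨y, hy, by grind⟩
        · exact ⟨x, hx, by grind⟩
    classical
    obtain ⟨x, hx, h⟩ := this {c ∈ F | c ∉ upperBounds {x | p x}} (by simp)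
    exact ⟨x, hx, fun c hc hcu => h c (Finset.mem_filter.2 ⟨hc, hcu⟩)⟩
  obtain ⟨x, hx, hxF⟩ := key
  by_cases hxm : x ∈ upperBounds {x | p x}
  · exact ⟨x, hxm, fun u hu => hu hx⟩
  classical
  by_cases hU : ({c ∈ F | c ∈ upperBounds {x | p x}} : Finset R).Nonempty
  · have hc := Finset.min'_mem _ hU
    have hmin := Finset.min'_le {c ∈ F | c ∈ upperBounds {x | p x}}
    set c := Finset.min' _ hU
    rw [Finset.mem_filter] at hc
    refine ⟨c, hc.2, fun u hu => ?_⟩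
    by_contra hlt
    push Not at hlt
    obtain ⟨z, h1, h2⟩ := exists_between hlt
    have hxu : x ≤ u := hu hx
    have : p z := (hF x z fun d hd => by
      by_cases hdu : d ∈ upperBounds {x | p x}
      · have h3 := hmin d (Finset.mem_filter.2 ⟨hd, hdu⟩)
        have : x < d := lt_of_lt_of_le (hxu.trans_lt hlt) h3
        have : z < d := h2.trans_le h3
        grind
      · have := hxF d hd hdu
        grind).1 hx
    exact absurd (hu this) (not_le.2 h1)
  · exfalso
    obtain ⟨z, hz⟩ := exists_gt b
    have hxb := hb x hx
    have : p z := (hF x z fun d hd => by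
      have hdu : d ∉ upperBounds {x | p x} := fun h =>
        hU ⟨d, Finset.mem_filter.2 ⟨hd, h⟩⟩
      have := hxF d hd hdu
      grind).1 hx
    exact absurd (hb z this) (not_le.2 hz)

/-- A definable predicate that is locally constant at the points of a segment is constant on it. -/
theorem Def1.connected [DenselyOrdered R] {p : R → Prop} (hp : D.Def1 p) {x y : R} (hxy : x ≤ y)
    (h : ∀ t, x ≤ t → t ≤ y → ∀ᶠ u in 𝓝 t, (p u ↔ p t)) : p x ↔ p y := by
  suffices H : ∀ q : R → Prop, D.Def1 q → (∀ t, x ≤ t → t ≤ y → ∀ᶠ u in 𝓝 t, (q u ↔ q t)) →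
      q x → q y by
    refine ⟨H p hp h, fun hy => ?_⟩
    by_contra hx
    exact H (fun z => ¬ p z) (fun _ i => D.not (hp i)) (fun t h1 h2 => (h t h1 h2).mono fun u hu =>
      not_congr hu) hx hy
  intro q hq h hx
  have hZ : D.Def1 fun z => (x ≤ z ∧ z ≤ y) ∧ ∀ w, x ≤ w → w ≤ z → q w := by
    intro α i
    refine D.and (D.and ?_ ?_) (all (imp ?_ (imp (le _ _) (hq _))))
    · exact iff_congr (D.not (lt_const i x)) fun v => by simp
    · exact iff_congr (D.not (const_lt i y)) fun v => by simp
    · exact iff_congr (D.not (lt_const none x)) fun v => by simp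
  obtain ⟨s, hs⟩ := hZ.exists_isLUB
    ⟨x, ⟨le_rfl, hxy⟩, fun w h1 h2 => (le_antisymm h1 h2) ▸ hx⟩ (fun z hz => hz.1.2)
  have hxs : x ≤ s := hs.1 ⟨⟨le_rfl, hxy⟩, fun w h1 h2 => (le_antisymm h1 h2) ▸ hx⟩
  have hsy : s ≤ y := hs.2 fun z hz => hz.1.2
  obtain ⟨l, m, ⟨hl, hm⟩, hlm⟩ := eventually_nhds_iff.1 (h s hxs hsy)
  obtain ⟨z, hz, hlz⟩ : ∃ z, ((x ≤ z ∧ z ≤ y) ∧ ∀ w, x ≤ w → w ≤ z → q w) ∧ l < z := by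
    by_contra hcon
    push Not at hcon
    exact absurd (hs.2 fun z hz => hcon z hz) (not_le.2 hl)
  have hzs : z ≤ s := hs.1 hz
  have hqs : q s := (hlm z hlz (hzs.trans_lt hm)).1 (hz.2 z hz.1.1 le_rfl)
  have hbelow : ∀ w, x ≤ w → w < m → q w := fun w h1 h2 => by
    rcases le_or_gt w z with h3 | h3
    · exact hz.2 w h1 h3
    · exact (hlm w (hlz.trans h3) h2).2 hqs
  rcases lt_or_ge y m with h3 | h3
  · exact hbelow y hxy h3
  · obtain ⟨m', h4, h5⟩ := exists_between hm
    have := hs.1 (show m' ∈ _ from ⟨⟨hxs.trans h4.le, h5.le.trans h3⟩, fun w h6 h7 =>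
      hbelow w h6 (h7.trans_lt h5)⟩)
    exact absurd this (not_le.2 h4)

end Topology

end OMinSys

namespace OMinSys

section Monotonicity

variable {R : Type w} [LinearOrder R] [TopologicalSpace R] [OrderTopology R]
  [NoMinOrder R] [NoMaxOrder R] [DenselyOrdered R] {D : OMinSys R}

/-- A definable predicate is constant near the right end of an interval. -/
theorem Def1.exists_left_end {p : R → Prop} (hp : D.Def1 p) {a b : R} (hab : a < b) :
    ∃ a', a ≤ a' ∧ a' < b ∧
      ((∀ x, a' < x → x < b → p x) ∨ ∀ x, a' < x → x < b → ¬ p x) := by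
  rcases hp.germ_lt b with h | h <;> obtain ⟨m, hm, h⟩ := eventually_lt_iff.1 h
  · exact ⟨max a m, le_max_left _ _, max_lt hab hm,
      .inl fun x h1 h2 => h x ((le_max_right _ _).trans_lt h1) h2⟩
  · exact ⟨max a m, le_max_left _ _, max_lt hab hm,
      .inr fun x h1 h2 => h x ((le_max_right _ _).trans_lt h1) h2⟩

/-- A definable predicate is constant near the left end of an interval. -/
theorem Def1.exists_right_end {p : R → Prop} (hp : D.Def1 p) {a b : R} (hab : a < b) :
    ∃ b', b' ≤ b ∧ a < b' ∧
      ((∀ x, a < x → x < b' → p x) ∨ ∀ x, a < x → x < b' → ¬ p x) := by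
  rcases hp.germ_gt a with h | h <;> obtain ⟨m, hm, h⟩ := eventually_gt_iff.1 h
  · exact ⟨min b m, min_le_left _ _, lt_min hab hm,
      .inl fun x h1 h2 => h x h1 (h2.trans_le (min_le_right _ _))⟩
  · exact ⟨min b m, min_le_left _ _, lt_min hab hm,
      .inr fun x h1 h2 => h x h1 (h2.trans_le (min_le_right _ _))⟩

theorem exists_mem_of_lt_isLUB {p : R → Prop} {s l : R} (hs : IsLUB {x | p x} s) (hl : l < s) :
    ∃ z, p z ∧ l < z ∧ z ≤ s := by
  obtain ⟨z, hz, h⟩ := (lt_isLUB_iff hs).1 hl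
  exact ⟨z, hz, h, hs.1 hz⟩

theorem rel_of_local_rel {r : R → R → Prop} (hr : D.Def2 r)
    (htrans : ∀ x y z, r x y → r y z → r x z) {a b : R}
    (hR : ∀ x, a < x → x < b → ∀ᶠ y in 𝓝[>] x, r x y)
    (hL : ∀ x, a < x → x < b → ∀ᶠ y in 𝓝[<] x, r y x) (x y : R)
    (hax : a < x) (hxy : x < y) (hyb : y < b) : r x y := by
  have hZ : D.Def1 fun z => (x < z ∧ ¬ y < z) ∧ ∀ w, x < w → w < z → r x w := by
    intro α i
    exact D.and (D.and (const_lt _ _) (D.not (const_lt _ _)))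
      (all (imp (const_lt _ _) (imp (D.lt _ _) (hr.fix x _))))
  have hZ' : ∃ z, (x < z ∧ ¬ y < z) ∧ ∀ w, x < w → w < z → r x w := by
    obtain ⟨m, hm, h⟩ := eventually_gt_iff.1 (hR x hax (hxy.trans hyb))
    exact ⟨min m y, ⟨lt_min hm hxy, by simp⟩,
      fun w h1 h2 => h w h1 (h2.trans_le (min_le_left _ _))⟩
  obtain ⟨s, hs⟩ := hZ.exists_isLUB hZ' (b := y) fun z hz => not_lt.1 hz.1.2
  obtain ⟨z, hz⟩ := hZ'
  have hxs : x < s := hz.1.1.trans_le (hs.1 hz)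
  have hsy : s ≤ y := hs.2 fun z hz => not_lt.1 hz.1.2
  have hbelow : ∀ w, x < w → w < s → r x w := fun w h1 h2 => by
    obtain ⟨z, hz, h, -⟩ := exists_mem_of_lt_isLUB hs h2
    exact hz.2 w h1 h
  have hrs : r x s := by
    obtain ⟨m, hm, h⟩ := eventually_lt_iff.1 (hL s (hax.trans hxs) (hsy.trans_lt hyb))
    obtain ⟨w, h1, h2⟩ := exists_between (max_lt hm hxs)
    exact htrans _ _ _ (hbelow w ((le_max_right _ _).trans_lt h1) h2)
      (h w ((le_max_left _ _).trans_lt h1) h2)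
  rcases hsy.eq_or_lt with h | hsy
  · exact h ▸ hrs
  · obtain ⟨m, hm, h⟩ := eventually_gt_iff.1 (hR s (hax.trans hxs) (hsy.trans hyb))
    obtain ⟨u, h1, h2⟩ := exists_between (lt_min hm hsy)
    refine absurd (hs.1 (show u ∈ {z | _} from ⟨⟨hxs.trans h1,
      not_lt.2 (h2.le.trans (min_le_right _ _))⟩, fun w h3 h4 => ?_⟩)) (not_le.2 h1)
    rcases lt_trichotomy w s with h5 | h5 | h5
    · exact hbelow w h3 h5
    · exact h5 ▸ hrs
    · exact htrans _ _ _ hrs (h w h5 (h4.trans (h2.trans_le (min_le_left _ _))))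

theorem exists_left_end_of_local_min {r : R → R → Prop} (hr : D.Def2 r)
    (hasymm : ∀ x y, r x y → ¬ r y x)
    (htrans : ∀ x y z, r x y → r y z → r x z) {a b : R} (hab : a < b)
    (htri : ∀ x y, a < x → x < b → a < y → y < b → x ≠ y → r x y ∨ r y x)
    (hR : ∀ x, a < x → x < b → ∀ᶠ y in 𝓝[>] x, r x y)
    (hL : ∀ x, a < x → x < b → ∀ᶠ y in 𝓝[<] x, r x y) :
    ∃ a', a ≤ a' ∧ a' < b ∧ ∀ β, a' < β → β < b →
      ∃ l m, (l < β ∧ β < m) ∧ ∀ y z, l < y → y < β → β < z → z < m → r z y := by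
  have hB : D.Def1 fun x => ∀ y, x < y → y < b → r x y := fun _ i =>
    all (imp (D.lt _ _) (imp (lt_const _ _) (hr _ _)))
  obtain ⟨a₁, haa₁, ha₁b, hB⟩ := hB.exists_left_end hab
  replace hB : ∀ x, a₁ < x → x < b → ∃ y, x < y ∧ y < b ∧ r y x := by
    rcases hB with hB | hB
    · exfalso
      obtain ⟨x, h1, h2⟩ := exists_between ha₁b
      obtain ⟨m, hm, h⟩ := eventually_lt_iff.1 (hL x (haa₁.trans_lt h1) h2)
      obtain ⟨y, h3, h4⟩ := exists_between (max_lt hm h1)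
      exact hasymm _ _ (h y ((le_max_left _ _).trans_lt h3) h4)
        (hB y ((le_max_right _ _).trans_lt h3) (h4.trans h2) x h4 h2)
    · intro x h1 h2
      have := hB x h1 h2
      push Not at this
      obtain ⟨y, h3, h4, h5⟩ := this
      have h1' := haa₁.trans_lt h1
      exact ⟨y, h3, h4, (htri x y h1' h2 (h1'.trans h3) h4 h3.ne).resolve_left h5⟩
  have hfar : ∀ x, a₁ < x → x < b → ∃ d, d < b ∧ ∀ y, d < y → y < b → r y x := by
    intro x hx hxb
    rcases (hr.swap.fix x).germ_lt b with h | h <;> obtain ⟨m, hm, h⟩ := eventually_lt_iff.1 h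
    · exact ⟨m, hm, h⟩
    exfalso
    have hZ : D.Def1 fun z => (a₁ < z ∧ z < b) ∧ r z x := fun _ i =>
      D.and (D.and (const_lt _ _) (lt_const _ _)) (hr.swap.fix x _)
    obtain ⟨y, hxy, hyb, hy⟩ := hB x hx hxb
    have hZm : ∀ z, ((a₁ < z ∧ z < b) ∧ r z x) → z ≤ m := fun z hz =>
      not_lt.1 fun h' => h z h' hz.1.2 hz.2
    have hy' : (a₁ < y ∧ y < b) ∧ r y x := ⟨⟨hx.trans hxy, hyb⟩, hy⟩
    obtain ⟨d, hd⟩ := hZ.exists_isLUB ⟨y, hy'⟩ hZm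
    have hxd : x < d := hxy.trans_le (hd.1 hy')
    have hdb : d < b := (hd.2 hZm).trans_lt hm
    have had := hx.trans hxd
    by_cases hdx : r d x
    · obtain ⟨z, h1, h2, h3⟩ := hB d had hdb
      exact absurd (hd.1 (show z ∈ {z | _} from ⟨⟨had.trans h1, h2⟩, htrans _ _ _ h3 hdx⟩))
        (not_le.2 h1)
    · obtain ⟨l, hl, h'⟩ := eventually_lt_iff.1 (hL d (haa₁.trans_lt had) hdb)
      obtain ⟨z, hz, h1, h2⟩ := exists_mem_of_lt_isLUB hd hl
      have hzd : z < d := h2.lt_of_ne fun e => hdx (e ▸ hz.2)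
      exact hdx (htrans _ _ _ (h' z h1 hzd) hz.2)
  have hcof : ∀ x, a₁ < x → x < b → ∃ β, x < β ∧ β < b ∧
      ∃ l m, (l < β ∧ β < m) ∧ ∀ y z, l < y → y < β → β < z → z < m → r z y := by
    intro x hx hxb
    obtain ⟨d, hdb, hd⟩ := hfar x hx hxb
    have hW : D.Def1 fun y => (x < y ∧ y < b) ∧ ¬ r y x := fun _ i =>
      D.and (D.and (const_lt _ _) (lt_const _ _)) (D.not (hr.swap.fix x _))
    have hWd : ∀ y, ((x < y ∧ y < b) ∧ ¬ r y x) → y ≤ d := fun y hy =>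
      not_lt.1 fun h' => hy.2 (hd y h' hy.1.2)
    obtain ⟨m, hm, hxm⟩ := eventually_gt_iff.1 (hR x (haa₁.trans_lt hx) hxb)
    obtain ⟨y, h1, h2⟩ := exists_between (lt_min hm hxb)
    have hy : (x < y ∧ y < b) ∧ ¬ r y x := ⟨⟨h1, h2.trans_le (min_le_right _ _)⟩,
      hasymm _ _ (hxm y h1 (h2.trans_le (min_le_left _ _)))⟩
    obtain ⟨β, hβ⟩ := hW.exists_isLUB ⟨y, hy⟩ hWd
    have hxβ : x < β := h1.trans_le (hβ.1 hy)
    have hβb : β < b := (hβ.2 hWd).trans_lt hdb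
    have hax := haa₁.trans_lt hx
    have hright : ∀ z, β < z → z < b → r z x := fun z h1 h2 => by
      by_contra h
      exact absurd (hβ.1 (show z ∈ {z | _} from ⟨⟨hxβ.trans h1, h2⟩, h⟩)) (not_le.2 h1)
    refine ⟨β, hxβ, hβb, ?_⟩
    rcases (hr.swap.fix x).germ_lt β with h | h <;> obtain ⟨l, hl, h⟩ := eventually_lt_iff.1 h
    · exfalso
      obtain ⟨z, hz, h1, h2⟩ := exists_mem_of_lt_isLUB hβ hl
      rcases h2.eq_or_lt with rfl | h2
      · obtain ⟨l', hl', h'⟩ := eventually_lt_iff.1 (hL z (hax.trans hxβ) hβb)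
        obtain ⟨y, h3, h4⟩ := exists_between (max_lt hl hl')
        exact hz.2 (htrans _ _ _ (h' y ((le_max_right _ _).trans_lt h3) h4)
          (h y ((le_max_left _ _).trans_lt h3) h4))
      · exact hz.2 (h z h1 h2)
    · refine ⟨max l x, b, ⟨max_lt hl hxβ, hβb⟩, fun y z h1 h2 h3 h4 => ?_⟩
      have hxy := (le_max_right _ _).trans_lt h1
      exact htrans _ _ _ (hright z h3 h4) ((htri y x (hax.trans hxy) (h2.trans hβb) hax hxb
        hxy.ne').resolve_left (h y ((le_max_left _ _).trans_lt h1) h2))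
  have hΨ : D.Def1 fun β =>
      ∃ l m, (l < β ∧ β < m) ∧ ∀ y z, l < y → y < β → β < z → z < m → r z y := fun _ i =>
    D.ex <| D.ex <| D.and (D.and (D.lt _ _) (D.lt _ _)) <| all <| all <|
      imp (D.lt _ _) <| imp (D.lt _ _) <| imp (D.lt _ _) <| imp (D.lt _ _) <| hr _ _
  obtain ⟨a', h1, h2, h3⟩ := hΨ.exists_left_end ha₁b
  refine ⟨a', haa₁.trans h1, h2, h3.resolve_right fun h => ?_⟩
  obtain ⟨x, h4, h5⟩ := exists_between h2
  obtain ⟨β, h6, h7, h8⟩ := hcof x (h1.trans_lt h4) h5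
  exact h β (h4.trans h6) h7 h8

theorem no_local_min {r : R → R → Prop} (hr : D.Def2 r)
    (hasymm : ∀ x y, r x y → ¬ r y x)
    (htrans : ∀ x y z, r x y → r y z → r x z) {a b : R} (hab : a < b)
    (htri : ∀ x y, a < x → x < b → a < y → y < b → x ≠ y → r x y ∨ r y x)
    (hR : ∀ x, a < x → x < b → ∀ᶠ y in 𝓝[>] x, r x y)
    (hL : ∀ x, a < x → x < b → ∀ᶠ y in 𝓝[<] x, r x y) : False := by
  obtain ⟨a', h1, h2, h3⟩ := exists_left_end_of_local_min hr hasymm htrans hab htri hR hL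
  obtain ⟨b', h4, h5, h6⟩ : ∃ b', b' ≤ b ∧ a' < b' ∧ ∀ β, β < b' → a' < β →
      ∃ m l, (β < m ∧ l < β) ∧ ∀ y z, y < m → β < y → z < β → l < z → r z y :=
    exists_left_end_of_local_min (R := Rᵒᵈ) (D := D.dual) (r := r)
      (fun _ i j => hr i j) hasymm htrans (a := b) (b := a') h2
      (fun x y hx hx' hy hy' => htri x y (h1.trans_lt hx') hx (h1.trans_lt hy') hy)
      (fun x hx hx' => hL x (h1.trans_lt hx') hx) (fun x hx hx' => hR x (h1.trans_lt hx') hx)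
  obtain ⟨β, h7, h8⟩ := exists_between h5
  obtain ⟨l, m, ⟨hl, hm⟩, h⟩ := h3 β h7 (h8.trans_le h4)
  obtain ⟨m', l', ⟨hm', hl'⟩, h'⟩ := h6 β h8 h7
  obtain ⟨y, hy, hy'⟩ := exists_between (max_lt hl hl')
  obtain ⟨z, hz, hz'⟩ := exists_between (lt_min hm hm')
  exact hasymm _ _
    (h y z ((le_max_left _ _).trans_lt hy) hy' hz (hz'.trans_le (min_le_left _ _)))
    (h' z y (hz'.trans_le (min_le_right _ _)) hz hy' ((le_max_right _ _).trans_lt hy))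

/-- A definable strict linear order on an interval agrees with `<` or `>` on a subinterval. -/
theorem exists_Ioo_rel {r : R → R → Prop} (hr : D.Def2 r)
    (hasymm : ∀ x y, r x y → ¬ r y x)
    (htrans : ∀ x y z, r x y → r y z → r x z) {a b : R} (hab : a < b)
    (htri : ∀ x y, a < x → x < b → a < y → y < b → x ≠ y → r x y ∨ r y x) :
    ∃ b', b' ≤ b ∧ a < b' ∧ ((∀ x y, a < x → x < y → y < b' → r x y) ∨
      ∀ x y, a < x → x < y → y < b' → r y x) := by
  have hdR : D.Def1 fun x => ∀ᶠ y in 𝓝[>] x, r x y := fun α i =>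
    def_eventually_gt (p := fun v y => r (v i) y) i (hr _ _)
  have hdL : D.Def1 fun x => ∀ᶠ y in 𝓝[<] x, r x y := fun α i =>
    def_eventually_lt (p := fun v y => r (v i) y) i (hr _ _)
  obtain ⟨b₁, h1, h2, hR⟩ := hdR.exists_right_end hab
  obtain ⟨b', h3, h4, hL⟩ := hdL.exists_right_end h2
  have hb'b := h3.trans h1
  refine ⟨b', hb'b, h4, ?_⟩
  have hR' : ∀ x, a < x → x < b' → (¬ ∀ᶠ y in 𝓝[>] x, r x y) → ∀ᶠ y in 𝓝[>] x, r y x := by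
    intro x hx hx' h
    have h' := ((hr.fix x).germ_gt x).resolve_left h
    filter_upwards [h', Ioo_mem_nhdsGT hx'] with y hy hy'
    exact (htri x y hx (hx'.trans_le hb'b) (hx.trans hy'.1) (hy'.2.trans_le hb'b)
      hy'.1.ne).resolve_left hy
  have hL' : ∀ x, a < x → x < b' → (¬ ∀ᶠ y in 𝓝[<] x, r x y) → ∀ᶠ y in 𝓝[<] x, r y x := by
    intro x hx hx' h
    have h' := ((hr.fix x).germ_lt x).resolve_left h
    filter_upwards [h', Ioo_mem_nhdsLT hx] with y hy hy'
    exact (htri x y hx (hx'.trans_le hb'b) hy'.1 (hy'.2.trans (hx'.trans_le hb'b))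
      hy'.2.ne').resolve_left hy
  have htri' : ∀ x y, a < x → x < b' → a < y → y < b' → x ≠ y → r y x ∨ r x y :=
    fun x y h1 h2 h3 h4 hne =>
      (htri x y h1 (h2.trans_le hb'b) h3 (h4.trans_le hb'b) hne).symm
  rcases hR with hR | hR <;> rcases hL with hL | hL
  · exact (no_local_min hr hasymm htrans h4 (fun x y h1 h2 h3 h4 hne =>
      (htri' x y h1 h2 h3 h4 hne).symm) (fun x hx hx' => hR x hx (hx'.trans_le h3)) hL).elim
  · exact .inl (rel_of_local_rel hr htrans (fun x hx hx' => hR x hx (hx'.trans_le h3))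
      fun x hx hx' => hL' x hx hx' (hL x hx hx'))
  · exact .inr (rel_of_local_rel (r := fun x y => r y x) hr.swap
      (fun x y z h1 h2 => htrans _ _ _ h2 h1)
      (fun x hx hx' => hR' x hx hx' (hR x hx (hx'.trans_le h3))) hL)
  · exact (no_local_min (r := fun x y => r y x) hr.swap (fun x y h h' => hasymm _ _ h h')
      (fun x y z h1 h2 => htrans _ _ _ h2 h1) h4 htri'
      (fun x hx hx' => hR' x hx hx' (hR x hx (hx'.trans_le h3)))
      fun x hx hx' => hL' x hx hx' (hL x hx hx')).elim

end Monotonicity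

end OMinSys

namespace OMinSys

section Continuity

variable {R : Type w} [LinearOrder R] [TopologicalSpace R] [OrderTopology R]
  [NoMinOrder R] [NoMaxOrder R] [DenselyOrdered R] {D : OMinSys R} {α : Type}

/-- Substitution of a function with definable graph. -/
theorem subst {F : (α → R) → R}
    (hF : D.Def fun w : Option α → R => F (fun i => w (some i)) = w none)
    {p : (α → R) → R → Prop}
    (hp : D.Def fun w : Option α → R => p (fun i => w (some i)) (w none)) :
    D.Def fun v => p v (F v) :=
  iff_congr (D.ex (p := fun v x => F v = x ∧ p v x) (D.and hF hp)) fun v => by simp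

theorem continuousAt_iff_lt {f : R → R} {t : R} :
    ContinuousAt f t ↔
      (∀ l, l < f t → ∀ᶠ u in 𝓝 t, l < f u) ∧ ∀ m, f t < m → ∀ᶠ u in 𝓝 t, f u < m :=
  tendsto_order

theorem exists_continuousAt_of_mono {f : R → R} (hf : D.Def2 fun t y => f t = y) {a b : R}
    (hab : a < b) (hmono : (∀ x y, a < x → x < y → y < b → f x < f y) ∨
      ∀ x y, a < x → x < y → y < b → f y < f x) : ∃ t, a < t ∧ t < b ∧ ContinuousAt f t := by
  have hinj : InjOn f (Ioo a b) := by
    intro x hx y hy hxy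
    by_contra hne
    rcases lt_or_gt_of_ne hne with h | h <;> rcases hmono with hm | hm
    · exact (hm x y hx.1 h hy.2).ne hxy
    · exact (hm x y hx.1 h hy.2).ne' hxy
    · exact (hm y x hy.1 h hx.2).ne' hxy
    · exact (hm y x hy.1 h hx.2).ne hxy
  have hI : D.Def1 fun y => ∃ x, (a < x ∧ x < b) ∧ f x = y := fun _ i =>
    D.ex (D.and (D.and (const_lt _ _) (lt_const _ _)) (hf _ _))
  obtain ⟨c, d, hcd, h⟩ := hI.exists_Ioo (((infinite_image_iff hinj).2 (Ioo_infinite hab)).mono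
    (by rintro _ ⟨x, hx, rfl⟩; exact ⟨x, hx, rfl⟩))
  obtain ⟨y, hcy, hyd⟩ := exists_between hcd
  obtain ⟨t, ⟨hat, htb⟩, rfl⟩ := h y hcy hyd
  refine ⟨t, hat, htb, continuousAt_iff_lt.2 ⟨fun l hl => ?_, fun m hm => ?_⟩⟩
  · obtain ⟨y, h1, h2⟩ := exists_between (max_lt hl hcy)
    obtain ⟨x, ⟨h3, h4⟩, rfl⟩ := h y ((le_max_right _ _).trans_lt h1) (h2.trans hyd)
    replace h1 := (le_max_left _ _).trans_lt h1
    rcases hmono with hmono | hmono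
    · have hxt : x < t := by
        by_contra hcon
        rcases (not_lt.1 hcon).eq_or_lt with h' | h'
        · exact h2.ne (h' ▸ rfl)
        · exact lt_asymm h2 (hmono t x hat h' h4)
      filter_upwards [Ioo_mem_nhds hxt htb] with u hu
      exact h1.trans (hmono x u h3 hu.1 hu.2)
    · have hxt : t < x := by
        by_contra hcon
        rcases (not_lt.1 hcon).eq_or_lt with h' | h'
        · exact h2.ne (h' ▸ rfl)
        · exact lt_asymm h2 (hmono x t h3 h' htb)
      filter_upwards [Ioo_mem_nhds hat hxt] with u hu
      exact h1.trans (hmono u x hu.1 hu.2 h4)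
  · obtain ⟨y, h1, h2⟩ := exists_between (lt_min hm hyd)
    obtain ⟨x, ⟨h3, h4⟩, rfl⟩ := h y (hcy.trans h1) (h2.trans_le (min_le_right _ _))
    replace h2 := h2.trans_le (min_le_left _ _)
    rcases hmono with hmono | hmono
    · have hxt : t < x := by
        by_contra hcon
        rcases (not_lt.1 hcon).eq_or_lt with h' | h'
        · exact h1.ne (h' ▸ rfl)
        · exact lt_asymm h1 (hmono x t h3 h' htb)
      filter_upwards [Ioo_mem_nhds hat hxt] with u hu
      exact (hmono u x hu.1 hu.2 h4).trans h2
    · have hxt : x < t := by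
        by_contra hcon
        rcases (not_lt.1 hcon).eq_or_lt with h' | h'
        · exact h1.ne (h' ▸ rfl)
        · exact lt_asymm h1 (hmono t x hat h' h4)
      filter_upwards [Ioo_mem_nhds hxt htb] with u hu
      exact (hmono x u h3 hu.1 hu.2).trans h2

theorem exists_continuousAt {f : R → R} (hf : D.Def2 fun t y => f t = y) {a b : R}
    (hab : a < b) : ∃ t, a < t ∧ t < b ∧ ContinuousAt f t := by
  have hlt : D.Def2 fun x y => f x < f y := fun α i j =>
    subst (hf (some i) none) (p := fun v y => y < f (v j))
      (subst (hf (some (some j)) none) (p := fun w z => w none < z) (D.lt _ _))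
  by_cases hfib : ∃ c, {x | (a < x ∧ x < b) ∧ f x = c}.Infinite
  · obtain ⟨c, hc⟩ := hfib
    have : D.Def1 fun x => (a < x ∧ x < b) ∧ f x = c := fun _ i =>
      D.and (D.and (const_lt _ _) (lt_const _ _)) (hf.swap.fix c _)
    obtain ⟨l, m, hlm, h⟩ := this.exists_Ioo hc
    obtain ⟨t, h1, h2⟩ := exists_between hlm
    refine ⟨t, (h t h1 h2).1.1, (h t h1 h2).1.2, ?_⟩
    refine (continuousAt_const (y := c)).congr ?_
    filter_upwards [Ioo_mem_nhds h1 h2] with u hu using (h u hu.1 hu.2).2.symm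
  · simp only [not_exists, not_infinite] at hfib
    have hX : D.Def1 fun x => (a < x ∧ x < b) ∧ ∀ x', a < x' → x' < x → ¬ f x' = f x :=
      fun α i => D.and (D.and (const_lt _ _) (lt_const _ _)) <| all <| imp (const_lt _ _) <|
        imp (D.lt _ _) <| D.not <| subst (hf (some (some i)) none)
          (p := fun w y => f (w none) = y) (hf _ _)
    have hXinf : {x | (a < x ∧ x < b) ∧ ∀ x', a < x' → x' < x → ¬ f x' = f x}.Infinite := by
      intro hfin
      refine Ioo_infinite hab (Set.Finite.of_finite_fibers f ((hfin.image f).subset ?_) ?_)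
      · rintro _ ⟨x, hx, rfl⟩
        obtain ⟨z, hz, hmin⟩ := (hfib (f x)).exists_minimal ⟨x, hx, rfl⟩
        refine ⟨z, ⟨hz.1, fun x' h1 h2 h3 => ?_⟩, hz.2⟩
        exact absurd (hmin ⟨⟨h1, h2.trans hz.1.2⟩, h3.trans hz.2⟩ h2.le) (not_le.2 h2)
      · intro c _
        exact (hfib c).subset fun x hx => hx
    obtain ⟨l, m, hlm, h⟩ := hX.exists_Ioo hXinf
    have hne : ∀ x y, l < x → y < m → x < y → f x ≠ f y := fun x y h1 h2 h3 =>
      (h y (h1.trans h3) h2).2 x (h x h1 (h3.trans h2)).1.1 h3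
    obtain ⟨m', hm', hlm', hrel⟩ := exists_Ioo_rel hlt (fun x y => lt_asymm)
      (fun x y z => lt_trans) hlm (fun x y h1 h2 h3 h4 h5 => by
        rcases lt_or_gt_of_ne h5 with h6 | h6
        · exact lt_or_gt_of_ne (hne x y h1 h4 h6)
        · exact (lt_or_gt_of_ne (hne y x h3 h2 h6)).symm)
    obtain ⟨t, h1, h2, h3⟩ := exists_continuousAt_of_mono hf hlm' hrel
    have := h t h1 (h2.trans_le hm')
    exact ⟨t, this.1.1, this.1.2, h3⟩

/-- A definable function is continuous at all but finitely many points. -/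
theorem finite_not_continuousAt {f : R → R} (hf : D.Def2 fun t y => f t = y) :
    {t | ¬ ContinuousAt f t}.Finite := by
  have hd : D.Def1 fun t => ¬ ContinuousAt f t := by
    intro α i
    simp only [continuousAt_iff_lt]
    refine D.not (D.and ?_ ?_)
    · refine all (imp (subst (hf (some (some i)) none) (p := fun w y => w none < y) (D.lt _ _))
        (def_eventually (p := fun w u => w none < f u) (some i) ?_))
      exact subst (hf (some none) none) (p := fun w y => w (some none) < y) (D.lt _ _)
    · refine all (imp (subst (hf (some (some i)) none) (p := fun w y => y < w none) (D.lt _ _))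
        (def_eventually (p := fun w u => f u < w none) (some i) ?_))
      exact subst (hf (some none) none) (p := fun w y => y < w (some none)) (D.lt _ _)
  by_contra hinf
  obtain ⟨a, b, hab, h⟩ := hd.exists_Ioo hinf
  obtain ⟨t, h1, h2, h3⟩ := exists_continuousAt hf hab
  exact h t h1 h2 h3

end Continuity

end OMinSys

namespace OMinSys

section Planar

variable {R : Type w} [LinearOrder R] [TopologicalSpace R] [OrderTopology R]
  [NoMinOrder R] [NoMaxOrder R] [DenselyOrdered R] {D : OMinSys R} {α : Type}

/-- A definable family of finite sets has a definable choice of least elements. -/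
theorem exists_min_fun {Q : (α → R) → R → Prop} (hQ : D.DefFam1 Q)
    (hfin : ∀ v, {x | Q v x}.Finite) (c : R) :
    ∃ F : (α → R) → R, D.DefFam1 (fun v y => F v = y) ∧
      ∀ v, (∃ x, Q v x) → Q v (F v) ∧ ∀ x, Q v x → F v ≤ x := by
  have h : ∀ v, ∃ m, ((Q v m ∧ ∀ x, Q v x → m ≤ x) ∨ ((¬ ∃ x, Q v x) ∧ m = c)) := by
    intro v
    by_cases hv : ∃ x, Q v x
    · obtain ⟨m, hm, hmin⟩ := (hfin v).exists_minimal hv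
      exact ⟨m, .inl ⟨hm, fun x hx => (le_total m x).elim id fun h => hmin hx h⟩⟩
    · exact ⟨c, .inr ⟨hv, rfl⟩⟩
  choose F hF using h
  refine ⟨F, fun β σ j => ?_, fun v hv => (hF v).elim id fun h => absurd hv h.1⟩
  refine iff_congr (p := fun w => (Q (fun i => w (σ i)) (w j) ∧
      ∀ x, Q (fun i => w (σ i)) x → w j ≤ x) ∨
      ((¬ ∃ x, Q (fun i => w (σ i)) x) ∧ w j = c)) ?_ fun w => ?_
  · exact or (D.and (hQ _ _) (all (imp (hQ (fun i => some (σ i)) none) (le _ _))))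
      (D.and (D.not (D.ex (hQ (fun i => some (σ i)) none))) (eq_const _ _))
  · constructor
    · intro h
      rw [← h]
      exact hF _
    · intro h
      rcases hF fun i => w (σ i) with h1 | h1 <;> rcases h with h2 | h2
      · exact le_antisymm (h1.2 _ h2.1) (h2.2 _ h1.1)
      · exact absurd ⟨_, h1.1⟩ h2.1
      · exact absurd ⟨_, h2.1⟩ h1.1
      · exact h1.2.trans h2.2.symm

theorem exists_min_fun_one {Q : R → R → Prop} (hQ : D.Def2 Q)
    (hfin : ∀ t, {x | Q t x}.Finite) (c : R) :
    ∃ f : R → R, D.Def2 (fun t y => f t = y) ∧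
      ∀ t, (∃ x, Q t x) → Q t (f t) ∧ ∀ x, Q t x → f t ≤ x := by
  obtain ⟨F, hF, h⟩ := exists_min_fun (Q := fun (v : Unit → R) x => Q (v ()) x)
    (fun _ σ j => hQ (σ ()) j) (fun v => hfin _) c
  exact ⟨fun t => F fun _ => t, fun _ i j => hF (fun _ => i) j, fun t => h fun _ => t⟩

/-- Sets in the family near `t` stay above every lower bound of the set at `t`. -/
def LowerStable (Q : R → R → Prop) (t : R) : Prop :=
  ∀ e, (∀ x, x ≤ e → ¬ Q t x) → ∀ᶠ u in 𝓝 t, ∀ x, x ≤ e → ¬ Q u x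

/-- Sets in the family near `t` stay below every upper bound of the set at `t`. -/
def UpperStable (Q : R → R → Prop) (t : R) : Prop :=
  ∀ e, (∀ x, e ≤ x → ¬ Q t x) → ∀ᶠ u in 𝓝 t, ∀ x, e ≤ x → ¬ Q u x

/-- Isolated points of the set at `t` persist for nearby members of the family. -/
def PointStable (A : R → R → Prop) (t : R) : Prop :=
  ¬ ∃ x, A t x ∧ ∃ c e, ((c < x ∧ x < e) ∧ ∀ y, c ≤ y → y ≤ e → A t y → y = x) ∧
    ¬ ∀ᶠ u in 𝓝 t, ∃ y, ((c < y ∧ y ≤ e) ∧ A u y) ∧ ∀ z, c < z → z ≤ e → A u z → z = y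

theorem finite_not_lowerStable {Q : R → R → Prop} (hQ : D.Def2 Q)
    (hfin : ∀ t, {x | Q t x}.Finite) : {t | ¬ LowerStable Q t}.Finite := by
  rcases isEmpty_or_nonempty R with h | ⟨⟨c⟩⟩
  · exact toFinite _
  obtain ⟨f, hf, hfQ⟩ := exists_min_fun_one hQ hfin c
  have hd : D.Def1 fun t => ∃ x, Q t x := fun _ i => D.ex (hQ _ _)
  refine ((finite_not_continuousAt hf).union hd.finite_not_locConst).subset fun t ht => ?_
  by_contra hcon
  simp only [mem_union, mem_ofPred_eq, not_or, not_not] at hcon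
  refine ht fun e he => ?_
  by_cases hne : ∃ x, Q t x
  · have : e < f t := not_le.1 fun h => he _ h (hfQ t hne).1
    filter_upwards [hcon.2, (continuousAt_iff_lt.1 hcon.1).1 e this] with u h1 h2 x hx hxQ
    exact absurd ((hfQ u ⟨x, hxQ⟩).2 x hxQ) (not_le.2 (hx.trans_lt h2))
  · filter_upwards [hcon.2] with u h1 x _ hxQ
    exact hne (h1.1 ⟨x, hxQ⟩)

theorem finite_not_upperStable {Q : R → R → Prop} (hQ : D.Def2 Q)
    (hfin : ∀ t, {x | Q t x}.Finite) : {t | ¬ UpperStable Q t}.Finite :=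
  finite_not_lowerStable (R := Rᵒᵈ) (D := D.dual) (Q := Q) (fun _ i j => hQ i j) hfin

theorem finite_not_pointStable {A : R → R → Prop} (hA : D.Def2 A)
    (hfin : ∀ t, {x | A t x}.Finite) : {t | ¬ PointStable A t}.Finite := by
  rcases isEmpty_or_nonempty R with h | ⟨⟨p₀⟩⟩
  · exact toFinite _
  simp only [PointStable, not_not]
  set B : R → R → Prop := fun t x => A t x ∧ ∃ c e, ((c < x ∧ x < e) ∧
    ∀ y, c ≤ y → y ≤ e → A t y → y = x) ∧
    ¬ ∀ᶠ u in 𝓝 t, ∃ y, ((c < y ∧ y ≤ e) ∧ A u y) ∧ ∀ z, c < z → z ≤ e → A u z → z = y with hBdef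
  have hB : D.Def2 B := by
    intro α i j
    refine D.and (hA _ _) <| D.ex <| D.ex <| D.and (D.and (D.and (D.lt _ _) (D.lt _ _)) <|
      all <| imp (le _ _) <| imp (le _ _) <| imp (hA _ _) (eq _ _)) <| D.not ?_
    refine def_eventually (p := fun v u => ∃ y, ((v (some none) < y ∧ y ≤ v none) ∧ A u y) ∧
      ∀ z, v (some none) < z → z ≤ v none → A u z → z = y) (some (some i)) ?_
    exact D.ex <| D.and (D.and (D.and (D.lt _ _) (le _ _)) (hA _ _)) <| all <| imp (D.lt _ _) <|
      imp (le _ _) <| imp (hA _ _) (eq _ _)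
  have hBfin : ∀ t, {x | B t x}.Finite := fun t => (hfin t).subset fun x hx => hx.1
  have hd : D.Def1 fun t => ∃ x, B t x := fun _ i => D.ex (hB _ _)
  by_contra hinf
  obtain ⟨a, b, hab, h⟩ := hd.exists_Ioo hinf
  obtain ⟨f, hf, hfB⟩ := exists_min_fun_one hB hBfin p₀
  have hplus : D.Def2 fun u x => A u x ∧ f u < x := fun _ i j =>
    D.and (hA _ _) (subst (hf (some i) none) (p := fun w y => y < w j) (D.lt _ _))
  have hminus : D.Def2 fun u x => A u x ∧ x < f u := fun _ i j =>
    D.and (hA _ _) (subst (hf (some i) none) (p := fun w y => w j < y) (D.lt _ _))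
  obtain ⟨t, ⟨hat, htb⟩, ht⟩ := ((Ioo_infinite hab).sdiff ((finite_not_continuousAt hf).union
    ((finite_not_lowerStable hplus fun t => (hfin t).subset fun x hx => hx.1).union
      (finite_not_upperStable hminus fun t => (hfin t).subset fun x hx => hx.1)))).nonempty
  simp only [mem_union, mem_ofPred_eq, not_or, not_not] at ht
  obtain ⟨hcont, hlow, hup⟩ := ht
  obtain ⟨-, c, e, ⟨⟨hc, he⟩, huniq⟩, hbad⟩ := (hfB t (h t hat htb)).1
  refine hbad ?_
  filter_upwards [Ioo_mem_nhds hat htb, (continuousAt_iff_lt.1 hcont).1 c hc,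
    (continuousAt_iff_lt.1 hcont).2 e he,
    hlow e fun x hx hx' => hx'.2.ne' (huniq x (hc.trans hx'.2).le hx hx'.1),
    hup c fun x hx hx' => hx'.2.ne (huniq x hx (hx'.2.trans he).le hx'.1)] with u h1 h2 h3 h4 h5
  refine ⟨f u, ⟨⟨h2, h3.le⟩, (hfB u (h u h1.1 h1.2)).1.1⟩, fun z h6 h7 h8 => ?_⟩
  rcases lt_trichotomy z (f u) with h9 | h9 | h9
  · exact absurd ⟨h8, h9⟩ (h5 z h6.le)
  · exact h9
  · exact absurd ⟨h8, h9⟩ (h4 z h7)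

/-- The parameters at which a family of finite sets is not locally stable. -/
def Bad (A : R → R → Prop) (t : R) : Prop :=
  ¬ LowerStable A t ∨ ¬ UpperStable A t ∨ ¬ PointStable A t

theorem finite_bad {A : R → R → Prop} (hA : D.Def2 A)
    (hfin : ∀ t, {x | A t x}.Finite) : {t | Bad A t}.Finite :=
  (finite_not_lowerStable hA hfin).union
    ((finite_not_upperStable hA hfin).union (finite_not_pointStable hA hfin))

theorem DefFam2.bad {A : (α → R) → R → R → Prop} (hA : D.DefFam2 A) :
    D.DefFam1 fun v t => Bad (A v) t := by
  intro β σ j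
  refine or (D.not ?_) (or (D.not ?_) (D.not (D.not ?_)))
  · refine all (imp (all (imp (le _ _) (D.not (hA (fun i => some (some (σ i))) _ _)))) ?_)
    exact def_eventually (p := fun w u => ∀ x, x ≤ w none → ¬ A (fun i => w (some (σ i))) u x)
      (some j) (all (imp (le _ _) (D.not (hA (fun i => some (some (some (σ i)))) _ _))))
  · refine all (imp (all (imp (le _ _) (D.not (hA (fun i => some (some (σ i))) _ _)))) ?_)
    exact def_eventually (p := fun w u => ∀ x, w none ≤ x → ¬ A (fun i => w (some (σ i))) u x)
      (some j) (all (imp (le _ _) (D.not (hA (fun i => some (some (some (σ i)))) _ _))))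
  · refine D.ex <| D.and (hA (fun i => some (σ i)) _ _) <| D.ex <| D.ex <|
      D.and (D.and (D.and (D.lt _ _) (D.lt _ _)) <|
      all <| imp (le _ _) <| imp (le _ _) <|
        imp (hA (fun i => some (some (some (some (σ i))))) _ _) (eq _ _)) <| D.not ?_
    refine def_eventually (p := fun w u => ∃ y, ((w (some none) < y ∧ y ≤ w none) ∧
      A (fun i => w (some (some (some (σ i))))) u y) ∧
      ∀ z, w (some none) < z → z ≤ w none → A (fun i => w (some (some (some (σ i))))) u z → z = y)
      (some (some (some j))) ?_
    exact D.ex <| D.and (D.and (D.and (D.lt _ _) (le _ _))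
      (hA (fun i => some (some (some (some (some (σ i)))))) _ _)) <| all <| imp (D.lt _ _) <|
      imp (le _ _) <|
        imp (hA (fun i => some (some (some (some (some (some (σ i))))))) _ _) (eq _ _)

theorem exists_lt_separating {s : Set R} (hs : s.Finite) (x : R) :
    ∃ c, c < x ∧ ∀ y ∈ s, y < x → y < c := by
  have : ∀ᶠ c in 𝓝[<] x, ∀ y ∈ s, y < x → y < c := by
    rw [Filter.eventually_all_finite hs]
    intro y _
    by_cases h : y < x
    · exact eventually_lt_iff.2 ⟨y, h, fun u h1 _ _ => h1⟩
    · exact Eventually.of_forall fun _ h' => absurd h' h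
  obtain ⟨m, hm, h⟩ := eventually_lt_iff.1 this
  obtain ⟨c, h1, h2⟩ := exists_between hm
  exact ⟨c, h2, h c h1 h2⟩

theorem eventually_ncard_le_eq {A : R → R → Prop} (hfin : ∀ t, {x | A t x}.Finite) {t : R}
    (hlow : LowerStable A t) (hpt : PointStable A t) (n : ℕ) :
    ∀ e, ¬ A t e → {x | x ≤ e ∧ A t x}.ncard = n →
      ∀ᶠ u in 𝓝 t, {x | x ≤ e ∧ A u x}.ncard = n := by
  have hfin' : ∀ u e, {x | x ≤ e ∧ A u x}.Finite := fun u e => (hfin u).subset fun x hx => hx.2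
  induction n with
  | zero =>
    intro e _ h
    rw [ncard_eq_zero (hfin' _ _), eq_empty_iff_forall_notMem] at h
    filter_upwards [hlow e fun x hx hA => h x ⟨hx, hA⟩] with u hu
    rw [ncard_eq_zero (hfin' _ _), eq_empty_iff_forall_notMem]
    exact fun x hx => hu x hx.1 hx.2
  | succ n ih =>
    intro e he h
    obtain ⟨x, ⟨hxe, hx⟩, hmax⟩ := (hfin' t e).exists_maximal
      (nonempty_of_ncard_ne_zero (by omega))
    replace hxe : x < e := hxe.lt_of_ne fun h => he (h ▸ hx)
    obtain ⟨c, hcx, hc⟩ := exists_lt_separating (hfin t) x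
    have hle : ∀ y, y ≤ e → A t y → y ≤ x := fun y h1 h2 =>
      (le_total y x).elim id fun h3 => hmax ⟨h1, h2⟩ h3
    have hcA : ¬ A t c := fun h => lt_irrefl _ (hc c h hcx)
    have hset : {y | y ≤ e ∧ A t y} = insert x {y | y ≤ c ∧ A t y} := by
      ext y
      simp only [mem_ofPred_eq, mem_insert_iff]
      constructor
      · rintro ⟨h1, h2⟩
        rcases (hle y h1 h2).eq_or_lt with h3 | h3
        · exact .inl h3
        · exact .inr ⟨(hc y h2 h3).le, h2⟩
      · rintro (rfl | ⟨h1, h2⟩)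
        · exact ⟨hxe.le, hx⟩
        · exact ⟨h1.trans (hcx.trans hxe).le, h2⟩
    rw [hset, ncard_insert_of_notMem (by simp [hcx]) (hfin' _ _)] at h
    have hone := not_not.1 fun hcon => hpt ⟨x, hx, c, e, ⟨⟨hcx, hxe⟩, fun y h1 h2 h3 =>
      (hle y h2 h3).eq_or_lt.resolve_right fun h4 => absurd (hc y h3 h4) (not_lt.2 h1)⟩, hcon⟩
    filter_upwards [ih c hcA (by omega), hone] with u h1 ⟨y, ⟨⟨h2, h3⟩, h4⟩, h5⟩
    have hset : {y | y ≤ e ∧ A u y} = insert y {y | y ≤ c ∧ A u y} := by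
      ext z
      simp only [mem_ofPred_eq, mem_insert_iff]
      constructor
      · rintro ⟨h6, h7⟩
        rcases le_or_gt z c with h8 | h8
        · exact .inr ⟨h8, h7⟩
        · exact .inl (h5 z h8 h6 h7)
      · rintro (rfl | ⟨h6, h7⟩)
        · exact ⟨h3, h4⟩
        · exact ⟨h6.trans (hcx.trans hxe).le, h7⟩
    rw [hset, ncard_insert_of_notMem (by simp [h2]) (hfin' _ _), h1]

/-- At a stable parameter the cardinality of the sets in the family is locally constant. -/
theorem eventually_ncard_eq {A : R → R → Prop} (hfin : ∀ t, {x | A t x}.Finite) {t : R}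
    (ht : ¬ Bad A t) : ∀ᶠ u in 𝓝 t, {x | A u x}.ncard = {x | A t x}.ncard := by
  simp only [Bad, not_or, not_not] at ht
  obtain ⟨hlow, hup, hpt⟩ := ht
  have : Nonempty R := ⟨t⟩
  obtain ⟨e₀, he₀⟩ := (hfin t).bddAbove
  obtain ⟨e, he⟩ := exists_gt e₀
  have heA : ∀ x, e ≤ x → ¬ A t x := fun x h h' => absurd (he₀ h') (not_le.2 (he.trans_le h))
  have hset : ∀ u, (∀ x, e ≤ x → ¬ A u x) → {x | A u x} = {x | x ≤ e ∧ A u x} := by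
    intro u hu
    ext x
    exact ⟨fun h => ⟨le_of_not_ge fun h' => hu x h' h, h⟩, fun h => h.2⟩
  filter_upwards [hup e heA,
    eventually_ncard_le_eq hfin hlow hpt _ e (heA e le_rfl) rfl] with u h1 h2
  rw [hset u h1, h2, hset t heA]

end Planar

end OMinSys

namespace OMinSys

section Uniform

variable {R : Type w}

/-- Extension of a tuple by one coordinate. -/
def cons {Γ : Type} (v : Γ → R) (t : R) : Option Γ → R := fun o => o.elim t v

theorem cons_comp {Γ β : Type} (w : β → R) (σ : Γ → β) (j : β) :
    cons (fun i => w (σ i)) (w j) = fun o : Option Γ => w (o.elim j σ) := by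
  funext o
  cases o <;> rfl

theorem cons_eta {Γ : Type} (w : Option Γ → R) : cons (fun i => w (some i)) (w none) = w := by
  funext o
  cases o <;> rfl

variable [LinearOrder R] [TopologicalSpace R] [OrderTopology R]
  [NoMinOrder R] [NoMaxOrder R] [DenselyOrdered R] {D : OMinSys R} {α Γ Γ' : Type}

theorem DefMap.comp {F : (Γ → R) → (α → R)} {G : (Γ' → R) → (Γ → R)} (hF : D.DefMap F)
    (hG : D.DefMap G) : D.DefMap fun v => F (G v) := fun δ σ p hp =>
  hG σ (fun u w => p (F u) w) <| hF (δ := Γ ⊕ δ) .inl (fun x w => p x fun i => w (.inr i)) <|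
    reindex hp (β := α ⊕ (Γ ⊕ δ)) (Sum.elim Sum.inl fun i => Sum.inr (Sum.inr i))

theorem DefMap.proj (σ : α → Γ) : D.DefMap fun (v : Γ → R) i => v (σ i) := fun _ σ' _ hp =>
  reindex hp (Sum.elim (fun i => σ' (σ i)) id)

theorem DefMap.cons {F : (Γ → R) → (α → R)} (hF : D.DefMap F) {f : (Γ → R) → R}
    (hf : D.DefFam1 fun v y => f v = y) : D.DefMap fun v => cons (F v) (f v) := by
  intro δ σ p hp
  refine subst (F := fun w : δ → R => f fun i => w (σ i)) (hf (fun i => some (σ i)) none)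
    (p := fun w y => p (OMinSys.cons (F fun i => w (σ i)) y) w) ?_
  refine hF (δ := Option δ) (fun i => some (σ i))
    (fun x w => p (OMinSys.cons x (w none)) fun i => w (some i)) ?_
  refine iff_congr (reindex hp (β := α ⊕ Option δ)
    (Sum.elim (fun o => o.elim (.inr none) .inl) fun i => .inr (some i))) fun w => ?_
  rw [cons_comp (fun i => w i) .inl (.inr none)]
  rfl

theorem DefMap.fam0 {F : (Γ → R) → (α → R)} (hF : D.DefMap F) {A : (α → R) → Prop}
    (hA : D.DefFam0 A) : D.DefFam0 fun v => A (F v) := fun _ σ =>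
  hF σ (fun x _ => A x) (hA _)

theorem DefMap.fam1 {F : (Γ → R) → (α → R)} (hF : D.DefMap F) {A : (α → R) → R → Prop}
    (hA : D.DefFam1 A) : D.DefFam1 fun v => A (F v) := fun _ σ j =>
  hF σ (fun x w => A x (w j)) (hA _ _)

theorem DefFam0.fam1 {A : (Option α → R) → Prop} (hA : D.DefFam0 A) :
    D.DefFam1 fun v t => A (OMinSys.cons v t) := fun _ σ j =>
  iff_congr (hA fun o => o.elim j σ) fun w => by simp only [cons_comp]

theorem DefFam1.fam2 {A : (Option α → R) → R → Prop} (hA : D.DefFam1 A) :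
    D.DefFam2 fun v t x => A (OMinSys.cons v t) x := fun _ σ j k =>
  iff_congr (hA (fun o => o.elim j σ) k) fun w => by simp only [cons_comp]

/-- A numerical function with definable levels that is locally constant along definable curves up
to a definable finite set of exceptions. -/
structure Tame (D : OMinSys R) (g : (α → R) → ℕ) : Prop where
  level : ∀ k, D.DefFam0 fun v => k ≤ g v
  stable : ∀ {Γ : Type} (γ : (Option Γ → R) → (α → R)), D.DefMap γ →
    ∃ T : (Γ → R) → R → Prop, D.DefFam1 T ∧ (∀ v, {t | T v t}.Finite) ∧
      ∀ v t, ¬ T v t → ∀ᶠ u in 𝓝 t, g (γ (OMinSys.cons v u)) = g (γ (OMinSys.cons v t))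

theorem Tame.comp {g : (α → R) → ℕ} (hg : Tame D g) {F : (Γ → R) → (α → R)}
    (hF : D.DefMap F) : Tame D fun v => g (F v) where
  level k := hF.fam0 (hg.level k)
  stable γ hγ := hg.stable (fun w => F (γ w)) (hF.comp hγ)

theorem succ_le_ncard_iff {s : Set R} (hs : s.Finite) (k : ℕ) :
    k + 1 ≤ s.ncard ↔ ∃ x, x ∈ s ∧ k ≤ {y | y ∈ s ∧ x < y}.ncard := by
  constructor
  · intro h
    obtain ⟨x, hx, hmin⟩ := hs.exists_minimal (nonempty_of_ncard_ne_zero (by omega))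
    refine ⟨x, hx, ?_⟩
    have : s = insert x {y | y ∈ s ∧ x < y} := by
      ext y
      simp only [mem_ofPred_eq, mem_insert_iff]
      constructor
      · intro hy
        rcases lt_trichotomy x y with h | h | h
        · exact .inr ⟨hy, h⟩
        · exact .inl h.symm
        · exact absurd (hmin hy h.le) (not_le.2 h)
      · rintro (rfl | h)
        · exact hx
        · exact h.1
    have h2 := ncard_insert_le x {y | y ∈ s ∧ x < y}
    rw [← this] at h2
    omega
  · rintro ⟨x, hx, h⟩
    have h2 : (insert x {y | y ∈ s ∧ x < y}).ncard ≤ s.ncard :=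
      ncard_le_ncard (insert_subset hx fun y hy => hy.1) hs
    rw [ncard_insert_of_notMem (by simp) (hs.subset fun y hy => hy.1)] at h2
    omega

theorem def_le_ncard (k : ℕ) : ∀ {α : Type} {T : (α → R) → R → Prop}, D.DefFam1 T →
    (∀ v, {x | T v x}.Finite) → D.DefFam0 fun v => k ≤ {x | T v x}.ncard := by
  induction k with
  | zero => exact fun _ _ _ _ => iff_congr (const True) fun _ => by simp
  | succ k ih =>
    intro α T hT hfin β σ
    have h := ih (α := Option α) (T := fun w y => T (fun i => w (some i)) y ∧ w none < y)
      (fun _ σ j => D.and (hT (fun i => σ (some i)) j) (D.lt _ _))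
      (fun w => (hfin _).subset fun x hx => hx.1)
    refine iff_congr (D.ex (p := fun w x => T (fun i => w (σ i)) x ∧
      k ≤ {y | T (fun i => w (σ i)) y ∧ x < y}.ncard)
      (D.and (hT (fun i => some (σ i)) none) (h fun o => o.elim none fun i => some (σ i))))
      fun w => succ_le_ncard_iff (hfin _) k

/-- Cardinalities in a definable family of finite sets. -/
theorem tame_ncard {T : (α → R) → R → Prop} (hT : D.DefFam1 T)
    (hfin : ∀ v, {x | T v x}.Finite) : Tame D fun v => {x | T v x}.ncard where
  level k := def_le_ncard k hT hfin
  stable γ hγ := by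
    have hA := (hγ.fam1 hT).fam2
    exact ⟨_, hA.bad, fun v => finite_bad (hA.fix v) fun t => hfin _,
      fun v t ht => eventually_ncard_eq (fun t => hfin _) ht⟩

/-- A definable family of uniformly finite sets is covered by finitely many definable functions. -/
theorem exists_enum [Nonempty R] (K : ℕ) : ∀ {T : (α → R) → R → Prop}, D.DefFam1 T →
    (∀ v, {x | T v x}.Finite) → (∀ v, {x | T v x}.ncard ≤ K) →
    ∃ f : Fin K → (α → R) → R, (∀ i, D.DefFam1 fun v y => f i v = y) ∧
      ∀ v t, T v t → ∃ i, f i v = t := by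
  induction K with
  | zero =>
    intro T hT hfin hK
    refine ⟨fun i => i.elim0, fun i => i.elim0, fun v t ht => ?_⟩
    have := (ncard_eq_zero (hfin v)).1 (Nat.le_zero.1 (hK v))
    exact (this ▸ ht : t ∈ (∅ : Set R)).elim
  | succ K ih =>
    intro T hT hfin hK
    obtain ⟨f₀, hf₀, hmin⟩ := exists_min_fun hT hfin (Classical.arbitrary R)
    obtain ⟨f, hf, h⟩ := ih (T := fun v t => T v t ∧ ¬ f₀ v = t)
      (fun _ σ j => D.and (hT _ _) (D.not (hf₀ _ _)))
      (fun v => (hfin v).subset fun x hx => hx.1) (fun v => by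
        by_cases hne : ∃ x, T v x
        · have h1 : {x | T v x ∧ ¬ f₀ v = x} ⊆ {x | T v x} \ {f₀ v} :=
            fun x hx => ⟨hx.1, fun h => hx.2 h.symm⟩
          have h2 := ncard_le_ncard h1 ((hfin v).sdiff)
          have h3 := ncard_sdiff_singleton_add_one (s := {x | T v x}) (hmin v hne).1 (hfin v)
          have := hK v
          omega
        · rw [show {x | T v x ∧ ¬ f₀ v = x} = ∅ from
            eq_empty_iff_forall_notMem.2 fun x hx => hne ⟨x, hx.1⟩]
          simp)
    refine ⟨Fin.cons f₀ f, fun i => Fin.cases hf₀ hf i, fun v t ht => ?_⟩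
    by_cases h0 : f₀ v = t
    · exact ⟨0, h0⟩
    · obtain ⟨i, hi⟩ := h v t ⟨ht, h0⟩
      exact ⟨i.succ, hi⟩

/-- Membership in the sets of the family is, along definable curves, an open condition on the
parameter up to finitely many exceptions. -/
def Stab (D : OMinSys R) (G : (α → R) → R → Prop) : Prop :=
  ∀ ⦃Γ : Type⦄ (γ : (Option Γ → R) → (α → R)), D.DefMap γ → ∀ v : Γ → R,
    {u | ¬ ∀ t, G (γ (OMinSys.cons v u)) t →
      ∀ᶠ u' in 𝓝 u, G (γ (OMinSys.cons v u')) t}.Finite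

theorem Stab.and {G H : (α → R) → R → Prop} (hG : D.Stab G) (hH : D.Stab H) :
    D.Stab fun v t => G v t ∧ H v t := fun Γ γ hγ v =>
  ((hG γ hγ v).union (hH γ hγ v)).subset fun u hu => by
    by_contra hcon
    simp only [mem_union, mem_ofPred_eq, not_or, not_not] at hcon
    exact hu fun t ht => (hcon.1 t ht.1).and (hcon.2 t ht.2)

theorem stab_true : D.Stab fun (_ : α → R) _ => True := fun Γ γ hγ v => by simp

theorem stab_lt {f : (α → R) → R} (hf : D.DefFam1 fun v y => f v = y) :
    D.Stab fun v t => f v < t := fun _ γ hγ v =>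
  (finite_not_continuousAt (D := D) (f := fun u => f (γ (OMinSys.cons v u)))
    ((hγ.fam1 hf).fam2.fix v)).subset fun _ hu hcon => hu fun t ht =>
      (continuousAt_iff_lt.1 hcon).2 t ht

theorem stab_gt {f : (α → R) → R} (hf : D.DefFam1 fun v y => f v = y) :
    D.Stab fun v t => t < f v := fun _ γ hγ v =>
  (finite_not_continuousAt (D := D) (f := fun u => f (γ (OMinSys.cons v u)))
    ((hγ.fam1 hf).fam2.fix v)).subset fun _ hu hcon => hu fun t ht =>
      (continuousAt_iff_lt.1 hcon).1 t ht

/-- The common value of a tame function on a definable family of intervals free of exceptional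
points is tame. -/
theorem Tame.gap {g : (Option α → R) → ℕ} (hg : Tame D g) {T : (α → R) → R → Prop}
    (hT : D.DefFam1 T)
    (hTg : ∀ v t, ¬ T v t → ∀ᶠ u in 𝓝 t, g (OMinSys.cons v u) = g (OMinSys.cons v t))
    {G : (α → R) → R → Prop} (hG : D.DefFam1 G) (hstab : D.Stab G)
    (hconv : ∀ v s t x, G v s → G v t → s ≤ x → x ≤ t → G v x) :
    ∃ g' : (α → R) → ℕ, Tame D g' ∧
      ∀ v t, (∀ s, G v s → ¬ T v s) → G v t → g (OMinSys.cons v t) = g' v := by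
  classical
  set N : (α → R) → Prop := fun v => (∃ t, G v t) ∧ ∀ s, G v s → ¬ T v s with hN
  have hNdef : D.DefFam0 N := fun _ σ =>
    D.and (D.ex (hG (fun i => some (σ i)) none))
      (all (imp (hG (fun i => some (σ i)) none) (D.not (hT (fun i => some (σ i)) none))))
  have hle : ∀ v s t, N v → G v s → G v t → s ≤ t →
      g (OMinSys.cons v s) = g (OMinSys.cons v t) := by
    intro v s t hv hs ht hst
    refine eq_of_forall_le_iff fun k => ?_
    refine ((hg.level k).fam1.fix v).connected hst fun x h1 h2 => ?_
    filter_upwards [hTg v x (hv.2 x (hconv v s t x hs ht h1 h2))] with u hu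
    rw [hu]
  have hconst : ∀ v s t, N v → G v s → G v t →
      g (OMinSys.cons v s) = g (OMinSys.cons v t) := by
    intro v s t hv hs ht
    rcases le_total s t with h | h
    · exact hle v s t hv hs ht h
    · exact (hle v t s hv ht hs h).symm
  obtain ⟨g', hg'⟩ : ∃ g' : (α → R) → ℕ, ∀ v,
      (N v → ∀ t, G v t → g (OMinSys.cons v t) = g' v) ∧ (¬ N v → g' v = 0) := by
    refine ⟨fun v => if h : N v then g (OMinSys.cons v h.1.choose) else 0, fun v => ⟨?_, ?_⟩⟩
    · intro h t ht
      simp only [h, dite_true]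
      exact hconst v _ _ h ht h.1.choose_spec
    · intro h
      simp [h]
  refine ⟨g', ⟨fun k β σ => ?_, ?_⟩, fun v t h ht => (hg' v).1 ⟨⟨t, ht⟩, h⟩ t ht⟩
  · refine iff_congr (p := fun w => (N (fun i => w (σ i)) ∧
      ∃ t, G (fun i => w (σ i)) t ∧ k ≤ g (OMinSys.cons (fun i => w (σ i)) t)) ∨
      (¬ N (fun i => w (σ i)) ∧ k ≤ 0)) ?_ fun w => ?_
    · exact or (D.and (hNdef _) (D.ex (D.and (hG (fun i => some (σ i)) none)
        ((hg.level k).fam1 (fun i => some (σ i)) none)))) (D.and (D.not (hNdef _)) (const _))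
    · by_cases h : N fun i => w (σ i)
      · simp only [h, true_and, not_true, false_and, or_false]
        constructor
        · intro h'
          obtain ⟨t, ht⟩ := h.1
          exact ⟨t, ht, by rwa [(hg' _).1 h t ht]⟩
        · rintro ⟨t, ht, h'⟩
          rwa [(hg' _).1 h t ht] at h'
      · simp only [h, not_false_eq_true, false_and, true_and, false_or]
        rw [(hg' _).2 h]
  · intro Γ γ hγ
    set γ' : (Option (Option Γ) → R) → (Option α → R) := fun w =>
      OMinSys.cons (γ fun o => w (o.elim none fun i => some (some i))) (w (some none)) with hγ'def
    have hγ' : D.DefMap γ' := (hγ.comp (DefMap.proj _)).cons fun _ σ j => eq _ _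
    have hγ'eq : ∀ v t u, γ' (OMinSys.cons (OMinSys.cons v t) u) =
        OMinSys.cons (γ (OMinSys.cons v u)) t := by
      intro v t u
      have : (fun o : Option Γ => OMinSys.cons (OMinSys.cons v t) u
          (o.elim none fun i => some (some i))) = OMinSys.cons v u := by
        funext o
        cases o <;> rfl
      simp only [hγ'def, this]
      rfl
    obtain ⟨S, hS, hSfin, hSg⟩ := hg.stable γ' hγ'
    have hGγ := (hγ.fam1 hG).fam2
    have hNγ := (hγ.fam0 hNdef).fam1
    have hC : D.DefFam1 fun (v : Γ → R) u => N (γ (OMinSys.cons v u)) ∧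
        ∀ t, G (γ (OMinSys.cons v u)) t → S (OMinSys.cons v t) u := fun _ σ j =>
      D.and (hNγ _ _) (all (imp (hGγ (fun i => some (σ i)) _ _)
        (hS.fam2 (fun i => some (σ i)) _ _)))
    refine ⟨fun v u => (¬ ∀ᶠ u' in 𝓝 u, (N (γ (OMinSys.cons v u')) ↔ N (γ (OMinSys.cons v u)))) ∨
      (¬ ∀ t, G (γ (OMinSys.cons v u)) t → ∀ᶠ u' in 𝓝 u, G (γ (OMinSys.cons v u')) t) ∨
      (N (γ (OMinSys.cons v u)) ∧ ∀ t, G (γ (OMinSys.cons v u)) t → S (OMinSys.cons v t) u),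
      ?_, ?_, ?_⟩
    · intro β σ j
      refine or (D.not ?_) (or (D.not (all (imp (hGγ (fun i => some (σ i)) _ _) ?_))) (hC _ _))
      · exact def_eventually (p := fun w u' => N (γ (OMinSys.cons (fun i => w (σ i)) u')) ↔
          N (γ (OMinSys.cons (fun i => w (σ i)) (w j)))) j
          (iff (hNγ (fun i => some (σ i)) _) (hNγ (fun i => some (σ i)) _))
      · exact def_eventually
          (p := fun w u' => G (γ (OMinSys.cons (fun i => w (some (σ i))) u')) (w none)) (some j)
          (hGγ (fun i => some (some (σ i))) _ _)
    · intro v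
      refine ((hNγ.fix v).finite_not_locConst).union ((hstab γ hγ v).union ?_)
      by_contra hinf
      obtain ⟨a, b, hab, h⟩ := (hC.fix v).exists_Ioo hinf
      obtain ⟨u, ⟨hau, hub⟩, hu⟩ := ((Ioo_infinite hab).sdiff (hstab γ hγ v)).nonempty
      simp only [mem_ofPred_eq, not_not] at hu
      obtain ⟨t, ht⟩ := (h u hau hub).1.1
      obtain ⟨l, m, hlm, h'⟩ := eventually_nhds_iff.1
        (Eventually.and (Ioo_mem_nhds hau hub) (hu t ht))
      refine (Ioo_infinite (hlm.1.trans hlm.2)).mono ?_ (hSfin (OMinSys.cons v t))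
      intro x hx
      have := h' x hx.1 hx.2
      exact (h x this.1.1 this.1.2).2 t this.2
    · intro v u hu
      simp only [not_or, not_not, not_and] at hu
      obtain ⟨h1, h2, h3⟩ := hu
      by_cases hNu : N (γ (OMinSys.cons v u))
      · have := h3 hNu
        push Not at this
        obtain ⟨t, ht, hSt⟩ := this
        filter_upwards [h1, h2 t ht, hSg _ _ hSt] with u' h4 h5 h6
        rw [hγ'eq, hγ'eq] at h6
        rw [← (hg' _).1 (h4.2 hNu) t h5, ← (hg' _).1 hNu t ht, h6]
      · filter_upwards [h1] with u' h4
        rw [(hg' _).2 hNu, (hg' _).2 fun h => hNu (h4.1 h)]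

theorem Tame.bounded_option (ih : ∀ g : (α → R) → ℕ, Tame D g → ∃ K, ∀ v, g v ≤ K)
    {g : (Option α → R) → ℕ} (hg : Tame D g) : ∃ K, ∀ v, g v ≤ K := by
  rcases isEmpty_or_nonempty R with hR | hR
  · exact ⟨0, fun v => isEmptyElim (v none)⟩
  obtain ⟨T, hT, hTfin, hTg⟩ := hg.stable (fun w => w) (DefMap.proj id)
  obtain ⟨K, hK⟩ := ih _ (tame_ncard hT hTfin)
  obtain ⟨f, hf, hfT⟩ := exists_enum K hT hTfin hK
  have hgraph : ∀ i, ∃ B, ∀ v, g (OMinSys.cons v (f i v)) ≤ B := fun i =>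
    ih _ (hg.comp ((DefMap.proj id).cons (hf i)))
  choose B hB using hgraph
  let lo : Option (Fin K) → (α → R) → R → Prop := fun i v t => i.elim True fun k => f k v < t
  let hi : Option (Fin K) → (α → R) → R → Prop := fun i v t => i.elim True fun k => t < f k v
  have hlo : ∀ i, D.DefFam1 (lo i) ∧ D.Stab (lo i) := by
    rintro (_ | i)
    · exact ⟨fun _ _ _ => const True, stab_true⟩
    · exact ⟨fun _ σ j => subst (F := fun w => f i fun k => w (σ k))
        (hf i (fun k => some (σ k)) none) (p := fun w y => y < w j) (D.lt _ _), stab_lt (hf i)⟩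
  have hhi : ∀ i, D.DefFam1 (hi i) ∧ D.Stab (hi i) := by
    rintro (_ | i)
    · exact ⟨fun _ _ _ => const True, stab_true⟩
    · exact ⟨fun _ σ j => subst (F := fun w => f i fun k => w (σ k))
        (hf i (fun k => some (σ k)) none) (p := fun w y => w j < y) (D.lt _ _), stab_gt (hf i)⟩
  have hgap : ∀ ij : Option (Fin K) × Option (Fin K), ∃ B, ∀ v t,
      (∀ s, lo ij.1 v s ∧ hi ij.2 v s → ¬ T v s) → lo ij.1 v t ∧ hi ij.2 v t →
      g (OMinSys.cons v t) ≤ B := by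
    rintro ⟨i, j⟩
    obtain ⟨g', hg', h⟩ := hg.gap hT hTg (G := fun v s => lo i v s ∧ hi j v s)
      (fun _ σ k => D.and ((hlo i).1 _ _) ((hhi j).1 _ _)) ((hlo i).2.and (hhi j).2) (by
        intro v s t x hs ht h1 h2
        refine ⟨?_, ?_⟩
        · cases i with
          | none => trivial
          | some i => exact lt_of_lt_of_le hs.1 h1
        · cases j with
          | none => trivial
          | some j => exact lt_of_le_of_lt h2 ht.2)
    obtain ⟨B, hB⟩ := ih g' hg'
    exact ⟨B, fun v t h1 h2 => (h v t h1 h2).trans_le (hB v)⟩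
  choose B' hB' using hgap
  obtain ⟨C, hC⟩ := (finite_range B).bddAbove
  obtain ⟨C', hC'⟩ := (finite_range B').bddAbove
  refine ⟨max C C', fun w => ?_⟩
  rw [← cons_eta w]
  set v : α → R := fun i => w (some i)
  set t := w none
  by_cases hTt : T v t
  · obtain ⟨i, hi⟩ := hfT v t hTt
    rw [← hi]
    exact (hB i v).trans ((hC ⟨i, rfl⟩).trans (le_max_left _ _))
  · have h1 : ∃ i, lo i v t ∧ ∀ k, f k v < t → ∀ s, lo i v s → f k v < s := by
      by_cases h : ∃ k, f k v < t
      · obtain ⟨i, h1, h2⟩ := exists_max_image {k | f k v < t} (fun k => f k v) (toFinite _) h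
        exact ⟨some i, h1, fun k hk s hs => (h2 k hk).trans_lt hs⟩
      · exact ⟨none, trivial, fun k hk => absurd ⟨k, hk⟩ h⟩
    have h2 : ∃ i, hi i v t ∧ ∀ k, t < f k v → ∀ s, hi i v s → s < f k v := by
      by_cases h : ∃ k, t < f k v
      · obtain ⟨i, h1, h2⟩ := exists_min_image {k | t < f k v} (fun k => f k v) (toFinite _) h
        exact ⟨some i, h1, fun k hk s hs => lt_of_lt_of_le hs (h2 k hk)⟩
      · exact ⟨none, trivial, fun k hk => absurd ⟨k, hk⟩ h⟩
    obtain ⟨i, hi1, hi2⟩ := h1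
    obtain ⟨j, hj1, hj2⟩ := h2
    refine (hB' (i, j) v t (fun s hs hTs => ?_) ⟨hi1, hj1⟩).trans
      ((hC' ⟨_, rfl⟩).trans (le_max_right _ _))
    obtain ⟨k, rfl⟩ := hfT v s hTs
    rcases lt_trichotomy (f k v) t with h | h | h
    · exact lt_irrefl _ (hi2 k h _ hs.1)
    · exact hTt (h ▸ hTs)
    · exact lt_irrefl _ (hj2 k h _ hs.2)

theorem Tame.bounded [Finite α] {g : (α → R) → ℕ} (hg : Tame D g) : ∃ K, ∀ v, g v ≤ K := by
  revert g
  refine Finite.induction_empty_option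
    (P := fun α => ∀ {g : (α → R) → ℕ}, Tame D g → ∃ K, ∀ v, g v ≤ K) ?_ ?_ ?_ α
  · intro α β e ih g hg
    obtain ⟨K, hK⟩ := ih (hg.comp (DefMap.proj e.symm))
    refine ⟨K, fun v => ?_⟩
    have := hK fun i => v (e i)
    simpa using this
  · intro g _
    exact ⟨g isEmptyElim, fun v => le_of_eq (congrArg g (Subsingleton.elim _ _))⟩
  · intro α _ ih g hg
    exact hg.bounded_option fun g hg => ih hg

/-- Uniform finiteness: the sets in a definable family of finite sets have bounded cardinality. -/
theorem uniform_finiteness [Finite α] {S : (α → R) → R → Prop} (hS : D.DefFam1 S)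
    (hfin : ∀ v, {x | S v x}.Finite) : ∃ K, ∀ v, {x | S v x}.ncard ≤ K :=
  (tame_ncard hS hfin).bounded

end Uniform

end OMinSys

section CutInvariance

variable {M : Type w} [LinearOrder M] {ι : Type}

/-- Membership in `s` depends only on the position relative to the points `p i`. -/
def CutInvariant (p : ι → M) (s : Set M) : Prop :=
  ∀ x z, (∀ i, (x < p i ↔ z < p i) ∧ (p i < x ↔ p i < z)) → (x ∈ s ↔ z ∈ s)

theorem IsOpenIntervalSet.exists_finset {s : Set M} (h : IsOpenIntervalSet s) :
    ∃ E : Finset M, ∀ x z, (∀ c ∈ E, (x < c ↔ z < c) ∧ (c < x ↔ c < z)) → (x ∈ s ↔ z ∈ s) := by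
  classical
  rcases h with ⟨a, b, rfl⟩ | ⟨a, rfl⟩ | ⟨b, rfl⟩ | rfl
  · exact ⟨{a, b}, fun x z h => and_congr (h a (by simp)).2 (h b (by simp)).1⟩
  · exact ⟨{a}, fun x z h => (h a (by simp)).2⟩
  · exact ⟨{b}, fun x z h => (h b (by simp)).1⟩
  · exact ⟨∅, fun x z _ => by simp⟩

theorem IsFinUnionPointsIntervals.exists_finset {s : Set M} (h : IsFinUnionPointsIntervals s) :
    ∃ E : Finset M, ∀ x z, (∀ c ∈ E, (x < c ↔ z < c) ∧ (c < x ↔ c < z)) → (x ∈ s ↔ z ∈ s) := by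
  classical
  obtain ⟨F, n, J, hJ, rfl⟩ := h
  choose E hE using fun k => (hJ k).exists_finset
  refine ⟨F ∪ Finset.univ.biUnion E, fun x z h => or_congr ?_ ?_⟩
  · have key : ∀ c ∈ F, x = c ↔ z = c := fun c hc => by
      have := h c (by simp [hc])
      rw [eq_iff_le_not_lt, eq_iff_le_not_lt, ← not_lt, ← not_lt, this.1, this.2]
    exact ⟨fun hx => ((key x hx).1 rfl).symm ▸ hx, fun hz => ((key z hz).2 rfl).symm ▸ hz⟩
  · simp only [mem_iUnion]
    refine exists_congr fun k => hE k x z fun c hc => h c ?_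
    simp only [Finset.mem_union, Finset.mem_biUnion, Finset.mem_univ, true_and]
    exact .inr ⟨k, hc⟩

theorem IsFinUnionPointsIntervals.exists_cutInvariant {s : Set M}
    (h : IsFinUnionPointsIntervals s) : ∃ (K : ℕ) (p : Fin K → M), CutInvariant p s := by
  obtain ⟨E, hE⟩ := h.exists_finset
  refine ⟨E.card, fun i => E.equivFin.symm i, fun x z h => hE x z fun c hc => ?_⟩
  simpa using h (E.equivFin ⟨c, hc⟩)

theorem isOpenIntervalSet_option (i j : Option M) :
    IsOpenIntervalSet {x | (∀ a ∈ i, a < x) ∧ ∀ b ∈ j, x < b} := by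
  rcases i with _ | a <;> rcases j with _ | b
  · exact .inr <| .inr <| .inr <| by ext; simp
  · exact .inr <| .inr <| .inl ⟨b, by ext; simp⟩
  · exact .inr <| .inl ⟨a, by ext; simp⟩
  · exact .inl ⟨a, b, by ext; simp⟩

theorem exists_greatest_option [Finite ι] (p : ι → M) (x : M) :
    ∃ i : Option ι, (∀ k ∈ i, p k < x) ∧ ∀ k, p k < x → ∃ l ∈ i, p k ≤ p l := by
  by_cases h : ∃ k, p k < x
  · obtain ⟨l, hl, hmax⟩ := (toFinite {k | p k < x}).exists_maximalFor p _ h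
    exact ⟨some l, by simpa using hl, fun k hk => ⟨l, rfl,
      (le_total (p k) (p l)).elim id fun h => hmax hk h⟩⟩
  · push Not at h
    exact ⟨none, by simp, fun k hk => absurd hk (h k).not_gt⟩

theorem CutInvariant.isFinUnionPointsIntervals [Finite ι] {p : ι → M} {s : Set M}
    (h : CutInvariant p s) : IsFinUnionPointsIntervals s := by
  classical
  let I (q : Option ι × Option ι) : Set M :=
    {x | (∀ a ∈ q.1.map p, a < x) ∧ ∀ b ∈ q.2.map p, x < b}
  let T := {q : Option ι × Option ι // I q ⊆ s}
  obtain ⟨n, ⟨e⟩⟩ := Finite.exists_equiv_fin T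
  refine ⟨((finite_range p).inter_of_left s).toFinset, n, fun k => I (e.symm k),
    fun k => isOpenIntervalSet_option _ _, ?_⟩
  ext x
  simp only [Finite.coe_toFinset, mem_union, mem_inter_iff, mem_iUnion]
  constructor
  · intro hx
    by_cases hp : x ∈ range p
    · exact .inl ⟨hp, hx⟩
    obtain ⟨i, hi, hi'⟩ := exists_greatest_option p x
    obtain ⟨j, hj, hj'⟩ := exists_greatest_option (M := Mᵒᵈ) (fun k => OrderDual.toDual (p k))
      (OrderDual.toDual x)
    simp only [OrderDual.toDual_lt_toDual, OrderDual.toDual_le_toDual] at hj hj'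
    have hI : I (i, j) ⊆ s := by
      intro z hz
      simp only [I, mem_ofPred_eq, Option.mem_map, forall_exists_index, and_imp,
        forall_apply_eq_imp_iff₂] at hz
      refine (h x z fun k => ?_).1 hx
      rcases lt_trichotomy x (p k) with hk | hk | hk
      · obtain ⟨l, hl, hkl⟩ := hj' k hk
        have := (hz.2 l hl).trans_le hkl
        simp [hk, this, hk.not_gt, this.not_gt]
      · exact absurd ⟨k, hk.symm⟩ hp
      · obtain ⟨l, hl, hkl⟩ := hi' k hk
        have := hkl.trans_lt (hz.1 l hl)
        simp [hk, this, hk.not_gt, this.not_gt]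
    refine .inr ⟨e ⟨(i, j), hI⟩, ?_⟩
    simp only [Equiv.symm_apply_apply, I, mem_ofPred_eq, Option.mem_map, forall_exists_index,
      and_imp, forall_apply_eq_imp_iff₂]
    exact ⟨hi, hj⟩
  · rintro (hx | ⟨k, hk⟩)
    · exact hx.2
    · exact (e.symm k).2 hk

theorem Set.Finite.exists_fin_range {R : Type w} [Nonempty R] {s : Set R} (hs : s.Finite) {K : ℕ}
    (hK : s.ncard ≤ K) : ∃ p : Fin K → R, s ⊆ range p := by
  classical
  obtain ⟨r⟩ := ‹Nonempty R›
  have := hs.to_subtype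
  let e := Finite.equivFinOfCardEq (α := s) (n := s.ncard) rfl
  refine ⟨fun i => if h : i.1 < s.ncard then (e.symm ⟨i, h⟩ : R) else r, fun x hx => ?_⟩
  refine ⟨⟨e ⟨x, hx⟩, (e ⟨x, hx⟩).2.trans_le hK⟩, ?_⟩
  simp

end CutInvariance

section Formulas

open FirstOrder.Language

variable {L : FirstOrder.Language.{u, v}} [L.IsOrdered] {M : Type w} [LinearOrder M]
  [L.Structure M] [L.OrderedStructure M]

/-- The formula `i < j` between two variables. -/
def varLt {α : Type*} (i j : α) : L.Formula α :=
  Term.lt (n := 0) (Term.var (.inl i)) (Term.var (.inl j))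

@[simp]
theorem realize_varLt {α : Type*} (i j : α) (v : α → M) :
    (varLt i j : L.Formula α).Realize v ↔ v i < v j := by
  simp [varLt, Formula.Realize]

/-- The formula stating that the set `φ(v, ·)` is cut invariant for some `K` points. -/
noncomputable def cutFormula {α : Type} (K : ℕ) (φ : L.Formula (α ⊕ Unit)) : L.Formula α :=
  Formula.iExs (Fin K) <| Formula.iAlls Bool <|
    (Formula.iInf fun i : Fin K =>
      ((varLt (.inr true) (.inl (.inr i))).iff (varLt (.inr false) (.inl (.inr i)))) ⊓
      ((varLt (.inl (.inr i)) (.inr true)).iff (varLt (.inl (.inr i)) (.inr false)))).imp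
    ((φ.relabel (Sum.elim (fun a => .inl (.inl a)) fun _ => .inr true)).iff
      (φ.relabel (Sum.elim (fun a => .inl (.inl a)) fun _ => .inr false)))

theorem realize_cutFormula {α : Type} (K : ℕ) (φ : L.Formula (α ⊕ Unit)) (v : α → M) :
    (cutFormula K φ).Realize v ↔
      ∃ p : Fin K → M, CutInvariant p {x | φ.Realize (Sum.elim v fun _ => x)} := by
  have key : ∀ (p : Fin K → M) (w : Bool → M) (t : Bool),
      Sum.elim (Sum.elim v p) w ∘ (Sum.elim (fun a => .inl (.inl a)) fun _ => .inr t) =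
        Sum.elim v fun _ : Unit => w t := by
    intro p w t; ext i; rcases i with i | i <;> rfl
  simp only [cutFormula, Formula.realize_iExs, Formula.realize_iAlls, Formula.realize_imp,
    Formula.realize_iInf, Formula.realize_inf, Formula.realize_iff, realize_varLt,
    Formula.realize_relabel, key, Sum.elim_inl, Sum.elim_inr, CutInvariant, mem_ofPred_eq]
  exact exists_congr fun p => ⟨fun h x z => h (fun t => if t then x else z), fun h w => h _ _⟩

theorem exists_formula_of_definable₁ {s : Set M} (h : (univ : Set M).Definable₁ L s) :
    ∃ (n : ℕ) (c : Fin n → M) (φ : L.Formula (Fin n ⊕ Unit)),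
      s = {x | φ.Realize (Sum.elim c fun _ => x)} := by
  obtain ⟨A, -, hA⟩ := definable_iff_finitely_definable.1 h
  obtain ⟨φ, hφ⟩ := definable_iff_exists_formula_sum.1 hA
  refine ⟨A.card, fun i => A.equivFin.symm i, φ.relabel (Sum.map A.equivFin fun _ => ()), ?_⟩
  ext x
  have := Set.ext_iff.1 hφ fun _ => x
  simp only [mem_ofPred_eq] at this
  rw [this, mem_ofPred_eq, Formula.realize_relabel]
  refine iff_of_eq (congrArg _ ?_)
  ext i
  rcases i with i | i <;> simp

theorem definable₁_of_formula {β : Type*} (c : β → M) (φ : L.Formula (β ⊕ Unit)) :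
    (univ : Set M).Definable₁ L {x | φ.Realize (Sum.elim c fun _ => x)} := by
  refine definable_iff_exists_formula_sum.2
    ⟨φ.relabel (Sum.map (fun i => ⟨c i, mem_univ _⟩) fun _ => 0), ?_⟩
  ext x
  simp only [mem_ofPred_eq, Formula.realize_relabel]
  refine iff_of_eq (congrArg _ ?_)
  ext i
  rcases i with i | i <;> simp

end Formulas

section Interval

open FirstOrder.Language

variable {L : FirstOrder.Language.{u, v}} [L.IsOrdered] {M : Type w} [LinearOrder M]
  [L.Structure M] [L.OrderedStructure M]

/-- The definable predicates on a bounded open interval of an almost o-minimal structure. -/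
noncomputable def intervalSys (h : IsAlmostOMinimal L M) (a b : M) : OMinSys (Ioo a b) where
  Def {α} p := ∃ φ : L.Formula (α ⊕ M), ∀ v : α → Ioo a b,
    φ.Realize (Sum.elim (fun i => (v i : M)) id) ↔ p v
  and := fun ⟨φ, hφ⟩ ⟨ψ, hψ⟩ => ⟨φ ⊓ ψ, fun v => by rw [Formula.realize_inf, hφ, hψ]⟩
  not := fun ⟨φ, hφ⟩ => ⟨φ.not, fun v => by rw [Formula.realize_not, hφ]⟩
  comp := fun σ p ⟨φ, hφ⟩ =>
    ⟨φ.relabel (Sum.elim (fun i => (σ i).map id Subtype.val) .inr), fun v => by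
      rw [Formula.realize_relabel]
      refine Iff.trans ?_ (hφ _)
      refine iff_of_eq (congrArg _ ?_)
      ext i
      rcases i with i | i
      · simp only [Function.comp_apply, Sum.elim_inl]
        rcases σ i with j | r <;> rfl
      · rfl⟩
  ex := fun {α p} ⟨φ, hφ⟩ => by
    refine ⟨Formula.iExs Unit (varLt (.inl (.inr a)) (.inr ()) ⊓ varLt (.inr ()) (.inl (.inr b)) ⊓
      φ.relabel (Sum.elim (fun o => o.elim (.inr ()) fun i => .inl (.inl i))
        fun m => .inl (.inr m))), fun v => ?_⟩
    have key : ∀ r : Ioo a b, φ.Realize (Sum.elim (Sum.elim (fun i => (v i : M)) id)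
        (fun _ : Unit => (r : M)) ∘ (Sum.elim (fun o => o.elim (.inr ()) fun i => .inl (.inl i))
        fun m => .inl (.inr m))) ↔ p v r := fun r => by
      refine Iff.trans ?_ (hφ fun o => o.elim r v)
      refine iff_of_eq (congrArg _ ?_)
      ext i
      rcases i with (_ | i) | i <;> rfl
    simp only [Formula.realize_iExs, Formula.realize_inf, realize_varLt, Formula.realize_relabel,
      Sum.elim_inl, Sum.elim_inr, id]
    exact ⟨fun ⟨w, hw, h⟩ => ⟨⟨w (), hw⟩, (key _).1 h⟩,
      fun ⟨r, hr⟩ => ⟨fun _ => r, r.2, (key r).2 hr⟩⟩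
  lt := fun i j => ⟨varLt (.inl i) (.inl j), fun v => by simp⟩
  tame := fun p hp => by
    classical
    obtain ⟨φ, hφ⟩ := hp ()
    let ψ : L.Formula (M ⊕ Unit) :=
      φ.relabel Sum.swap ⊓ (varLt (.inl a) (.inr ()) ⊓ varLt (.inr ()) (.inl b))
    have hψ : ∀ x, ψ.Realize (Sum.elim id fun _ => x) ↔
        φ.Realize (Sum.elim (fun _ => x) id) ∧ a < x ∧ x < b := fun x => by
      simp only [ψ, Formula.realize_inf, realize_varLt, Formula.realize_relabel, Sum.elim_inl,
        Sum.elim_inr, id]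
      refine and_congr_left fun _ => iff_of_eq (congrArg _ ?_)
      ext i
      rcases i with i | i <;> rfl
    obtain ⟨E, hE⟩ := (h _ (definable₁_of_formula id ψ)
      ⟨b, fun x hx => ((hψ x).1 hx).2.2.le⟩ ⟨a, fun x hx => ((hψ x).1 hx).2.1.le⟩).exists_finset
    refine ⟨E.subtype _, fun x y hxy => ?_⟩
    have := hE x y fun c hc => ?_
    · refine ((hφ fun _ => x).symm.trans ?_).trans (hφ fun _ => y)
      simpa only [mem_ofPred_eq, hψ, x.2.1, x.2.2, y.2.1, y.2.2, and_true] using this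
    · by_cases hca : a < c
      · by_cases hcb : c < b
        · exact hxy ⟨c, hca, hcb⟩ (by simpa using hc)
        · rw [not_lt] at hcb
          have h1 := x.2.2.trans_le hcb
          have h2 := y.2.2.trans_le hcb
          simp [h1, h2, h1.not_gt, h2.not_gt]
      · rw [not_lt] at hca
        have h1 := hca.trans_lt x.2.1
        have h2 := hca.trans_lt y.2.1
        simp [h1, h2, h1.not_gt, h2.not_gt]

/-- In an almost o-minimal structure, the traces on a bounded open interval of the members of a
definable family with parameters in that interval are uniformly tame. -/
theorem IsAlmostOMinimal.uniform [DenselyOrdered M] (h : IsAlmostOMinimal L M) {a b : M}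
    (hab : a < b) {n : ℕ} (φ : L.Formula (Fin n ⊕ Unit)) :
    ∃ K : ℕ, ∀ y : Fin n → M, (∀ i, a < y i ∧ y i < b) → ∃ p : Fin K → M,
      CutInvariant p {x | φ.Realize (Sum.elim y fun _ => x) ∧ a < x ∧ x < b} := by
  let : TopologicalSpace (Ioo a b) := Preorder.topology _
  have : OrderTopology (Ioo a b) := ⟨rfl⟩
  have : Nonempty (Ioo a b) := (nonempty_Ioo.2 hab).to_subtype
  let D := intervalSys h a b
  let A (v : Fin n → Ioo a b) (x : Ioo a b) : Prop :=
    φ.Realize (Sum.elim (fun i => (v i : M)) fun _ => (x : M))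
  have hA : D.DefFam1 A := fun β σ j =>
    ⟨φ.relabel (Sum.elim (fun i => .inl (σ i)) fun _ => .inl j), fun v => by
      rw [Formula.realize_relabel]
      refine iff_of_eq (congrArg _ ?_)
      ext i
      rcases i with i | i <;> rfl⟩
  have hS : D.DefFam1 fun v x => ¬ ∀ᶠ u in 𝓝 x, (A v u ↔ A v x) := fun β σ j =>
    D.not <| OMinSys.def_eventually
      (p := fun w u => A (fun i => w (σ i)) u ↔ A (fun i => w (σ i)) (w j)) j
      (OMinSys.iff (hA _ _) (hA (fun i => some (σ i)) (some j)))
  have hfin : ∀ v, {x | ¬ ∀ᶠ u in 𝓝 x, (A v u ↔ A v x)}.Finite := fun v =>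
    (hA.fix v).finite_not_locConst
  obtain ⟨K, hK⟩ := OMinSys.uniform_finiteness hS hfin
  refine ⟨K + 1 + 1, fun y hy => ?_⟩
  let v : Fin n → Ioo a b := fun i => ⟨y i, hy i⟩
  obtain ⟨q, hq⟩ := (hfin v).exists_fin_range (hK v)
  refine ⟨Fin.cons a (Fin.cons b fun i => q i), fun x z hxz => ?_⟩
  simp only [Fin.forall_fin_succ (n := K + 1), Fin.forall_fin_succ (n := K), Fin.cons_zero,
    Fin.cons_succ] at hxz
  obtain ⟨hxa, hxb, hxq⟩ := hxz
  simp only [mem_ofPred_eq, ← hxa.2, ← hxb.1, and_congr_left_iff, and_imp]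
  intro hax hbx
  have H : ∀ s t : Ioo a b, s ≤ t →
      (∀ i, (s < q i ↔ t < q i) ∧ (q i < s ↔ q i < t)) → (A v s ↔ A v t) := by
    intro s t hst hq'
    rcases hst.eq_or_lt with rfl | hlt
    · rfl
    refine (hA.fix v).connected hst fun r hsr hrt => ?_
    by_contra hr
    obtain ⟨i, rfl⟩ := hq hr
    rcases hsr.eq_or_lt with hs | hs
    · exact lt_irrefl _ (((hq' i).2.2 (hs ▸ hlt)).trans_eq hs)
    · exact ((hq' i).1.1 hs).not_ge hrt
  rcases le_total x z with hle | hle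
  · exact H ⟨x, hax, hbx⟩ ⟨z, hxa.2.1 hax, hxb.1.1 hbx⟩ hle hxq
  · exact (H ⟨z, hxa.2.1 hax, hxb.1.1 hbx⟩ ⟨x, hax, hbx⟩ hle fun i =>
      ⟨(hxq i).1.symm, (hxq i).2.symm⟩).symm

end Interval

section Transfer

open FirstOrder FirstOrder.Language

variable {L : FirstOrder.Language.{u, v}} [L.IsOrdered] {M : Type w} [LinearOrder M]
  [L.Structure M] [L.OrderedStructure M] {N : Type x} [LinearOrder N] [L.Structure N]
  [L.OrderedStructure N]

theorem isFinUnionPointsIntervals_iff_cutFormula {α : Type} (φ : L.Formula (α ⊕ Unit))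
    (v : α → M) : IsFinUnionPointsIntervals {x | φ.Realize (Sum.elim v fun _ => x)} ↔
      ∃ K, (cutFormula K φ).Realize v := by
  simp only [realize_cutFormula]
  exact ⟨fun h => h.exists_cutInvariant, fun ⟨_, _, h⟩ => h.isFinUnionPointsIntervals⟩

theorem isFinUnionPointsIntervals_map_iff (f : M ↪ₑ[L] N) {α : Type} (φ : L.Formula (α ⊕ Unit))
    (v : α → M) : IsFinUnionPointsIntervals {x | φ.Realize (Sum.elim (f ∘ v) fun _ => x)} ↔
      IsFinUnionPointsIntervals {x | φ.Realize (Sum.elim v fun _ => x)} := by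
  simp only [isFinUnionPointsIntervals_iff_cutFormula, f.map_formula]

theorem lt_iff_lt_of_elementary (f : M ↪ₑ[L] N) {a b : M} : f a < f b ↔ a < b := by
  have h := f.map_formula (varLt true false) fun t => if t then a else b
  rwa [realize_varLt, realize_varLt] at h

/-- An elementary embedding preserves an upper bound of a definable set. -/
theorem le_map_of_elementary (f : M ↪ₑ[L] N) {α : Type} (φ : L.Formula (α ⊕ Unit)) (v : α → M)
    {d : M} (h : ∀ x, φ.Realize (Sum.elim v fun _ => x) → x ≤ d) (y : N)
    (hy : φ.Realize (Sum.elim (f ∘ v) fun _ => y)) : y ≤ f d := by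
  let χ : L.Formula (α ⊕ Unit) := Formula.iAlls Unit <|
    (φ.relabel (Sum.map .inl id)).imp (varLt (.inl (.inr ())) (.inr ())).not
  have hχ := f.map_formula χ (Sum.elim v fun _ => d)
  simp only [χ, Formula.realize_iAlls, Formula.realize_imp, Formula.realize_not, realize_varLt,
    Formula.realize_relabel, Sum.elim_inl, Sum.elim_inr, not_lt, Sum.elim_comp_map,
    Function.comp_apply, Function.comp_id] at hχ
  exact hχ.2 (fun i hi => h _ hi) (fun _ => y) hy

/-- An elementary embedding preserves a lower bound of a definable set. -/
theorem map_le_of_elementary (f : M ↪ₑ[L] N) {α : Type} (φ : L.Formula (α ⊕ Unit)) (v : α → M)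
    {d : M} (h : ∀ x, φ.Realize (Sum.elim v fun _ => x) → d ≤ x) (y : N)
    (hy : φ.Realize (Sum.elim (f ∘ v) fun _ => y)) : f d ≤ y := by
  let χ : L.Formula (α ⊕ Unit) := Formula.iAlls Unit <|
    (φ.relabel (Sum.map .inl id)).imp (varLt (.inr ()) (.inl (.inr ()))).not
  have hχ := f.map_formula χ (Sum.elim v fun _ => d)
  simp only [χ, Formula.realize_iAlls, Formula.realize_imp, Formula.realize_not, realize_varLt,
    Formula.realize_relabel, Sum.elim_inl, Sum.elim_inr, not_lt, Sum.elim_comp_map,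
    Function.comp_apply, Function.comp_id] at hχ
  exact hχ.2 (fun i hi => h _ hi) (fun _ => y) hy

theorem IsDownwardOMinimal.of_elementary (f : M ↪ₑ[L] N) (h : IsDownwardOMinimal L N) :
    IsDownwardOMinimal L M := by
  rintro s hs ⟨d, hd⟩
  obtain ⟨n, c, φ, rfl⟩ := exists_formula_of_definable₁ hs
  exact (isFinUnionPointsIntervals_map_iff f φ c).1 <| h _ (definable₁_of_formula _ φ)
    ⟨f d, fun y hy => le_map_of_elementary f φ c (fun x hx => hd hx) y hy⟩

theorem IsUpwardOMinimal.of_elementary (f : M ↪ₑ[L] N) (h : IsUpwardOMinimal L N) :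
    IsUpwardOMinimal L M := by
  rintro s hs ⟨d, hd⟩
  obtain ⟨n, c, φ, rfl⟩ := exists_formula_of_definable₁ hs
  exact (isFinUnionPointsIntervals_map_iff f φ c).1 <| h _ (definable₁_of_formula _ φ)
    ⟨f d, fun y hy => map_le_of_elementary f φ c (fun x hx => hd hx) y hy⟩

/-- The uniform bound for a definable family on a bounded interval passes to elementary
extensions. -/
theorem IsAlmostOMinimal.uniform_map [DenselyOrdered M] (h : IsAlmostOMinimal L M)
    (f : M ↪ₑ[L] N) {a b : M} (hab : a < b) {n : ℕ} (φ : L.Formula (Fin n ⊕ Unit))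
    (y : Fin n → N) (hy : ∀ i, f a < y i ∧ y i < f b) :
    IsFinUnionPointsIntervals
      {x | φ.Realize (Sum.elim y fun _ => x) ∧ f a < x ∧ x < f b} := by
  obtain ⟨K, hK⟩ := h.uniform hab φ
  let ψ : L.Formula ((Bool ⊕ Fin n) ⊕ Unit) := φ.relabel (Sum.map .inr id) ⊓
    (varLt (.inl (.inl true)) (.inr ()) ⊓ varLt (.inr ()) (.inl (.inl false)))
  let χ : L.Formula Bool := Formula.iAlls (Fin n) <|
    (Formula.iInf fun i : Fin n =>
      varLt (.inl true) (.inr i) ⊓ varLt (.inr i) (.inl false)).imp (cutFormula K ψ)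
  have hχ := f.map_formula χ fun t => if t then a else b
  simp only [χ, ψ, Formula.realize_iAlls, Formula.realize_imp, Formula.realize_iInf,
    Formula.realize_inf, realize_varLt, realize_cutFormula, Formula.realize_relabel, Sum.elim_inl,
    Sum.elim_inr, Sum.elim_comp_map, Sum.elim_comp_inr, Function.comp_id, Function.comp_apply,
    if_true, Bool.false_eq_true, if_false] at hχ
  obtain ⟨p, hp⟩ := hχ.2 hK y hy
  exact hp.isFinUnionPointsIntervals

theorem exists_map_lt_of_coinitial [NoMinOrder M] (f : M ↪ₑ[L] N)
    (hcoinitial : ∀ y : N, ∃ x : M, f x ≤ y) {s : Set N} (hs : s.Finite) (z : N) :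
    ∃ a : M, (∀ y ∈ s, f a < y) ∧ f a < z := by
  have : Nonempty N := ⟨z⟩
  obtain ⟨m, hm⟩ := (hs.insert z).bddBelow
  obtain ⟨x, hx⟩ := hcoinitial m
  obtain ⟨a, ha⟩ := exists_lt x
  have hlt : f a < m := ((lt_iff_lt_of_elementary f).2 ha).trans_le hx
  exact ⟨a, fun y hy => hlt.trans_le (hm (.inr hy)), hlt.trans_le (hm (.inl rfl))⟩

theorem exists_lt_map_of_cofinal [NoMaxOrder M] (f : M ↪ₑ[L] N)
    (hcofinal : ∀ y : N, ∃ x : M, y ≤ f x) {s : Set N} (hs : s.Finite) (z : N) :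
    ∃ b : M, (∀ y ∈ s, y < f b) ∧ z < f b := by
  have : Nonempty N := ⟨z⟩
  obtain ⟨m, hm⟩ := (hs.insert z).bddAbove
  obtain ⟨x, hx⟩ := hcofinal m
  obtain ⟨b, hb⟩ := exists_gt x
  have hlt : m < f b := hx.trans_lt ((lt_iff_lt_of_elementary f).2 hb)
  exact ⟨b, fun y hy => (hm (.inr hy)).trans_lt hlt, (hm (.inl rfl)).trans_lt hlt⟩

theorem IsAlmostOMinimal.of_cofinal_coinitial [DenselyOrdered M] [NoMinOrder M] [NoMaxOrder M]
    (h : IsAlmostOMinimal L M) (f : M ↪ₑ[L] N) (hcofinal : ∀ y : N, ∃ x : M, y ≤ f x)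
    (hcoinitial : ∀ y : N, ∃ x : M, f x ≤ y) : IsAlmostOMinimal L N := by
  rintro s hs ⟨t, ht⟩ ⟨r, hr⟩
  obtain ⟨n, c, φ, rfl⟩ := exists_formula_of_definable₁ hs
  obtain ⟨a, ha, har⟩ := exists_map_lt_of_coinitial f hcoinitial
    ((finite_range c).insert t) r
  obtain ⟨b, hb, hbt⟩ := exists_lt_map_of_cofinal f hcofinal (finite_range c) t
  have hab : a < b := (lt_iff_lt_of_elementary f).1 ((ha t (.inl rfl)).trans hbt)
  convert h.uniform_map f hab φ c fun i =>
    ⟨ha _ (.inr ⟨i, rfl⟩), hb _ ⟨i, rfl⟩⟩ using 1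
  ext x
  exact ⟨fun hx => ⟨hx, har.trans_le (hr hx), (ht hx).trans_lt hbt⟩, fun hx => hx.1⟩

end Transfer

end

open scoped FirstOrder

/-- Let `M` be an almost o-minimal structure that is neither downward
nor upward o-minimal.  Let `N` be an elementary extension of `M` (given by an elementary
embedding `f : M ↪ₑ[L] N` of ordered `L`-structures) in which `M` is both cofinal and
coinitial.  Then `N` is almost o-minimal, and neither downward nor upward o-minimal. -/
theorem almost_ominimal_of_cofinal_coinitial_elementary_extension
    {L : FirstOrder.Language.{u, v}} [L.IsOrdered] {M : Type w}
    [LinearOrder M] [L.Structure M] [L.OrderedStructure M]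
    [DenselyOrdered M] [NoMinOrder M] [NoMaxOrder M]
    {N : Type x} [LinearOrder N] [L.Structure N] [L.OrderedStructure N]
    (halmost : IsAlmostOMinimal L M)
    (hnotdown : ¬ IsDownwardOMinimal L M) (hnotup : ¬ IsUpwardOMinimal L M)
    (f : M ↪ₑ[L] N) (hcofinal : ∀ y : N, ∃ x : M, y ≤ f x)
    (hcoinitial : ∀ y : N, ∃ x : M, f x ≤ y) :
    IsAlmostOMinimal L N ∧ ¬ IsDownwardOMinimal L N ∧ ¬ IsUpwardOMinimal L N := by
  exact ⟨halmost.of_cofinal_coinitial f hcofinal hcoinitial, fun h => hnotdown (.of_elementary f h),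
    fun h => hnotup (.of_elementary f h)⟩
end

section
/- Let M = (M,<,…) be a structure expanding a dense linear order without endpoints that is downward o-minimal but not upward o-minimal. Then M satisfies condition (†)⁺: for every formula φ(x,ȳ) with parameters from M and every a ∈ M, if M ⊨ ∀ȳ < a ∃x φ(x,ȳ), then there exists d ∈ M such that M ⊨ ∀ȳ < a ∃x < d φ(x,ȳ). -/
open FirstOrder FirstOrder.Language

universe u v w x

/-! ### Definable predicates and terms -/

section DefinablePredicates

variable {L : FirstOrder.Language.{u, v}} {M : Type w} [L.Structure M] {α β : Type*}

/-- A predicate on tuples is definable with parameters. -/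
def DefPred (L : FirstOrder.Language.{u, v}) {M : Type w} [L.Structure M] {α : Type*}
    (P : (α → M) → Prop) : Prop :=
  (Set.univ : Set M).Definable L {v | P v}

/-- A function on tuples is given by a term with parameters. -/
def DefTerm (L : FirstOrder.Language.{u, v}) {M : Type w} [L.Structure M] {α : Type*}
    (t : (α → M) → M) : Prop :=
  ∃ τ : L[[(Set.univ : Set M)]].Term α, ∀ v, τ.realize v = t v

theorem DefTerm.var (i : α) : DefTerm L (fun v : α → M => v i) :=
  ⟨Term.var i, fun _ => rfl⟩

theorem DefTerm.const (c : M) : DefTerm L (fun _ : α → M => c) :=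
  ⟨(L.con (⟨c, trivial⟩ : (Set.univ : Set M))).term, fun v => by simp⟩

theorem DefPred.subst {Φ : Set (α → M)} (hΦ : (Set.univ : Set M).Definable L Φ)
    {t : (β → M) → α → M} (ht : ∀ i, DefTerm L (fun v => t v i)) :
    DefPred L (fun v => t v ∈ Φ) := by
  obtain ⟨φ, rfl⟩ := hΦ
  choose τ hτ using ht
  refine ⟨BoundedFormula.subst φ τ, ?_⟩
  ext v
  change φ.Realize (t v) ↔ Formula.Realize (BoundedFormula.subst φ τ) v
  rw [Formula.Realize, Formula.Realize, BoundedFormula.realize_subst]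
  simp only [hτ]

theorem DefPred.mem {s : Set M} (hs : (Set.univ : Set M).Definable₁ L s)
    {t : (β → M) → M} (ht : DefTerm L t) : DefPred L (fun v => t v ∈ s) :=
  DefPred.subst (t := fun v _ => t v) hs fun _ => ht

theorem DefPred.lt [L.IsOrdered] [LinearOrder M] [L.OrderedStructure M]
    {t s : (β → M) → M} (ht : DefTerm L t) (hs : DefTerm L s) :
    DefPred L (fun v => t v < s v) := by
  have h : (Set.univ : Set M).Definable L {v : Fin 2 → M | v 0 < v 1} := by
    refine Set.Definable.mono (Set.empty_definable_iff.2
      ⟨Term.lt (n := 0) (Term.var (Sum.inl 0)) (Term.var (Sum.inl 1)), ?_⟩)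
      (Set.empty_subset _)
    ext v
    change _ ↔ BoundedFormula.Realize _ _ _
    simp
  refine DefPred.subst (t := fun v => ![t v, s v]) h fun i => ?_
  fin_cases i
  · exact ht
  · exact hs

theorem DefPred.and {P Q : (α → M) → Prop} (hP : DefPred L P) (hQ : DefPred L Q) :
    DefPred L (fun v => P v ∧ Q v) :=
  Set.Definable.inter hP hQ

theorem DefPred.not {P : (α → M) → Prop} (hP : DefPred L P) : DefPred L (fun v => ¬ P v) :=
  Set.Definable.compl hP

theorem DefPred.imp {P Q : (α → M) → Prop} (hP : DefPred L P) (hQ : DefPred L Q) :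
    DefPred L (fun v => P v → Q v) := by
  have h := (hP.and hQ.not).not
  simpa using h

theorem DefPred.le [L.IsOrdered] [LinearOrder M] [L.OrderedStructure M]
    {t s : (β → M) → M} (ht : DefTerm L t) (hs : DefTerm L s) :
    DefPred L (fun v => t v ≤ s v) := by
  simpa using (DefPred.lt hs ht).not

theorem DefPred.forall_tuple [Finite β] {P : (α → M) → (β → M) → Prop}
    (h : DefPred L (fun w : α ⊕ β → M => P (fun i => w (Sum.inl i)) (fun i => w (Sum.inr i)))) :
    DefPred L (fun v => ∀ y, P v y) :=
  Set.Definable.forall_of_finite h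

theorem DefPred.all {P : (α → M) → M → Prop}
    (h : DefPred L (fun w : α ⊕ Unit → M => P (fun i => w (Sum.inl i)) (w (Sum.inr ())))) :
    DefPred L (fun v => ∀ x, P v x) := by
  have h' := DefPred.forall_tuple (L := L) (β := Unit) (P := fun v y => P v (y ())) h
  have e : (fun v : α → M => ∀ x, P v x) = fun v => ∀ y : Unit → M, P v (y ()) := by
    funext v
    exact propext ⟨fun h y => h _, fun h x => h fun _ => x⟩
  rwa [e]

theorem DefPred.ex {P : (α → M) → M → Prop}
    (h : DefPred L (fun w : α ⊕ Unit → M => P (fun i => w (Sum.inl i)) (w (Sum.inr ())))) :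
    DefPred L (fun v => ∃ x, P v x) := by
  have h' := (DefPred.all (P := fun v x => ¬ P v x) h.not).not
  simpa using h'

theorem DefPred.forall_finite {ι : Type*} [Finite ι] {P : ι → (α → M) → Prop}
    (h : ∀ i, DefPred L (P i)) : DefPred L (fun v => ∀ i, P i v) := by
  have e := Set.definable_iInter_of_finite h
  simpa [DefPred, Set.ofPred_forall] using e

end DefinablePredicates

/-! ### Finite unions of points and open intervals -/

section FiniteUnions

open Set Filter Topology

variable {M : Type w} [LinearOrder M] {s : Set M}

theorem IsFinUnionPointsIntervals.induction {C : Set M → Prop} (empty : C ∅)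
    (singleton : ∀ a, C {a}) (interval : ∀ J, IsOpenIntervalSet J → C J)
    (union : ∀ s t, C s → C t → C (s ∪ t)) (hs : IsFinUnionPointsIntervals s) : C s := by
  obtain ⟨F, n, J, hJ, rfl⟩ := hs
  refine union _ _ ?_ ?_
  · induction F using Finset.induction_on with
    | empty => simpa using empty
    | insert a F _ ih =>
      rw [Finset.coe_insert, Set.insert_eq]
      exact union _ _ (singleton a) ih
  · induction n with
    | zero => simpa using empty
    | succ n ih =>
      have e : ⋃ k, J k = J 0 ∪ ⋃ k : Fin n, J k.succ := by
        ext x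
        simp [Fin.exists_fin_succ]
      rw [e]
      exact union _ _ (interval _ (hJ 0)) (ih _ fun k => hJ k.succ)

theorem IsFinUnionPointsIntervals.insert (a : M) (hs : IsFinUnionPointsIntervals s) :
    IsFinUnionPointsIntervals (insert a s) := by
  obtain ⟨F, n, J, hJ, rfl⟩ := hs
  refine ⟨Insert.insert a F, n, J, hJ, ?_⟩
  rw [Finset.coe_insert, Set.insert_union]

theorem IsFinUnionPointsIntervals.union_interval (hs : IsFinUnionPointsIntervals s) {I : Set M}
    (hI : IsOpenIntervalSet I) : IsFinUnionPointsIntervals (s ∪ I) := by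
  obtain ⟨F, n, J, hJ, rfl⟩ := hs
  refine ⟨F, n + 1, Fin.cons I J, fun k => ?_, ?_⟩
  · cases k using Fin.cases with
    | zero => exact hI
    | succ k => exact hJ k
  · ext x
    simp only [mem_union, mem_iUnion, Fin.exists_fin_succ, Fin.cons_zero, Fin.cons_succ]
    tauto

theorem IsFinUnionPointsIntervals.eventually_nhdsLT [TopologicalSpace M] [OrderTopology M]
    (hs : IsFinUnionPointsIntervals s) (p : M) :
    (∀ᶠ x in 𝓝[<] p, x ∈ s) ∨ ∀ᶠ x in 𝓝[<] p, x ∉ s := by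
  refine IsFinUnionPointsIntervals.induction
    (C := fun s => (∀ᶠ x in 𝓝[<] p, x ∈ s) ∨ ∀ᶠ x in 𝓝[<] p, x ∉ s) ?_ ?_ ?_ ?_ hs
  · simp
  · intro a
    right
    rcases lt_or_ge a p with h | h
    · filter_upwards [Ioo_mem_nhdsLT h] with x hx using hx.1.ne'
    · filter_upwards [self_mem_nhdsWithin] with x hx using (lt_of_lt_of_le hx h).ne
  · have hI : ∀ a, (∀ᶠ x in 𝓝[<] p, a < x) ∨ ∀ᶠ x in 𝓝[<] p, ¬ a < x := by
      intro a
      rcases lt_or_ge a p with h | h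
      · left
        filter_upwards [Ioo_mem_nhdsLT h] with x hx using hx.1
      · right
        filter_upwards [self_mem_nhdsWithin] with x hx using (lt_of_lt_of_le hx h).not_gt
    have hI' : ∀ b, (∀ᶠ x in 𝓝[<] p, x < b) ∨ ∀ᶠ x in 𝓝[<] p, ¬ x < b := by
      intro b
      rcases lt_or_ge b p with h | h
      · right
        filter_upwards [Ioo_mem_nhdsLT h] with x hx using hx.1.not_gt
      · left
        filter_upwards [self_mem_nhdsWithin] with x hx using lt_of_lt_of_le hx h
    rintro J (⟨a, b, rfl⟩ | ⟨a, rfl⟩ | ⟨b, rfl⟩ | rfl)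
    · rcases hI a with h | h
      · rcases hI' b with h' | h'
        · left
          filter_upwards [h, h'] with x hx hx' using ⟨hx, hx'⟩
        · right
          filter_upwards [h'] with x hx' h using hx' h.2
      · right
        filter_upwards [h] with x hx h using hx h.1
    · exact hI a
    · exact hI' b
    · simp
  · rintro s t (hs | hs) ht
    · exact Or.inl (hs.mono fun x hx => Or.inl hx)
    · rcases ht with ht | ht
      · exact Or.inl (ht.mono fun x hx => Or.inr hx)
      · right
        filter_upwards [hs, ht] with x h h' using fun hx => hx.elim h h'

theorem mem_frontier_iff_order [TopologicalSpace M] [OrderTopology M] [NoMinOrder M] [NoMaxOrder M]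
    {x : M} : x ∈ frontier s ↔
    (∀ a, a < x → ∀ b, x < b → ∃ z, z ∈ s ∧ a < z ∧ z < b) ∧
      ∀ a, a < x → ∀ b, x < b → ∃ z, z ∉ s ∧ a < z ∧ z < b := by
  have h : ∀ t : Set M, x ∈ closure t ↔
      ∀ a, a < x → ∀ b, x < b → ∃ z, z ∈ t ∧ a < z ∧ z < b := by
    intro t
    rw [mem_closure_iff_nhds_basis (nhds_basis_Ioo x)]
    simp only [Prod.forall, mem_Ioo]
    exact ⟨fun h a ha b hb => h a b ⟨ha, hb⟩, fun h a b hab => h a hab.1 b hab.2⟩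
  rw [frontier_eq_closure_inter_closure, mem_inter_iff, h, h]
  rfl

variable [DenselyOrdered M]

theorem IsFinUnionPointsIntervals.exists_isLUB [NoMaxOrder M] (hs : IsFinUnionPointsIntervals s)
    (hne : s.Nonempty) (hb : BddAbove s) : ∃ p, IsLUB s p := by
  revert hne hb
  refine IsFinUnionPointsIntervals.induction (C := fun s => s.Nonempty → BddAbove s →
    ∃ p, IsLUB s p) ?_ ?_ ?_ ?_ hs
  · intro h
    simp at h
  · exact fun a _ _ => ⟨a, isLUB_singleton⟩
  · rintro J (⟨a, b, rfl⟩ | ⟨a, rfl⟩ | ⟨b, rfl⟩ | rfl) hne hb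
    · exact ⟨b, isLUB_Ioo (nonempty_Ioo.1 hne)⟩
    · exact absurd hb (not_bddAbove_Ioi a)
    · exact ⟨b, isLUB_Iio⟩
    · exact absurd hb not_bddAbove_univ
  · intro s t hs ht hne hb
    rw [bddAbove_union] at hb
    rcases s.eq_empty_or_nonempty with rfl | hsne
    · simp only [empty_union] at hne ⊢
      exact ht hne hb.2
    rcases t.eq_empty_or_nonempty with rfl | htne
    · simp only [union_empty] at hne ⊢
      exact hs hne hb.1
    obtain ⟨p, hp⟩ := hs hsne hb.1
    obtain ⟨q, hq⟩ := ht htne hb.2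
    exact ⟨_, hp.union hq⟩

theorem IsFinUnionPointsIntervals.exists_isGLB [NoMinOrder M] (hs : IsFinUnionPointsIntervals s)
    (hne : s.Nonempty) (hb : BddBelow s) : ∃ p, IsGLB s p := by
  revert hne hb
  refine IsFinUnionPointsIntervals.induction (C := fun s => s.Nonempty → BddBelow s →
    ∃ p, IsGLB s p) ?_ ?_ ?_ ?_ hs
  · intro h
    simp at h
  · exact fun a _ _ => ⟨a, isGLB_singleton⟩
  · rintro J (⟨a, b, rfl⟩ | ⟨a, rfl⟩ | ⟨b, rfl⟩ | rfl) hne hb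
    · exact ⟨a, isGLB_Ioo (nonempty_Ioo.1 hne)⟩
    · exact ⟨a, isGLB_Ioi⟩
    · exact absurd hb (not_bddBelow_Iio b)
    · exact absurd hb not_bddBelow_univ
  · intro s t hs ht hne hb
    rw [bddBelow_union] at hb
    rcases s.eq_empty_or_nonempty with rfl | hsne
    · simp only [empty_union] at hne ⊢
      exact ht hne hb.2
    rcases t.eq_empty_or_nonempty with rfl | htne
    · simp only [union_empty] at hne ⊢
      exact hs hne hb.1
    obtain ⟨p, hp⟩ := hs hsne hb.1
    obtain ⟨q, hq⟩ := ht htne hb.2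
    exact ⟨_, hp.union hq⟩

theorem IsFinUnionPointsIntervals.exists_Ioo_subset [NoMinOrder M] [NoMaxOrder M]
    (hs : IsFinUnionPointsIntervals s)
    (hinf : s.Infinite) : ∃ a b, a < b ∧ Ioo a b ⊆ s := by
  revert hinf
  refine IsFinUnionPointsIntervals.induction (C := fun s => s.Infinite →
    ∃ a b, a < b ∧ Ioo a b ⊆ s) ?_ ?_ ?_ ?_ hs
  · exact fun h => absurd finite_empty h
  · exact fun a h => absurd (finite_singleton a) h
  · rintro J (⟨a, b, rfl⟩ | ⟨a, rfl⟩ | ⟨b, rfl⟩ | rfl) hinf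
    · exact ⟨a, b, nonempty_Ioo.1 hinf.nonempty, Subset.rfl⟩
    · obtain ⟨b, hb⟩ := exists_gt a
      exact ⟨a, b, hb, Ioo_subset_Ioi_self⟩
    · obtain ⟨a, ha⟩ := exists_lt b
      exact ⟨a, b, ha, Ioo_subset_Iio_self⟩
    · obtain ⟨a, -⟩ := hinf.nonempty
      obtain ⟨b, hb⟩ := exists_gt a
      exact ⟨a, b, hb, subset_univ _⟩
  · intro s t hs ht hinf
    rcases infinite_union.1 hinf with h | h
    · obtain ⟨a, b, hab, hsub⟩ := hs h
      exact ⟨a, b, hab, hsub.trans subset_union_left⟩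
    · obtain ⟨a, b, hab, hsub⟩ := ht h
      exact ⟨a, b, hab, hsub.trans subset_union_right⟩

theorem IsFinUnionPointsIntervals.finite_of_finite_lt [NoMinOrder M] [NoMaxOrder M]
    (hs : IsFinUnionPointsIntervals s)
    (h : ∀ x ∈ s, {y ∈ s | y < x}.Finite) : s.Finite := by
  by_contra hinf
  obtain ⟨a, b, hab, hsub⟩ := hs.exists_Ioo_subset hinf
  obtain ⟨c, hc⟩ := exists_between hab
  exact Ioo_infinite hc.1 ((h c (hsub hc)).subset fun y hy =>
    ⟨hsub ⟨hy.1, hy.2.trans hc.2⟩, hy.2⟩)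

theorem IsFinUnionPointsIntervals.finite_of_finite_gt [NoMinOrder M] [NoMaxOrder M]
    (hs : IsFinUnionPointsIntervals s)
    (h : ∀ x ∈ s, {y ∈ s | x < y}.Finite) : s.Finite := by
  by_contra hinf
  obtain ⟨a, b, hab, hsub⟩ := hs.exists_Ioo_subset hinf
  obtain ⟨c, hc⟩ := exists_between hab
  exact Ioo_infinite hc.2 ((h c (hsub hc)).subset fun y hy =>
    ⟨hsub ⟨hc.1.trans hy.1, hy.2⟩, hy.1⟩)

variable [TopologicalSpace M] [OrderTopology M]

theorem IsFinUnionPointsIntervals.finite_frontier [NoMinOrder M] [NoMaxOrder M]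
    (hs : IsFinUnionPointsIntervals s) :
    (frontier s).Finite := by
  refine IsFinUnionPointsIntervals.induction (C := fun s => (frontier s).Finite)
    ?_ ?_ ?_ ?_ hs
  · simp
  · exact fun a => (finite_singleton a).subset isClosed_singleton.frontier_subset
  · rintro J (⟨a, b, rfl⟩ | ⟨a, rfl⟩ | ⟨b, rfl⟩ | rfl)
    · rcases lt_or_ge a b with h | h
      · simp [frontier_Ioo h]
      · simp [Ioo_eq_empty h.not_gt]
    · simp
    · simp
    · simp
  · intro s t hs ht
    exact ((hs.inter_of_left _).union (ht.inter_of_right _)).subset (frontier_union_subset s t)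

end FiniteUnions

theorem IsFinUnionPointsIntervals.exists_Ioo_subset_of_isLUB {M : Type w} [LinearOrder M]
    [DenselyOrdered M] [NoMinOrder M] [NoMaxOrder M] {s : Set M}
    (hs : IsFinUnionPointsIntervals s) {p : M} (hp : IsLUB s p) (hps : p ∉ s) :
    ∃ l < p, Set.Ioo l p ⊆ s := by
  let : TopologicalSpace M := Preorder.topology M
  have : OrderTopology M := ⟨rfl⟩
  rcases hs.eventually_nhdsLT p with h | h
  · exact mem_nhdsLT_iff_exists_Ioo_subset.1 h
  · obtain ⟨l, hl, hsub⟩ := mem_nhdsLT_iff_exists_Ioo_subset.1 h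
    obtain ⟨x, hx, hlx⟩ := (lt_isLUB_iff hp).1 hl
    exact absurd hx (hsub ⟨hlx, lt_of_le_of_ne (hp.1 hx) fun e => hps (e ▸ hx)⟩)

/-! ### Downward o-minimal structures -/

section DownwardOMinimal

open Set

variable {L : FirstOrder.Language.{u, v}} {M : Type w} [L.Structure M]

theorem DefPred.rel {α : Type*} {B : M → M → Prop}
    (hB : DefPred L (fun v : Fin 2 → M => B (v 0) (v 1)))
    {t s : (α → M) → M} (ht : DefTerm L t) (hs : DefTerm L s) :
    DefPred L (fun v => B (t v) (s v)) := by
  refine DefPred.subst (t := fun v => ![t v, s v]) hB fun i => ?_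
  fin_cases i
  · exact ht
  · exact hs

variable [L.IsOrdered] [LinearOrder M] [L.OrderedStructure M]

theorem exists_mem_frontier_of_mem_of_notMem [DenselyOrdered M] [NoMinOrder M]
    [TopologicalSpace M] [OrderTopology M] (hdown : IsDownwardOMinimal L M) {s : Set M}
    (hs : (univ : Set M).Definable₁ L s) {x y : M} (hxy : x < y) (hx : x ∈ s) (hy : y ∉ s) :
    ∃ t, x ≤ t ∧ t ∈ frontier s := by
  have hd : (univ : Set M).Definable₁ L {z | z ∉ s ∧ x < z ∧ z ≤ y} :=
    DefPred.and (DefPred.mem hs (.var _)).not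
      (.and (.lt (.const _) (.var _)) (.le (.var _) (.const _)))
  have hle : x ∈ lowerBounds {z | z ∉ s ∧ x < z ∧ z ≤ y} := fun z hz => hz.2.1.le
  obtain ⟨t, ht⟩ := (hdown _ hd ⟨y, fun z hz => hz.2.2⟩).exists_isGLB ⟨y, hy, hxy, le_rfl⟩
    ⟨x, hle⟩
  have hxt : x ≤ t := ht.2 hle
  have hty : t ≤ y := ht.1 ⟨hy, hxy, le_rfl⟩
  refine ⟨t, hxt, ?_⟩
  rw [frontier_eq_closure_inter_closure]
  constructor
  · rcases hxt.eq_or_lt with rfl | hlt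
    · exact subset_closure hx
    · have hsub : Ioo x t ⊆ s := by
        intro z hz
        by_contra hzs
        exact (ht.1 ⟨hzs, hz.1, hz.2.le.trans hty⟩).not_gt hz.2
      have hmem : t ∈ closure (Ioo x t) := by
        rw [closure_Ioo hlt.ne]
        exact ⟨hxt, le_rfl⟩
      exact closure_mono hsub hmem
  · exact closure_mono (fun z hz => hz.1) (ht.mem_closure ⟨y, hy, hxy, le_rfl⟩)

theorem exists_definable_infinite_of_not_upward [DenselyOrdered M] [NoMinOrder M] [NoMaxOrder M]
    (hdown : IsDownwardOMinimal L M) (hnotup : ¬ IsUpwardOMinimal L M) :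
    ∃ D : Set M, (univ : Set M).Definable₁ L D ∧ D.Infinite ∧ ∀ b, (D ∩ Iio b).Finite := by
  let : TopologicalSpace M := Preorder.topology M
  have : OrderTopology M := ⟨rfl⟩
  simp only [IsUpwardOMinimal, not_forall] at hnotup
  obtain ⟨s, hs, -, hns⟩ := hnotup
  have hseg : ∀ b, IsFinUnionPointsIntervals (s ∩ Iio b) := fun b =>
    hdown _ (DefPred.and (DefPred.mem hs (.var _)) (.lt (.var _) (.const b)))
      ⟨b, fun z hz => hz.2.le⟩
  refine ⟨frontier s, ?_, fun hfin => hns ?_, fun b => ?_⟩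
  · have e : frontier s = {x | (∀ a, a < x → ∀ b, x < b → ∃ z, z ∈ s ∧ a < z ∧ z < b) ∧
        ∀ a, a < x → ∀ b, x < b → ∃ z, z ∉ s ∧ a < z ∧ z < b} :=
      Set.ext fun x => mem_frontier_iff_order
    rw [e]
    exact DefPred.and
      (.all (.imp (.lt (.var _) (.var _)) (.all (.imp (.lt (.var _) (.var _))
        (.ex (.and (.mem hs (.var _)) (.and (.lt (.var _) (.var _)) (.lt (.var _) (.var _)))))))))
      (.all (.imp (.lt (.var _) (.var _)) (.all (.imp (.lt (.var _) (.var _))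
        (.ex (.and (DefPred.mem hs (.var _)).not
          (.and (.lt (.var _) (.var _)) (.lt (.var _) (.var _)))))))))
  · have hM : Nonempty M := by
      by_contra hM
      rw [not_nonempty_iff] at hM
      exact hns ⟨∅, 0, fun _ => ∅, fun k => k.elim0, Subsingleton.elim _ _⟩
    obtain ⟨b, hb⟩ := hfin.bddAbove
    obtain ⟨c, hbc⟩ := exists_gt b
    have hfr : ∀ t, c ≤ t → t ∉ frontier s := fun t hct ht =>
      (hb ht).not_gt (hbc.trans_le hct)
    have hs' : (univ : Set M).Definable₁ L sᶜ := DefPred.not (DefPred.mem hs (.var _))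
    by_cases hc : c ∈ s
    · have e : s = insert c ((s ∩ Iio c) ∪ Ioi c) := by
        ext z
        rcases lt_trichotomy z c with h | rfl | h
        · simp [h, h.ne, h.not_gt]
        · simp [hc]
        · simp only [mem_insert_iff, mem_union, mem_Ioi, h, or_true, iff_true]
          by_contra hz
          obtain ⟨t, hct, ht⟩ := exists_mem_frontier_of_mem_of_notMem hdown hs h hc hz
          exact hfr t hct ht
      rw [e]
      exact ((hseg c).union_interval (Or.inr (Or.inl ⟨c, rfl⟩))).insert c
    · have e : s = s ∩ Iio c := by
        refine (inter_eq_left.2 fun z hz => ?_).symm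
        by_contra hzc
        have h : c < z := lt_of_le_of_ne (not_lt.1 hzc) fun e => hc (e ▸ hz)
        obtain ⟨t, hct, ht⟩ := exists_mem_frontier_of_mem_of_notMem hdown hs' h hc
          (not_not.2 hz)
        exact hfr t hct (frontier_compl s ▸ ht)
      rw [e]
      exact hseg c
  · rw [← frontier_inter_open_inter isOpen_Iio]
    exact (hseg b).finite_frontier.inter_of_left _

variable [DenselyOrdered M] [NoMinOrder M] [NoMaxOrder M]

/-- In a downward o-minimal structure with an infinite definable set all of whose initial
segments are finite, a decreasing definable family of nonempty subsets of `(-∞, a)` has nonempty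
intersection. -/
theorem exists_forall_of_antitone_family (hdown : IsDownwardOMinimal L M) {D : Set M}
    (hD : (univ : Set M).Definable₁ L D) (hDinf : D.Infinite) (hDfin : ∀ b, (D ∩ Iio b).Finite)
    {B : M → M → Prop} (hB : DefPred L (fun v : Fin 2 → M => B (v 0) (v 1)))
    (hanti : ∀ d e y, d ≤ e → B e y → B d y) {a : M} (ha : ∀ d y, B d y → y < a)
    (hne : ∀ d, ∃ y, B d y) : ∃ y, ∀ d, B d y := by
  by_contra! hempty
  have hcof : ∀ m, ∃ d ∈ D, m ≤ d := by
    intro m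
    by_contra! h
    exact hDinf ((hDfin m).subset fun d hd => ⟨hd, h d hd⟩)
  have hfu : ∀ d, IsFinUnionPointsIntervals {y | B d y} := fun d =>
    hdown _ (DefPred.rel hB (.const d) (.var 0)) ⟨a, fun y hy => (ha d y hy).le⟩
  choose S hS using fun d => (hfu d).exists_isLUB (hne d) ⟨a, fun y hy => (ha d y hy).le⟩
  have hSanti : Antitone S := fun d e hde =>
    (hS e).2 fun y hy => (hS d).1 (hanti d e y hde hy)
  have hXfin : (S '' D).Finite := by
    have hdef : (univ : Set M).Definable₁ L (S '' D) := by
      have e : S '' D = {x | ∃ d, d ∈ D ∧ (∀ y, B d y → y ≤ x) ∧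
          ∀ u, (∀ y, B d y → y ≤ u) → x ≤ u} := by
        ext x
        exact ⟨fun ⟨d, hd, hx⟩ => ⟨d, hd, hx ▸ (hS d).1, fun u hu => hx ▸ (hS d).2 hu⟩,
          fun ⟨d, hd, h1, h2⟩ => ⟨d, hd, (hS d).unique ⟨h1, fun u hu => h2 u hu⟩⟩⟩
      rw [e]
      exact DefPred.ex (.and (.mem hD (.var _)) (.and
        (.all (.imp (.rel hB (.var _) (.var _)) (.le (.var _) (.var _))))
        (.all (.imp (.all (.imp (.rel hB (.var _) (.var _)) (.le (.var _) (.var _))))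
          (.le (.var _) (.var _))))))
    refine (hdown _ hdef ⟨a, ?_⟩).finite_of_finite_gt ?_
    · rintro _ ⟨d, -, rfl⟩
      exact (hS d).2 fun y hy => (ha d y hy).le
    · rintro _ ⟨d, hd, rfl⟩
      refine ((hDfin d).image S).subset ?_
      rintro _ ⟨⟨e, he, rfl⟩, hlt⟩
      exact ⟨e, ⟨he, hSanti.reflect_lt hlt⟩, rfl⟩
  obtain ⟨_, ⟨d₀, -, rfl⟩, hmin⟩ := hXfin.exists_minimal (hDinf.nonempty.image S)
  obtain ⟨p, hp⟩ : ∃ p, p = S d₀ := ⟨_, rfl⟩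
  rw [← hp] at hmin
  obtain ⟨e₀, he₀⟩ := hempty p
  have hlub : ∀ d, max d₀ e₀ ≤ d → ∃ l < p, Ioo l p ⊆ {y | B d y} := by
    intro d hd
    have hSd : S d = p := by
      obtain ⟨e, he, hde⟩ := hcof d
      have hed : S d ≤ p := hp ▸ hSanti ((le_max_left _ _).trans hd)
      exact le_antisymm hed ((hmin ⟨e, he, rfl⟩ ((hSanti hde).trans hed)).trans (hSanti hde))
    exact (hfu d).exists_Ioo_subset_of_isLUB (hSd ▸ hS d) fun h =>
      he₀ (hanti _ _ _ ((le_max_right _ _).trans hd) h)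
  let H : M → Set M := fun d => {l | l < p ∧ ∀ z, l < z → z < p → B d z}
  let G : Set M := {g | ∃ d, d ∈ D ∧ max d₀ e₀ ≤ d ∧ IsGLB (H d) g}
  have hGlt : ∀ g ∈ G, g < p := by
    rintro g ⟨d, -, hd, hg⟩
    obtain ⟨l, hl, hsub⟩ := hlub d hd
    exact (hg.1 ⟨hl, fun z h1 h2 => hsub ⟨h1, h2⟩⟩).trans_lt hl
  have hHdef : ∀ d, (univ : Set M).Definable₁ L (H d) := fun d =>
    DefPred.and (.lt (.var _) (.const _)) (.all (.imp (.lt (.var _) (.var _))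
      (.imp (.lt (.var _) (.const _)) (.rel hB (.const _) (.var _)))))
  have hHrel : DefPred L (fun v : Fin 2 → M => v 1 ∈ H (v 0)) :=
    DefPred.and (.lt (.var _) (.const _)) (.all (.imp (.lt (.var _) (.var _))
      (.imp (.lt (.var _) (.const _)) (.rel hB (.var _) (.var _)))))
  have hGdef : (univ : Set M).Definable₁ L G := by
    have e : G = {g | ∃ d, d ∈ D ∧ max d₀ e₀ ≤ d ∧ (∀ l, l ∈ H d → g ≤ l) ∧
        ∀ u, (∀ l, l ∈ H d → u ≤ l) → u ≤ g} := rfl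
    rw [e]
    exact DefPred.ex (.and (.mem hD (.var _)) (.and (.le (.const _) (.var _)) (.and
      (.all (.imp (DefPred.rel (B := fun d l => l ∈ H d) hHrel (.var _) (.var _))
        (.le (.var _) (.var _))))
      (.all (.imp (.all (.imp (DefPred.rel (B := fun d l => l ∈ H d) hHrel (.var _) (.var _))
        (.le (.var _) (.var _)))) (.le (.var _) (.var _)))))))
  have hGfin : G.Finite := by
    refine (hdown _ hGdef ⟨p, fun g hg => (hGlt g hg).le⟩).finite_of_finite_lt fun x hx => ?_
    obtain ⟨m, hm⟩ := hempty x
    choose! δ hδ using fun g (hg : g ∈ G) => hg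
    refine Finite.of_finite_image (f := δ) ((hDfin m).subset ?_) ?_
    · rintro _ ⟨g, ⟨hg, hgx⟩, rfl⟩
      refine ⟨(hδ g hg).1, ?_⟩
      obtain ⟨l, hl, -, hlx⟩ := (hδ g hg).2.2.exists_between hgx
      by_contra hmd
      exact hm (hanti _ _ _ (not_lt.1 hmd) (hl.2 x hlx (hGlt x hx)))
    · intro g hg g' hg' e
      have h := (hδ g' hg'.1).2.2
      rw [← e] at h
      exact (hδ g hg.1).2.2.unique h
  have hGcof : ∀ y < p, ∃ g ∈ G, y ≤ g := by
    intro y hy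
    obtain ⟨m, hm⟩ := hempty y
    obtain ⟨d, hd, hmd⟩ := hcof (max m (max d₀ e₀))
    have hlow : y ∈ lowerBounds (H d) := by
      intro l hl
      by_contra hly
      exact hm (hanti _ _ _ ((le_max_left _ _).trans hmd) (hl.2 y (not_le.1 hly) hy))
    have hd' := (le_max_right _ _).trans hmd
    obtain ⟨l, hl, hsub⟩ := hlub d hd'
    obtain ⟨g, hg⟩ := (hdown _ (hHdef d) ⟨p, fun l hl => hl.1.le⟩).exists_isGLB
      ⟨l, hl, fun z h1 h2 => hsub ⟨h1, h2⟩⟩ ⟨y, hlow⟩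
    exact ⟨g, ⟨d, hd, hd', hg⟩, hg.2 hlow⟩
  obtain ⟨y₀, hy₀⟩ := exists_lt p
  obtain ⟨g₀, hg₀, -⟩ := hGcof y₀ hy₀
  obtain ⟨g, hg, hmax⟩ := hGfin.exists_maximal ⟨g₀, hg₀⟩
  obtain ⟨y, hgy, hyp⟩ := exists_between (hGlt g hg)
  obtain ⟨g', hg', hyg'⟩ := hGcof y hyp
  exact (hmax hg' (hgy.le.trans hyg')).not_gt (hgy.trans_le hyg')

end DownwardOMinimal

/-- Let `M` be a structure expanding a dense linear order without
endpoints that is downward o-minimal but not upward o-minimal.  Then `M` satisfies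
condition (†)⁺: for every formula `φ(x, ȳ)` with parameters from `M` (equivalently, every
subset `Φ` of `M^(1+n)` definable with parameters, `x` being the first coordinate) and
every `a ∈ M`, if `M ⊨ ∀ ȳ < a ∃ x φ(x, ȳ)`, then there exists `d ∈ M` such that
`M ⊨ ∀ ȳ < a ∃ x < d φ(x, ȳ)`. -/
theorem dagger_plus_of_downward_not_upward
    {L : FirstOrder.Language.{u, v}} [L.IsOrdered] {M : Type w}
    [LinearOrder M] [L.Structure M] [L.OrderedStructure M]
    [DenselyOrdered M] [NoMinOrder M] [NoMaxOrder M]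
    (hdown : IsDownwardOMinimal L M) (hnotup : ¬ IsUpwardOMinimal L M) :
    ∀ (n : ℕ) (Φ : Set (Fin (n + 1) → M)), (Set.univ : Set M).Definable L Φ →
      ∀ a : M,
        (∀ y : Fin n → M, (∀ k, y k < a) → ∃ x : M, Fin.cons x y ∈ Φ) →
        ∃ d : M, ∀ y : Fin n → M, (∀ k, y k < a) → ∃ x : M, x < d ∧ Fin.cons x y ∈ Φ := by
  obtain ⟨D, hD, hDinf, hDfin⟩ := exists_definable_infinite_of_not_upward hdown hnotup
  intro n
  induction n with
  | zero =>
    intro Φ _ a h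
    obtain ⟨x, hx⟩ := h Fin.elim0 fun k => k.elim0
    obtain ⟨d, hd⟩ := exists_gt x
    exact ⟨d, fun y _ => ⟨x, hd, Subsingleton.elim Fin.elim0 y ▸ hx⟩⟩
  | succ n ih =>
    intro Φ hΦ a h
    let B : M → M → Prop := fun d y => y < a ∧ ¬ ∀ z : Fin n → M, (∀ k, z k < a) →
      ∃ x, x < d ∧ (Fin.cons x (Fin.cons y z : Fin (n + 1) → M) : Fin (n + 2) → M) ∈ Φ
    have hB : DefPred L (fun v : Fin 2 → M => B (v 0) (v 1)) := by
      refine .and (.lt (.var _) (.const _)) (DefPred.not (.forall_tuple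
        (.imp (.forall_finite fun k => .lt (.var _) (.const _))
          (.ex (.and (.lt (.var _) (.var _)) (DefPred.subst hΦ fun i => ?_))))))
      refine Fin.cases ?_ (fun i => Fin.cases ?_ (fun i => ?_) i) i
      · exact .var _
      · exact .var _
      · exact .var _
    by_contra! hbad
    obtain ⟨y, hy⟩ := exists_forall_of_antitone_family hdown hD hDinf hDfin hB
      (fun d e y hde hy => ⟨hy.1, fun hall => hy.2 fun z hz =>
        let ⟨x, hx, hmem⟩ := hall z hz
        ⟨x, hx.trans_le hde, hmem⟩⟩) (fun d y hy => hy.1) (fun d => by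
        obtain ⟨y, hya, hy⟩ := hbad d
        refine ⟨y 0, hya 0, fun hall => ?_⟩
        obtain ⟨x, hx, hmem⟩ := hall (Fin.tail y) fun k => hya k.succ
        rw [Fin.cons_self_tail] at hmem
        exact hy x hx hmem)
    have hΦy : (Set.univ : Set M).Definable L {w : Fin (n + 1) → M |
        (Fin.cons (w 0) (Fin.cons y (Fin.tail w) : Fin (n + 1) → M) : Fin (n + 2) → M) ∈ Φ} := by
      refine DefPred.subst hΦ fun i => ?_
      refine Fin.cases ?_ (fun i => Fin.cases ?_ (fun i => ?_) i) i
      · exact .var _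
      · exact .const _
      · exact .var _
    obtain ⟨d, hd⟩ := ih _ hΦy a fun z hz => by
      obtain ⟨x, hx⟩ := h (Fin.cons y z) fun k => by
        cases k using Fin.cases with
        | zero => exact (hy y).1
        | succ k => exact hz k
      exact ⟨x, by simpa using hx⟩
    exact (hy d).2 fun z hz => by simpa using hd z hz
end

section
/- Let M = (M,<,…) be an almost o-minimal structure that is neither downward o-minimal nor upward o-minimal. Then M satisfies condition (†): for every formula φ(x,ȳ) with parameters from M and all a,b ∈ M, if M ⊨ ∀ȳ ∈ (a,b) ∃x φ(x,ȳ), then there exist d,e ∈ M such that M ⊨ ∀ȳ ∈ (a,b) ∃x ∈ (d,e) φ(x,ȳ). -/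
open FirstOrder FirstOrder.Language

universe u v w x

section Definability

variable {L : FirstOrder.Language.{u, v}} {M : Type w} [L.Structure M]
  {α : Type*} {β : Type*}

/-- A predicate on tuples is definable with arbitrary parameters. -/
def DefinablePred (L : FirstOrder.Language.{u, v}) {M : Type w} [L.Structure M] {α : Type*}
    (p : (α → M) → Prop) : Prop :=
  (Set.univ : Set M).Definable L {v | p v}

namespace DefinablePred

theorem and {p q : (α → M) → Prop} (hp : DefinablePred L p) (hq : DefinablePred L q) :
    DefinablePred L fun v => p v ∧ q v :=
  Set.Definable.inter hp hq

theorem not {p : (α → M) → Prop} (hp : DefinablePred L p) : DefinablePred L fun v => ¬ p v :=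
  Set.Definable.compl hp

theorem imp {p q : (α → M) → Prop} (hp : DefinablePred L p) (hq : DefinablePred L q) :
    DefinablePred L fun v => p v → q v := by
  simpa only [not_and, not_not] using (hp.and hq.not).not

theorem forallFinite {ι : Type*} [Finite ι] {p : ι → (α → M) → Prop}
    (hp : ∀ i, DefinablePred L (p i)) : DefinablePred L fun v => ∀ i, p i v := by
  have h := Set.definable_iInter_of_finite hp
  rwa [← Set.ofPred_forall] at h

theorem existsTuple [Finite β] {p : (α → M) → (β → M) → Prop}
    (hp : DefinablePred L fun w : α ⊕ β → M => p (fun i => w (.inl i)) (fun i => w (.inr i))) :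
    DefinablePred L fun v => ∃ x, p v x :=
  Set.Definable.exists_of_finite hp

theorem forallTuple [Finite β] {p : (α → M) → (β → M) → Prop}
    (hp : DefinablePred L fun w : α ⊕ β → M => p (fun i => w (.inl i)) (fun i => w (.inr i))) :
    DefinablePred L fun v => ∀ x, p v x :=
  Set.Definable.forall_of_finite hp

theorem existsElem {p : (α → M) → M → Prop}
    (hp : DefinablePred L fun w : α ⊕ Unit → M => p (fun i => w (.inl i)) (w (.inr ()))) :
    DefinablePred L fun v => ∃ x, p v x := by
  have h := existsTuple (p := fun v (x : Unit → M) => p v (x ())) hp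
  convert! h using 3 with v
  exact ⟨fun ⟨x, hx⟩ => ⟨fun _ => x, hx⟩, fun ⟨x, hx⟩ => ⟨x (), hx⟩⟩

theorem forallElem {p : (α → M) → M → Prop}
    (hp : DefinablePred L fun w : α ⊕ Unit → M => p (fun i => w (.inl i)) (w (.inr ()))) :
    DefinablePred L fun v => ∀ x, p v x := by
  simpa only [not_exists, not_not] using (existsElem (p := fun v x => ¬ p v x) hp.not).not

/-- Substituting definable functions into a definable predicate. -/
theorem comp [Finite β] {p : (β → M) → Prop} (hp : DefinablePred L p) {F : (α → M) → β → M}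
    (hF : ∀ i, (Set.univ : Set M).DefinableFun L fun v => F v i) :
    DefinablePred L fun v => p (F v) :=
  Set.Definable.preimage_map (F := F) hF hp

theorem mem {s : Set M} (hs : (Set.univ : Set M).Definable₁ L s) {f : (α → M) → M}
    (hf : (Set.univ : Set M).DefinableFun L f) : DefinablePred L fun v => f v ∈ s :=
  comp (p := fun v : Fin 1 → M => v 0 ∈ s) hs (F := fun v _ => f v) fun _ => hf

theorem rel {r : M → M → Prop} (hr : DefinablePred L fun v : Fin 2 → M => r (v 0) (v 1))
    {f g : (α → M) → M} (hf : (Set.univ : Set M).DefinableFun L f)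
    (hg : (Set.univ : Set M).DefinableFun L g) : DefinablePred L fun v => r (f v) (g v) :=
  comp hr (F := fun v => ![f v, g v]) (Fin.forall_fin_two.2 ⟨hf, hg⟩)

theorem le [L.IsOrdered] [LinearOrder M] [L.OrderedStructure M] {f g : (α → M) → M}
    (hf : (Set.univ : Set M).DefinableFun L f) (hg : (Set.univ : Set M).DefinableFun L g) :
    DefinablePred L fun v => f v ≤ g v := by
  refine rel ?_ hf hg
  have h : (∅ : Set M).Definable L {v : Fin 2 → M | v 0 ≤ v 1} :=
    Set.empty_definable_iff.2
      ⟨Term.le (Term.var (.inl 0)) (Term.var (.inl 1)), by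
        ext v; simp [Formula.Realize]⟩
  exact h.mono (Set.empty_subset _)

theorem lt [L.IsOrdered] [LinearOrder M] [L.OrderedStructure M] {f g : (α → M) → M}
    (hf : (Set.univ : Set M).DefinableFun L f) (hg : (Set.univ : Set M).DefinableFun L g) :
    DefinablePred L fun v => f v < g v := by
  simpa only [not_le] using (le hg hf).not

end DefinablePred

theorem definableFun_const_univ (c : M) :
    (Set.univ : Set M).DefinableFun L fun _ : α → M => c :=
  definableFun_const L α (Set.mem_univ c)

end Definability

section Boundary

variable {M : Type w} [LinearOrder M]

/-- The boundary of `s` in the order topology. -/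
def orderBoundary (s : Set M) : Set M :=
  {t | ∀ p q, p < t → t < q → (∃ u, p < u ∧ u < q ∧ u ∈ s) ∧ ∃ u, p < u ∧ u < q ∧ u ∉ s}

/-- Membership in `s` is constant on closed intervals that miss `E`. -/
def ConstantOff (s : Set M) (E : Finset M) : Prop :=
  ∀ p q, p ≤ q → (∀ e ∈ E, p ≤ e → ¬ e ≤ q) → (p ∈ s ↔ q ∈ s)

theorem exists_nhd_of_notMem_orderBoundary {s : Set M} {t : M} (ht : t ∉ orderBoundary s) :
    ∃ p q, p < t ∧ t < q ∧ ∀ u, p < u → u < q → (u ∈ s ↔ t ∈ s) := by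
  simp only [orderBoundary, Set.mem_ofPred_eq, not_forall] at ht
  obtain ⟨p, q, hp, hq, h⟩ := ht
  refine ⟨p, q, hp, hq, fun u hu hu' => ?_⟩
  by_contra hne
  grind

theorem orderBoundary_inter_Ioo {s : Set M} {p q t : M} (hp : p < t) (hq : t < q) :
    t ∈ orderBoundary (s ∩ Set.Ioo p q) ↔ t ∈ orderBoundary s := by
  constructor
  · intro h p' q' hp' hq'
    obtain ⟨⟨u, hu⟩, x, hx⟩ := h (max p p') (min q q') (max_lt hp hp') (lt_min hq hq')
    simp only [max_lt_iff, lt_min_iff, Set.mem_inter_iff, Set.mem_Ioo] at hu hx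
    grind
  · intro h p' q' hp' hq'
    obtain ⟨⟨u, hu⟩, x, hx⟩ := h (max p p') (min q q') (max_lt hp hp') (lt_min hq hq')
    simp only [max_lt_iff, lt_min_iff] at hu hx
    exact ⟨⟨u, by grind⟩, x, by grind⟩

theorem IsOpenIntervalSet.exists_constantOff {s : Set M} (hs : IsOpenIntervalSet s) :
    ∃ E, ConstantOff s E := by
  rcases hs with ⟨a, b, rfl⟩ | ⟨a, rfl⟩ | ⟨b, rfl⟩ | rfl
  · refine ⟨{a, b}, fun p q hpq h => ?_⟩
    have ha := h a (by simp)
    have hb := h b (by simp)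
    simp only [Set.mem_Ioo]
    grind
  · refine ⟨{a}, fun p q hpq h => ?_⟩
    simp only [Finset.mem_singleton, Set.mem_Ioi] at h ⊢
    grind
  · refine ⟨{b}, fun p q hpq h => ?_⟩
    simp only [Finset.mem_singleton, Set.mem_Iio] at h ⊢
    grind
  · exact ⟨∅, fun p q _ _ => by simp⟩

theorem IsFinUnionPointsIntervals.exists_constantOff {s : Set M}
    (hs : IsFinUnionPointsIntervals s) : ∃ E, ConstantOff s E := by
  obtain ⟨F, n, J, hJ, rfl⟩ := hs
  choose E hE using fun k => (hJ k).exists_constantOff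
  refine ⟨F ∪ Finset.univ.biUnion E, fun p q hpq h => ?_⟩
  simp only [Finset.mem_union, Finset.mem_biUnion, Finset.mem_univ, true_and] at h
  have hk : ∀ k, p ∈ J k ↔ q ∈ J k := fun k =>
    hE k p q hpq fun e he => h e (.inr ⟨k, he⟩)
  have hp : p ∉ F := fun hp => h p (.inl hp) le_rfl hpq
  have hq : q ∉ F := fun hq => h q (.inl hq) hpq le_rfl
  simp [hp, hq, hk]

theorem ConstantOff.isFinUnionPointsIntervals {s : Set M} {E : Finset M}
    (hE : ConstantOff s E) : IsFinUnionPointsIntervals s := by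
  classical
  let K : Set (Set M) :=
    (Set.image2 Set.Ioo E E ∪ Set.Ioi '' E ∪ Set.Iio '' E ∪ {Set.univ}) ∩ {J | J ⊆ s}
  have hK : K.Finite :=
    (((((E.finite_toSet.image2 _ E.finite_toSet).union (E.finite_toSet.image _)).union
      (E.finite_toSet.image _)).union (Set.finite_singleton _))).inter_of_left _
  have hKopen : ∀ J ∈ K, IsOpenIntervalSet J := by
    rintro J ⟨((⟨a, _, b, _, rfl⟩ | ⟨a, _, rfl⟩) | ⟨b, _, rfl⟩) | rfl, _⟩
    · exact .inl ⟨a, b, rfl⟩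
    · exact .inr (.inl ⟨a, rfl⟩)
    · exact .inr (.inr (.inl ⟨b, rfl⟩))
    · exact .inr (.inr (.inr rfl))
  have hcover : ∀ t ∈ s, t ∉ E → ∃ J ∈ K, t ∈ J := by
    intro t hts htE
    have key : ∀ u, (∀ e ∈ E, min t u ≤ e → ¬ e ≤ max t u) → u ∈ s := by
      intro u hu
      rcases le_total t u with h | h
      · exact (hE t u h (by simpa [h] using hu)).1 hts
      · exact (hE u t h (by simpa [h] using hu)).2 hts
    have hbelow : (∀ e ∈ E, t < e) ∨ ∃ a ∈ E, a < t ∧ ∀ e ∈ E, e < t → e ≤ a := by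
      rcases (E.filter (· < t)).eq_empty_or_nonempty with h | h
      · left
        intro e he
        have := Finset.filter_eq_empty_iff.1 h he
        exact lt_of_le_of_ne (not_lt.1 this) (by grind)
      · obtain ⟨a, ha, hmax⟩ := Finset.exists_max_image _ id h
        simp only [Finset.mem_filter, id] at ha hmax
        exact .inr ⟨a, ha.1, ha.2, fun e he het => hmax e ⟨he, het⟩⟩
    have habove : (∀ e ∈ E, e < t) ∨ ∃ b ∈ E, t < b ∧ ∀ e ∈ E, t < e → b ≤ e := by
      rcases (E.filter (t < ·)).eq_empty_or_nonempty with h | h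
      · left
        intro e he
        have := Finset.filter_eq_empty_iff.1 h he
        exact lt_of_le_of_ne (not_lt.1 this) (by grind)
      · obtain ⟨b, hb, hmin⟩ := Finset.exists_min_image _ id h
        simp only [Finset.mem_filter, id] at hb hmin
        exact .inr ⟨b, hb.1, hb.2, fun e he het => hmin e ⟨he, het⟩⟩
    rcases hbelow with ha | ⟨a, haE, hat, ha⟩ <;> rcases habove with hb | ⟨b, hbE, htb, hb⟩
    · exact ⟨Set.univ, ⟨.inr rfl, fun u _ => key u fun e he => by grind⟩, trivial⟩
    · exact ⟨Set.Iio b, ⟨.inl (.inr ⟨b, hbE, rfl⟩),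
        fun u hu => key u fun e he => by grind⟩, htb⟩
    · exact ⟨Set.Ioi a, ⟨.inl (.inl (.inr ⟨a, haE, rfl⟩)),
        fun u hu => key u fun e he => by grind⟩, hat⟩
    · exact ⟨Set.Ioo a b, ⟨.inl (.inl (.inl ⟨a, haE, b, hbE, rfl⟩)),
        fun u hu => key u fun e he => by grind⟩, hat, htb⟩
  have : Finite K := hK
  obtain ⟨n, ⟨f⟩⟩ := Finite.exists_equiv_fin K
  refine ⟨E.filter (· ∈ s), n, fun k => (f.symm k : Set M), fun k => hKopen _ (f.symm k).2, ?_⟩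
  ext t
  simp only [Finset.coe_filter, Set.mem_union, Set.mem_ofPred_eq, Set.mem_iUnion]
  constructor
  · intro ht
    by_cases htE : t ∈ E
    · exact .inl ⟨htE, ht⟩
    · obtain ⟨J, hJ, htJ⟩ := hcover t ht htE
      exact .inr ⟨f ⟨J, hJ⟩, by simpa using htJ⟩
  · rintro (h | ⟨k, hk⟩)
    · exact h.2
    · exact (f.symm k).2.2 hk

theorem exists_Ioo_notMem [NoMinOrder M] [NoMaxOrder M] (E : Finset M) {t : M} (ht : t ∉ E) :
    ∃ p q, p < t ∧ t < q ∧ ∀ e ∈ E, p < e → ¬ e < q := by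
  induction E using Finset.induction_on with
  | empty =>
    obtain ⟨p, hp⟩ := exists_lt t
    obtain ⟨q, hq⟩ := exists_gt t
    exact ⟨p, q, hp, hq, by simp⟩
  | insert a E _ ih =>
    obtain ⟨hta, htE⟩ : t ≠ a ∧ t ∉ E := by simpa using ht
    obtain ⟨p, q, hp, hq, h⟩ := ih htE
    rcases lt_or_gt_of_ne hta with hlt | hlt
    · exact ⟨p, min q a, hp, lt_min hq hlt, by grind⟩
    · exact ⟨max p a, q, max_lt hp hlt, hq, by grind⟩

theorem ConstantOff.orderBoundary_subset [NoMinOrder M] [NoMaxOrder M] {s : Set M}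
    {E : Finset M} (hE : ConstantOff s E) : orderBoundary s ⊆ E := by
  intro t ht
  by_contra htE
  obtain ⟨p, q, hp, hq, h⟩ := exists_Ioo_notMem E htE
  obtain ⟨⟨x, hpx, hxq, hx⟩, y, hpy, hyq, hy⟩ := ht p q hp hq
  have key : ∀ u, p < u → u < q → (u ∈ s ↔ t ∈ s) := by
    intro u hpu huq
    rcases le_total u t with hut | hut
    · exact hE u t hut fun e he h1 h2 => h e he (hpu.trans_le h1) (h2.trans_lt hq)
    · exact (hE t u hut fun e he h1 h2 => h e he (hp.trans_le h1) (h2.trans_lt huq)).symm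
  exact hy ((key y hpy hyq).2 ((key x hpx hxq).1 hx))

theorem ConstantOff.erase [DenselyOrdered M] {s : Set M} {E : Finset M}
    (hE : ConstantOff s E) {e : M} (he : e ∉ orderBoundary s) : ConstantOff s (E.erase e) := by
  intro p q hpq h
  by_cases hmem : p ≤ e ∧ e ≤ q
  · obtain ⟨p', q', hp', hq', hc⟩ := exists_nhd_of_notMem_orderBoundary he
    have hpe : p ∈ s ↔ e ∈ s := by
      rcases hmem.1.eq_or_lt with rfl | hlt
      · rfl
      · obtain ⟨x, hx, hxe⟩ := exists_between (max_lt hlt hp')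
        rw [max_lt_iff] at hx
        refine (hE p x hx.1.le fun y hy h1 h2 => ?_).trans (hc x hx.2 (hxe.trans hq'))
        exact h y (Finset.mem_erase.2 ⟨(h2.trans_lt hxe).ne, hy⟩) h1
          ((h2.trans hxe.le).trans hmem.2)
    have heq : q ∈ s ↔ e ∈ s := by
      rcases hmem.2.eq_or_lt with rfl | hlt
      · rfl
      · obtain ⟨x, hxe, hx⟩ := exists_between (lt_min hlt hq')
        rw [lt_min_iff] at hx
        refine (hE x q hx.1.le fun y hy h1 h2 => ?_).symm.trans (hc x (hp'.trans hxe) hx.2)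
        exact h y (Finset.mem_erase.2 ⟨(hxe.trans_le h1).ne', hy⟩)
          ((hmem.1.trans hxe.le).trans h1) h2
    exact hpe.trans heq.symm
  · refine hE p q hpq fun y hy h1 h2 => ?_
    exact h y (Finset.mem_erase.2 ⟨fun hye => hmem ⟨hye ▸ h1, hye ▸ h2⟩, hy⟩) h1 h2

theorem ConstantOff.exists_subset_orderBoundary [DenselyOrdered M] {s : Set M} {E : Finset M}
    (hE : ConstantOff s E) : ∃ E', ConstantOff s E' ∧ ∀ e ∈ E', e ∈ orderBoundary s := by
  induction E using Finset.strongInduction with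
  | H E ih =>
    by_cases h : ∀ e ∈ E, e ∈ orderBoundary s
    · exact ⟨E, hE, h⟩
    · push Not at h
      obtain ⟨e, heE, he⟩ := h
      exact ih _ (Finset.erase_ssubset heE) (hE.erase he)

end Boundary

section AlmostOMinimal

variable {L : FirstOrder.Language.{u, v}} [L.IsOrdered] {M : Type w}
  [LinearOrder M] [L.Structure M] [L.OrderedStructure M]

theorem DefinablePred.mem_orderBoundary {α : Type*} {p : (α → M) → M → Prop}
    (hp : DefinablePred L fun w : α ⊕ Unit → M => p (fun i => w (.inl i)) (w (.inr ())))
    {f : (α → M) → M} (hf : (Set.univ : Set M).DefinableFun L f) :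
    DefinablePred L fun v => f v ∈ orderBoundary {u | p v u} := by
  have hp' : DefinablePred L fun w : ((α ⊕ Unit) ⊕ Unit) ⊕ Unit → M =>
      p (fun i => w (.inl (.inl (.inl i)))) (w (.inr ())) :=
    Set.Definable.preimage_comp
      (Sum.map (fun i => (.inl (.inl i) : (α ⊕ Unit) ⊕ Unit)) id : α ⊕ Unit → _) hp
  have hf' : (Set.univ : Set M).DefinableFun L
      fun w : (α ⊕ Unit) ⊕ Unit → M => f fun i => w (.inl (.inl i)) :=
    Set.Definable.preimage_comp
      (Option.map fun i : α => (.inl (.inl i) : (α ⊕ Unit) ⊕ Unit)) hf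
  refine forallElem (forallElem (imp (lt (.proj L) hf') (imp (lt hf' (.proj L)) (and ?_ ?_))))
  · exact existsElem (and (lt (.proj L) (.proj L)) (and (lt (.proj L) (.proj L)) hp'))
  · exact existsElem (and (lt (.proj L) (.proj L)) (and (lt (.proj L) (.proj L)) hp'.not))

theorem definable₁_inter_Ioo {s : Set M} (hs : (Set.univ : Set M).Definable₁ L s) (p q : M) :
    (Set.univ : Set M).Definable₁ L (s ∩ Set.Ioo p q) :=
  DefinablePred.and hs
    (.and (.lt (definableFun_const_univ p) (.proj L)) (.lt (.proj L) (definableFun_const_univ q)))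

theorem definable₁_orderBoundary {s : Set M} (hs : (Set.univ : Set M).Definable₁ L s) :
    (Set.univ : Set M).Definable₁ L (orderBoundary s) :=
  DefinablePred.mem_orderBoundary (p := fun _ u => u ∈ s) (.mem hs (.proj L)) (.proj L)

theorem IsAlmostOMinimal.isFinUnion_inter_Ioo
    (halmost : IsAlmostOMinimal L M) {s : Set M}
    (hs : (Set.univ : Set M).Definable₁ L s) (p q : M) :
    IsFinUnionPointsIntervals (s ∩ Set.Ioo p q) :=
  halmost _ (definable₁_inter_Ioo hs p q) (bddAbove_Ioo.mono Set.inter_subset_right)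
    (bddBelow_Ioo.mono Set.inter_subset_right)

variable [NoMinOrder M] [NoMaxOrder M]

theorem IsAlmostOMinimal.finite_orderBoundary_inter_Ioo
    (halmost : IsAlmostOMinimal L M) {s : Set M}
    (hs : (Set.univ : Set M).Definable₁ L s) (p q : M) :
    (orderBoundary s ∩ Set.Ioo p q).Finite := by
  obtain ⟨E, hE⟩ := (halmost.isFinUnion_inter_Ioo hs p q).exists_constantOff
  refine E.finite_toSet.subset fun t ht => hE.orderBoundary_subset ?_
  exact (orderBoundary_inter_Ioo ht.2.1 ht.2.2).2 ht.1

theorem IsAlmostOMinimal.exists_Ioo_subset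
    (halmost : IsAlmostOMinimal L M) {s : Set M}
    (hs : (Set.univ : Set M).Definable₁ L s) {a b : M} (hab : s ⊆ Set.Icc a b)
    (hinf : s.Infinite) : ∃ p t q, p < t ∧ t < q ∧ Set.Ioo p q ⊆ s := by
  obtain ⟨a', ha'⟩ := exists_lt a
  obtain ⟨b', hb'⟩ := exists_gt b
  obtain ⟨t, hts, ht⟩ := (hinf.sdiff (halmost.finite_orderBoundary_inter_Ioo hs a' b')).nonempty
  have htb : t ∉ orderBoundary s := fun h =>
    ht ⟨h, ha'.trans_le (hab hts).1, (hab hts).2.trans_lt hb'⟩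
  obtain ⟨p, q, hp, hq, h⟩ := exists_nhd_of_notMem_orderBoundary htb
  exact ⟨p, t, q, hp, hq, fun u hu => (h u hu.1 hu.2).2 hts⟩

variable [DenselyOrdered M]

theorem IsAlmostOMinimal.mem_iff_mem
    (halmost : IsAlmostOMinimal L M) {s : Set M} (hs : (Set.univ : Set M).Definable₁ L s)
    {p q : M} (hpq : p ≤ q) (h : ∀ t ∈ orderBoundary s, p ≤ t → ¬ t ≤ q) : p ∈ s ↔ q ∈ s := by
  obtain ⟨p', hp'⟩ := exists_lt p
  obtain ⟨q', hq'⟩ := exists_gt q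
  obtain ⟨E, hE⟩ := (halmost.isFinUnion_inter_Ioo hs p' q').exists_constantOff
  obtain ⟨E', hE', hsub⟩ := hE.exists_subset_orderBoundary
  have := hE' p q hpq fun e he h1 h2 => h e
    ((orderBoundary_inter_Ioo (hp'.trans_le h1) (h2.trans_lt hq')).1 (hsub e he)) h1 h2
  simpa [hp', hq', hp'.trans_le hpq, hpq.trans_lt hq'] using this

theorem IsAlmostOMinimal.infinite_orderBoundary
    (halmost : IsAlmostOMinimal L M) {s : Set M}
    (hs : (Set.univ : Set M).Definable₁ L s) (hfin : ¬ IsFinUnionPointsIntervals s) :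
    (orderBoundary s).Infinite := by
  intro h
  refine hfin (ConstantOff.isFinUnionPointsIntervals (E := h.toFinset) fun p q hpq hE => ?_)
  exact halmost.mem_iff_mem hs hpq fun t ht => hE t (h.mem_toFinset.2 ht)

/-- A bounded union of a definable family of finite sets is finite, if the index set is
totally ordered by a definable relation with finite initial segments. -/
theorem IsAlmostOMinimal.finite_iUnion
    (halmost : IsAlmostOMinimal L M) {D : Set M} (hD : (Set.univ : Set M).Definable₁ L D)
    {r : M → M → Prop} (hr : DefinablePred L fun v : Fin 2 → M => r (v 0) (v 1))
    (htotal : ∀ d d', r d d' ∨ r d' d) (hinit : ∀ d, {d' ∈ D | r d' d}.Finite)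
    {B : M → M → Prop} (hB : DefinablePred L fun v : Fin 2 → M => B (v 0) (v 1))
    (hfin : ∀ d ∈ D, {t | B d t}.Finite) {a b : M}
    (hab : ∀ d ∈ D, ∀ t, B d t → t ∈ Set.Icc a b) : {t | ∃ d ∈ D, B d t}.Finite := by
  by_contra hinf
  have hWdef : (Set.univ : Set M).Definable₁ L {t | ∃ d ∈ D, B d t} :=
    DefinablePred.existsElem (.and (.mem hD (.proj L)) (.rel hB (.proj L) (.proj L)))
  obtain ⟨p, x, q, hpx, hxq, hsub⟩ := halmost.exists_Ioo_subset hWdef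
    (by rintro t ⟨d, hd, ht⟩; exact hab d hd t ht) hinf
  let C : M → M → Prop := fun d t => ∃ d', (d' ∈ D ∧ r d' d) ∧ B d' t
  have hC : DefinablePred L fun v : Fin 2 → M => C (v 0) (v 1) :=
    .existsElem (.and (.and (.mem hD (.proj L)) (.rel hr (.proj L) (.proj L)))
      (.rel hB (.proj L) (.proj L)))
  have hCfin : ∀ d, {t | C d t}.Finite := by
    intro d
    refine ((hinit d).biUnion fun d' hd' => hfin d' hd'.1).subset ?_
    rintro t ⟨d', hd', ht⟩
    exact Set.mem_biUnion hd' ht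
  have hCrefl : ∀ d ∈ D, ∀ t, B d t → C d t := fun d hd t ht =>
    ⟨d, ⟨hd, (htotal d d).elim id id⟩, ht⟩
  -- points of the interval that are last among those appearing up to some stage
  let H : Set M := {t | (p < t ∧ t < q) ∧
    ∃ d, d ∈ D ∧ C d t ∧ ∀ t', t < t' → t' < q → ¬ C d t'}
  have hHdef : (Set.univ : Set M).Definable₁ L H :=
    DefinablePred.and
      (.and (.lt (definableFun_const_univ p) (.proj L)) (.lt (.proj L) (definableFun_const_univ q)))
      (.existsElem (.and (.mem hD (.proj L)) (.and (.rel hC (.proj L) (.proj L))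
        (.forallElem (.imp (.lt (.proj L) (.proj L)) (.imp (.lt (.proj L) (definableFun_const_univ q))
          (.not (.rel hC (.proj L) (.proj L)))))))))
  have hcofinal : ∀ t, p < t → t < q → ∃ m ∈ H, t ≤ m := by
    intro t hpt htq
    obtain ⟨d, hd, hdt⟩ := hsub ⟨hpt, htq⟩
    obtain ⟨m, ⟨⟨hm, htm, hmq⟩, hmax⟩⟩ := ((hCfin d).inter_of_left (Set.Ico t q)).exists_maximal
      ⟨t, hCrefl d hd t hdt, le_rfl, htq⟩
    refine ⟨m, ⟨⟨hpt.trans_le htm, hmq⟩, d, hd, hm, fun t' hmt' ht'q ht' => ?_⟩, htm⟩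
    exact hmt'.not_ge (hmax ⟨ht', htm.trans hmt'.le, ht'q⟩ hmt'.le)
  have hHinf : H.Infinite := by
    intro hH
    obtain ⟨m₀, hm₀, _⟩ := hcofinal x hpx hxq
    obtain ⟨m, hm, hmax⟩ := hH.exists_maximal ⟨m₀, hm₀⟩
    obtain ⟨t, hmt, htq⟩ := exists_between hm.1.2
    obtain ⟨m', hm', htm'⟩ := hcofinal t (hm.1.1.trans hmt) htq
    exact (hmt.trans_le htm').not_ge (hmax hm' (hmt.trans_le htm').le)
  obtain ⟨p', h, q', hp'h, hhq', hsubH⟩ := halmost.exists_Ioo_subset hHdef (a := p) (b := q)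
    (fun t ht => ⟨ht.1.1.le, ht.1.2.le⟩) hHinf
  obtain ⟨⟨_, hhq⟩, d, hd, ⟨d₁, hd₁, hBh⟩, _⟩ := hsubH ⟨hp'h, hhq'⟩
  refine Set.Ioo_infinite hp'h (((hinit d₁).biUnion fun e _ => hCfin e).subset fun t ht => ?_)
  obtain ⟨_, e, he, hCt, hlast⟩ := hsubH ⟨ht.1, ht.2.trans hhq'⟩
  refine Set.mem_biUnion ⟨he, (htotal e d₁).resolve_right fun hr₁ => ?_⟩ hCt
  exact hlast h ht.2 hhq ⟨d₁, ⟨hd₁.1, hr₁⟩, hBh⟩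

/-- If each point of `(a, b)` lies in only finitely many members of a definable family of sets
indexed by an infinite `D`, then some member of the family misses `(a, b)`. -/
theorem IsAlmostOMinimal.exists_forall_not
    (halmost : IsAlmostOMinimal L M) {D : Set M} (hD : (Set.univ : Set M).Definable₁ L D)
    (hDinf : D.Infinite)
    {r : M → M → Prop} (hr : DefinablePred L fun v : Fin 2 → M => r (v 0) (v 1))
    (htotal : ∀ d d', r d d' ∨ r d' d) (hinit : ∀ d, {d' ∈ D | r d' d}.Finite)
    {P : M → M → Prop} (hP : DefinablePred L fun v : Fin 2 → M => P (v 0) (v 1)) {a b : M}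
    (hfin : ∀ y ∈ Set.Ioo a b, {d ∈ D | P d y}.Finite) :
    ∃ d ∈ D, ∀ y ∈ Set.Ioo a b, ¬ P d y := by
  obtain ⟨a', ha'⟩ := exists_lt a
  obtain ⟨b', hb'⟩ := exists_gt b
  have hU : ∀ d, (Set.univ : Set M).Definable₁ L {y | P d y} := fun d =>
    DefinablePred.rel hP (definableFun_const_univ d) (.proj L)
  let W : Set M := {t | ∃ d ∈ D, t ∈ orderBoundary {y | P d y} ∧ a ≤ t ∧ t ≤ b}
  have hW : W.Finite := by
    refine halmost.finite_iUnion hD hr htotal hinit ?_ (fun d _ => ?_) (a := a) (b := b)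
      fun d _ t ht => ht.2
    · exact .and (.mem_orderBoundary (p := fun v u => P (v 0) u) (.rel hP (.proj L) (.proj L))
        (.proj L)) (.and (.le (definableFun_const_univ a) (.proj L))
        (.le (.proj L) (definableFun_const_univ b)))
    · refine (halmost.finite_orderBoundary_inter_Ioo (hU d) a' b').subset ?_
      rintro t ⟨ht, hat, htb⟩
      exact ⟨ht, ha'.trans_le hat, htb.trans_lt hb'⟩
  let g : M → Set M × Set M := fun y => (W ∩ Set.Iio y, W ∩ Set.Iic y)
  have hg : (g '' Set.Ioo a b).Finite := by
    refine (hW.finite_subsets.prod hW.finite_subsets).subset ?_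
    rintro _ ⟨y, _, rfl⟩
    exact ⟨Set.inter_subset_left, Set.inter_subset_left⟩
  have htransfer : ∀ d ∈ D, ∀ y ∈ Set.Ioo a b, ∀ z ∈ Set.Ioo a b, y < z → g y = g z →
      (P d y ↔ P d z) := by
    intro d hd y hy z hz hyz hgyz
    refine halmost.mem_iff_mem (hU d) hyz.le fun t ht hyt htz => ?_
    have htW : t ∈ W := ⟨d, hd, ht, hy.1.le.trans hyt, htz.trans hz.2.le⟩
    have hIio : W ∩ Set.Iio y = W ∩ Set.Iio z := congrArg Prod.fst hgyz
    have hIic : W ∩ Set.Iic y = W ∩ Set.Iic z := congrArg Prod.snd hgyz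
    rcases hyt.eq_or_lt with rfl | hlt
    · have : y ∈ W ∩ Set.Iio z := ⟨htW, hyz⟩
      rw [← hIio] at this
      exact lt_irrefl _ this.2
    · have : t ∈ W ∩ Set.Iic z := ⟨htW, htz⟩
      rw [← hIic] at this
      exact hlt.not_ge this.2
  obtain ⟨Y, hYsub, hY⟩ := Set.exists_subset_bijOn (Set.Ioo a b) g
  have hYfin : Y.Finite := hY.finite_iff_finite.2 hg
  obtain ⟨d, hd, hdY⟩ := (hDinf.sdiff (hYfin.biUnion fun y hy => hfin y (hYsub hy))).nonempty
  refine ⟨d, hd, fun y hy hPy => hdY ?_⟩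
  obtain ⟨z, hzY, hz⟩ := hY.surjOn (Set.mem_image_of_mem g hy)
  refine Set.mem_biUnion hzY ⟨hd, ?_⟩
  rcases lt_trichotomy y z with hlt | rfl | hlt
  · exact (htransfer d hd y hy z (hYsub hzY) hlt hz.symm).1 hPy
  · exact hPy
  · exact (htransfer d hd z (hYsub hzY) y hy hlt hz).2 hPy

theorem IsAlmostOMinimal.exists_infinite_finite_le
    (halmost : IsAlmostOMinimal L M) (hnotup : ¬ IsUpwardOMinimal L M) :
    ∃ D : Set M, (Set.univ : Set M).Definable₁ L D ∧ D.Infinite ∧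
      ∀ d, {d' ∈ D | d' ≤ d}.Finite := by
  simp only [IsUpwardOMinimal, not_forall] at hnotup
  obtain ⟨s, hs, ⟨c, hc⟩, hfin⟩ := hnotup
  refine ⟨_, definable₁_orderBoundary hs, halmost.infinite_orderBoundary hs hfin, fun d => ?_⟩
  obtain ⟨p, hp⟩ := exists_lt c
  obtain ⟨q, hq⟩ := exists_gt d
  refine (halmost.finite_orderBoundary_inter_Ioo hs p q).subset ?_
  rintro t ⟨ht, htd⟩
  refine ⟨ht, ?_, htd.trans_lt hq⟩
  by_contra! htp
  obtain ⟨p', hp'⟩ := exists_lt t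
  obtain ⟨⟨u, _, huc, hu⟩, _⟩ := ht p' c hp' (htp.trans_lt hp)
  exact (hc hu).not_gt huc

theorem IsAlmostOMinimal.exists_infinite_finite_ge
    (halmost : IsAlmostOMinimal L M) (hnotdown : ¬ IsDownwardOMinimal L M) :
    ∃ D : Set M, (Set.univ : Set M).Definable₁ L D ∧ D.Infinite ∧
      ∀ d, {d' ∈ D | d ≤ d'}.Finite := by
  simp only [IsDownwardOMinimal, not_forall] at hnotdown
  obtain ⟨s, hs, ⟨c, hc⟩, hfin⟩ := hnotdown
  refine ⟨_, definable₁_orderBoundary hs, halmost.infinite_orderBoundary hs hfin, fun d => ?_⟩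
  obtain ⟨p, hp⟩ := exists_lt d
  obtain ⟨q, hq⟩ := exists_gt c
  refine (halmost.finite_orderBoundary_inter_Ioo hs p q).subset ?_
  rintro t ⟨ht, hdt⟩
  refine ⟨ht, hp.trans_le hdt, ?_⟩
  by_contra! hqt
  obtain ⟨q', hq'⟩ := exists_gt t
  obtain ⟨⟨u, hcu, _, hu⟩, _⟩ := ht c q' (hq.trans_le hqt) hq'
  exact (hc hu).not_gt hcu

end AlmostOMinimal

/-- Let `M` be an almost o-minimal structure that is neither downward
o-minimal nor upward o-minimal.  Then `M` satisfies condition (†): for every formula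
`φ(x, ȳ)` with parameters from `M` (equivalently, every subset `Φ` of `M^(1+n)` definable
with parameters, `x` being the first coordinate) and all `a, b ∈ M`, if
`M ⊨ ∀ ȳ ∈ (a,b) ∃ x φ(x, ȳ)`, then there exist `d, e ∈ M` such that
`M ⊨ ∀ ȳ ∈ (a,b) ∃ x ∈ (d,e) φ(x, ȳ)`. -/
theorem dagger_of_neither_downward_nor_upward
    {L : FirstOrder.Language.{u, v}} [L.IsOrdered] {M : Type w}
    [LinearOrder M] [L.Structure M] [L.OrderedStructure M]
    [DenselyOrdered M] [NoMinOrder M] [NoMaxOrder M]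
    (halmost : IsAlmostOMinimal L M)
    (hnotdown : ¬ IsDownwardOMinimal L M) (hnotup : ¬ IsUpwardOMinimal L M) :
    ∀ (n : ℕ) (Φ : Set (Fin (n + 1) → M)), (Set.univ : Set M).Definable L Φ →
      ∀ a b : M,
        (∀ y : Fin n → M, (∀ k, y k ∈ Set.Ioo a b) → ∃ x : M, Fin.cons x y ∈ Φ) →
        ∃ d e : M, ∀ y : Fin n → M, (∀ k, y k ∈ Set.Ioo a b) →
          ∃ x ∈ Set.Ioo d e, Fin.cons x y ∈ Φ := by
  obtain ⟨D, hD, hDinf, hDinit⟩ := halmost.exists_infinite_finite_le hnotup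
  obtain ⟨E, hE, hEinf, hEinit⟩ := halmost.exists_infinite_finite_ge hnotdown
  intro n
  induction n with
  | zero =>
    intro Φ _ a b h
    obtain ⟨x, hx⟩ := h Fin.elim0 fun k => k.elim0
    obtain ⟨d, hd⟩ := exists_lt x
    obtain ⟨e, he⟩ := exists_gt x
    refine ⟨d, e, fun y _ => ⟨x, ⟨hd, he⟩, ?_⟩⟩
    rwa [Subsingleton.elim y Fin.elim0]
  | succ n ih =>
    intro Φ hΦ a b h
    let Q : M → M → M → Prop := fun d e y => ∀ z : Fin n → M,
      (∀ k, a < z k ∧ z k < b) → ∃ x, (d < x ∧ x < e) ∧ Fin.cons x (Fin.cons y z) ∈ Φ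
    have hQ : DefinablePred L fun v : Fin 3 → M => Q (v 0) (v 1) (v 2) := by
      refine .forallTuple (.imp (.forallFinite fun k => .and
        (.lt (definableFun_const_univ a) (.proj L)) (.lt (.proj L) (definableFun_const_univ b)))
        (.existsElem (.and (.and (.lt (.proj L) (.proj L)) (.lt (.proj L) (.proj L)))
          (.comp hΦ ?_))))
      exact Fin.cases (.proj L) (Fin.cases (.proj L) fun _ => .proj L)
    have hex : ∀ y ∈ Set.Ioo a b, ∃ d e, Q d e y := by
      intro y hy
      have hΦy : (Set.univ : Set M).Definable L
          {v : Fin (n + 1) → M | Fin.cons (v 0) (Fin.cons y (Fin.tail v)) ∈ Φ} :=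
        DefinablePred.comp hΦ
          (Fin.cases (.proj L) (Fin.cases (definableFun_const_univ y) fun _ => .proj L))
      obtain ⟨d, e, hde⟩ := ih _ hΦy a b fun z hz => h (Fin.cons y z) (Fin.cases hy hz)
      exact ⟨d, e, fun z hz => hde z hz⟩
    have hmono : ∀ d d' e e' y, d' ≤ d → e ≤ e' → Q d e y → Q d' e' y := by
      intro d d' e e' y hd he hQy z hz
      obtain ⟨x, hx, hxΦ⟩ := hQy z hz
      exact ⟨x, ⟨hd.trans_lt hx.1, hx.2.trans_le he⟩, hxΦ⟩
    obtain ⟨e, _, he⟩ := halmost.exists_forall_not hD hDinf (r := fun d d' => d ≤ d')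
      (P := fun e y => ¬ ∃ d, Q d e y) (.le (.proj L) (.proj L)) le_total hDinit
      (.not (.existsElem (.comp hQ
          (F := fun w : Fin 2 ⊕ Unit → M => ![w (.inr ()), w (.inl 0), w (.inl 1)])
        (by intro i; fin_cases i <;> exact .proj L))))
      (a := a) (b := b) (fun y hy => by
        obtain ⟨d, e, hde⟩ := hex y hy
        refine (hDinit e).subset fun e' he' => ⟨he'.1, ?_⟩
        by_contra! hlt
        exact he'.2 ⟨d, hmono d d e e' y le_rfl hlt.le hde⟩)
    obtain ⟨d, _, hd⟩ := halmost.exists_forall_not hE hEinf (r := fun d d' => d' ≤ d)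
      (P := fun d y => ¬ Q d e y) (.le (.proj L) (.proj L)) (fun d d' => le_total d' d) hEinit
      (.not (.comp hQ (F := fun w : Fin 2 → M => ![w 0, e, w 1])
        (by
          intro i
          fin_cases i
          exacts [.proj L, definableFun_const_univ e, .proj L])))
      (a := a) (b := b) (fun y hy => by
        obtain ⟨d, hde⟩ := not_not.1 (he y hy)
        refine (hEinit d).subset fun d' hd' => ⟨hd'.1, ?_⟩
        by_contra! hlt
        exact hd'.2 (hmono d d' e e y hlt.le le_rfl hde))
    refine ⟨d, e, fun y hy => ?_⟩
    obtain ⟨x, hx, hxΦ⟩ := not_not.1 (hd (y 0) (hy 0)) (Fin.tail y) fun k => hy k.succ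
    exact ⟨x, hx, by rwa [Fin.cons_self_tail] at hxΦ⟩
end
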